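/- arXiv:1112.1511 — 3 statements merged into one kernel-verified Lean document; each statement's English description precedes it below -/
import Mathlib

section
/- Let μ and ν be finite signed measures on ℝⁿ (n ≥ 2) with compact support. If there exists R > 0 such that μ̂(ζ,θ) = ν̂(ζ,θ) for all ζ ∈ ℂ with |ζ| > R and all θ ∈ S^{n-1}, then μ = ν. -/
open MeasureTheory Metric MvPolynomial

noncomputable section

/-- `ℝⁿ` as a Euclidean space. -/
abbrev En (n : ℕ) : Type := EuclideanSpace ℝ (Fin n)

/-- The Laplace operator `Δ = ∂²/∂x₁² + … + ∂²/∂xₙ²` acting on polynomials. -/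
def lap (n : ℕ) (P : MvPolynomial (Fin n) ℂ) : MvPolynomial (Fin n) ℂ :=
  ∑ i : Fin n, pderiv i (pderiv i P)

/-- A polynomial is harmonic if `ΔP = 0`. -/
def IsHarmonicPoly (n : ℕ) (P : MvPolynomial (Fin n) ℂ) : Prop := lap n P = 0

/-- The polyharmonic degree `d(P) = min {N : Δ^(N+1) P = 0}`. -/
def pdeg (n : ℕ) (P : MvPolynomial (Fin n) ℂ) : ℕ := sInf {N : ℕ | (lap n)^[N + 1] P = 0}

/-- Evaluation of a polynomial at a real point of `ℝⁿ`. -/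
def evalR {n : ℕ} (P : MvPolynomial (Fin n) ℂ) (x : En n) : ℂ :=
  eval (fun i => (x i : ℂ)) P

/-- Evaluation of a polynomial at `ζθ`, i.e. after substituting `ζ θ i` for `x i`. -/
def evalC {n : ℕ} (P : MvPolynomial (Fin n) ℂ) (ζ : ℂ) (θ : En n) : ℂ :=
  eval (fun i => ζ * (θ i : ℂ)) P

/-- The surface measure on the unit sphere `S^{n-1} ⊂ ℝⁿ`. -/
def sphereMeasure (n : ℕ) : Measure (sphere (0 : En n) 1) :=
  (volume : Measure (En n)).toSphere

/-- `ω_n`, the surface area of the unit sphere `S^{n-1}`. -/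
def omegaN (n : ℕ) : ℝ := ((sphereMeasure n) Set.univ).toReal

/-- The analytic continuation of `ζ ↦ r(ζθ − x)ⁿ = |ζθ − x|ⁿ` to `|ζ| > |x|`
(principal branch; for real `ζ = ρ > |x|` it equals `|ρθ − x|ⁿ`, for `θ` on the
unit sphere). -/
def rPow (n : ℕ) (ζ : ℂ) (θ x : En n) : ℂ :=
  ζ ^ n * (1 - 2 * ((inner ℝ θ x : ℝ) : ℂ) / ζ + ((‖x‖ : ℂ)) ^ 2 / ζ ^ 2) ^ ((n : ℂ) / 2)

/-- Integral of a complex-valued function against a finite signed measure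
(via the Jordan decomposition). -/
def sInt {α : Type*} [MeasurableSpace α] (μ : SignedMeasure α) (f : α → ℂ) : ℂ :=
  ∫ x, f x ∂μ.toJordanDecomposition.posPart - ∫ x, f x ∂μ.toJordanDecomposition.negPart

/-- The support of the signed measure `μ` is contained in the set `s`. -/
def SuppIn {α : Type*} [MeasurableSpace α] (μ : SignedMeasure α) (s : Set α) : Prop :=
  μ.totalVariation sᶜ = 0

/-- The multivariate Markov transform of a finite signed measure. -/
def markov {n : ℕ} (μ : SignedMeasure (En n)) (ζ : ℂ) (θ : En n) : ℂ :=
  (omegaN n : ℂ)⁻¹ * sInt μ fun x => ζ ^ (n - 1) / rPow n ζ θ x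

/-- The multivariate Markov transform of a (nonnegative) measure. -/
def markovM {n : ℕ} (μ : Measure (En n)) (ζ : ℂ) (θ : En n) : ℂ :=
  (omegaN n : ℂ)⁻¹ * ∫ x, ζ ^ (n - 1) / rPow n ζ θ x ∂μ

/-- The function of the second kind `Q_P` for a signed measure. -/
def qP {n : ℕ} (μ : SignedMeasure (En n)) (P : MvPolynomial (Fin n) ℂ) (ζ : ℂ) (θ : En n) : ℂ :=
  (omegaN n : ℂ)⁻¹ * sInt μ fun x => (evalC P ζ θ - evalR P x) * ζ ^ (n - 1) / rPow n ζ θ x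

/-- The function of the second kind `Q_P` for a (nonnegative) measure. -/
def qPM {n : ℕ} (μ : Measure (En n)) (P : MvPolynomial (Fin n) ℂ) (ζ : ℂ) (θ : En n) : ℂ :=
  (omegaN n : ℂ)⁻¹ * ∫ x, (evalC P ζ θ - evalR P x) * ζ ^ (n - 1) / rPow n ζ θ x ∂μ

/-- The rest function `R_P` for a signed measure. -/
def restP {n : ℕ} (μ : SignedMeasure (En n)) (P : MvPolynomial (Fin n) ℂ) (ζ : ℂ) (θ : En n) : ℂ :=
  (omegaN n : ℂ)⁻¹ * sInt μ fun x => evalR P x * ζ ^ (n - 1) / rPow n ζ θ x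

section MarkovAux

variable {n : ℕ}

lemma aux_int (A : Measure (En n)) [IsFiniteMeasure A] (r : ℝ)
    (hA : A (closedBall (0 : En n) r)ᶜ = 0) (f : En n → ℝ)
    (hf : ContinuousOn f (closedBall (0 : En n) r)) : Integrable f A := by
  have h1 : A.restrict (closedBall (0 : En n) r) = A :=
    Measure.restrict_eq_self_of_ae_mem (by rw [ae_iff]; exact hA)
  have := hf.integrableOn_compact (μ := A) (isCompact_closedBall (0 : En n) r)
  rwa [IntegrableOn, h1] at this

lemma aux_deriv1 (A : Measure (En n)) [IsFiniteMeasure A] (r : ℝ)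
    (hA : A (closedBall (0 : En n) r)ᶜ = 0)
    (f f' : En n → En n → ℝ) (v : En n)
    (hfc : ContinuousOn (Function.uncurry f) ({y | r < ‖y‖} ×ˢ closedBall (0 : En n) r))
    (hfc' : ContinuousOn (Function.uncurry f') ({y | r < ‖y‖} ×ˢ closedBall (0 : En n) r))
    (hd : ∀ y, r < ‖y‖ → ∀ x ∈ closedBall (0 : En n) r,
      HasDerivAt (fun t : ℝ => f (y + t • v) x) (f' y x) 0)
    (y : En n) (hy : r < ‖y‖) :
    HasDerivAt (fun t : ℝ => ∫ x, f (y + t • v) x ∂A) (∫ x, f' y x ∂A) 0 := by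
  have hUo : IsOpen {t : ℝ | r < ‖y + t • v‖} :=
    isOpen_lt continuous_const (by fun_prop)
  have h0 : (0 : ℝ) ∈ {t : ℝ | r < ‖y + t • v‖} := by simpa using hy
  obtain ⟨δ, hδ, hδs⟩ := Metric.nhds_basis_closedBall.mem_iff.1 (hUo.mem_nhds h0)
  have hsec : ∀ g : En n → En n → ℝ,
      ContinuousOn (Function.uncurry g) ({y | r < ‖y‖} ×ˢ closedBall (0 : En n) r) →
      ∀ z : En n, r < ‖z‖ → ContinuousOn (g z) (closedBall (0 : En n) r) := by
    intro g hg z hz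
    exact hg.comp (f := fun x => (z, x)) (by fun_prop) (fun x hx => ⟨hz, hx⟩)
  have hcomp : IsCompact (((fun t : ℝ => y + t • v) '' closedBall (0 : ℝ) δ) ×ˢ
      closedBall (0 : En n) r) :=
    ((isCompact_closedBall _ _).image (by fun_prop)).prod (isCompact_closedBall _ _)
  obtain ⟨C, hC⟩ := hcomp.exists_bound_of_continuousOn (hfc'.mono (by
    rintro ⟨a, b⟩ ⟨⟨t, ht, rfl⟩, hb⟩
    exact ⟨hδs ht, hb⟩))
  have hae : ∀ᵐ x ∂A, x ∈ closedBall (0 : En n) r := by rw [ae_iff]; exact hA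
  have key := hasDerivAt_integral_of_dominated_loc_of_deriv_le (μ := A) (𝕜 := ℝ)
    (F := fun t x => f (y + t • v) x) (F' := fun t x => f' (y + t • v) x) (x₀ := (0 : ℝ))
    (s := closedBall (0 : ℝ) δ) (bound := fun _ => C) (closedBall_mem_nhds _ hδ) ?_ ?_ ?_ ?_ ?_ ?_
  · simpa using key.2
  · filter_upwards [closedBall_mem_nhds (0 : ℝ) hδ] with t ht
    exact (aux_int A r hA _ (hsec f hfc _ (hδs ht))).aestronglyMeasurable
  · exact aux_int A r hA _ (hsec f hfc _ h0)
  · exact (aux_int A r hA _ (hsec f' hfc' _ h0)).aestronglyMeasurable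
  · filter_upwards [hae] with x hx t ht
    exact hC (y + t • v, x) ⟨⟨t, ht, rfl⟩, hx⟩
  · exact integrable_const _
  · filter_upwards [hae] with x hx t ht
    have h := hd (y + t • v) (hδs ht) x hx
    have h2 := HasDerivAt.comp_sub_const (f := fun s : ℝ => f (y + t • v + s • v) x) t t
      (by simpa using h)
    refine h2.congr_of_eventuallyEq (Filter.Eventually.of_forall fun s => ?_)
    simp only
    congr 1
    rw [add_assoc, ← add_smul]; simp

/-- `A` and `B` agree on the kernel for all outer points. -/
def AgreeOn (A B : Measure (En n)) (r : ℝ) (f : En n → En n → ℝ) : Prop :=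
  ∀ y, r < ‖y‖ → ∫ x, f y x ∂A = ∫ x, f y x ∂B

lemma aux_deriv (A B : Measure (En n)) [IsFiniteMeasure A] [IsFiniteMeasure B] (r : ℝ)
    (hA : A (closedBall (0 : En n) r)ᶜ = 0) (hB : B (closedBall (0 : En n) r)ᶜ = 0)
    (f f' : En n → En n → ℝ) (v : En n)
    (hfc : ContinuousOn (Function.uncurry f) ({y | r < ‖y‖} ×ˢ closedBall (0 : En n) r))
    (hfc' : ContinuousOn (Function.uncurry f') ({y | r < ‖y‖} ×ˢ closedBall (0 : En n) r))
    (hd : ∀ y, r < ‖y‖ → ∀ x ∈ closedBall (0 : En n) r,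
      HasDerivAt (fun t : ℝ => f (y + t • v) x) (f' y x) 0)
    (h : AgreeOn A B r f) : AgreeOn A B r f' := by
  intro y hy
  have h1 := aux_deriv1 A r hA f f' v hfc hfc' hd y hy
  have h2 := aux_deriv1 B r hB f f' v hfc hfc' hd y hy
  refine h1.unique (h2.congr_of_eventuallyEq ?_)
  have hUo : IsOpen {t : ℝ | r < ‖y + t • v‖} :=
    isOpen_lt continuous_const (by fun_prop)
  have h0 : (0 : ℝ) ∈ {t : ℝ | r < ‖y + t • v‖} := by simpa using hy
  filter_upwards [hUo.mem_nhds h0] with t ht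
  exact h _ ht

/-- The kernel. -/
def Ker (p : ℝ) (y x : En n) : ℝ := (‖y - x‖ ^ 2) ^ p

lemma aux_pos {r : ℝ} {y x : En n} (hy : r < ‖y‖) (hx : x ∈ closedBall (0 : En n) r) :
    0 < ‖y - x‖ ^ 2 := by
  have : ‖x‖ ≤ r := by simpa using hx
  have : y - x ≠ 0 := by
    intro h
    rw [sub_eq_zero] at h
    subst h
    linarith
  positivity

lemma ker_cont (p r : ℝ) : ContinuousOn (Function.uncurry (Ker (n := n) p))
    ({y | r < ‖y‖} ×ˢ closedBall (0 : En n) r) := by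
  have : (Function.uncurry (Ker (n := n) p)) = fun z => (‖z.1 - z.2‖ ^ 2) ^ p := by
    ext ⟨a, b⟩; rfl
  rw [this]
  refine ContinuousOn.rpow_const (by fun_prop) ?_
  rintro ⟨a, b⟩ ⟨ha, hb⟩
  exact Or.inl (aux_pos ha hb).ne'

lemma sq_deriv (y x v : En n) :
    HasDerivAt (fun t : ℝ => ‖y + t • v - x‖ ^ 2) (2 * inner ℝ (y - x) v) 0 := by
  have h1 : HasDerivAt (fun t : ℝ => y + t • v - x) v 0 := by
    simpa using (((hasDerivAt_id (0 : ℝ)).smul_const v).const_add y).sub_const x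
  simpa using h1.norm_sq

lemma ker_deriv (p r : ℝ) (v y : En n) (hy : r < ‖y‖) (x : En n)
    (hx : x ∈ closedBall (0 : En n) r) :
    HasDerivAt (fun t : ℝ => Ker p (y + t • v) x) (2 * p * inner ℝ (y - x) v * Ker (p - 1) y x)
      0 := by
  have h := (sq_deriv y x v).rpow_const (p := p) (by
    left; simpa using (aux_pos hy hx).ne')
  unfold Ker
  convert h using 1
  rw [zero_smul, add_zero]
  ring

lemma ker_deriv2 (p r : ℝ) (v y : En n) (hy : r < ‖y‖) (x : En n)
    (hx : x ∈ closedBall (0 : En n) r) :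
    HasDerivAt (fun t : ℝ => 2 * p * inner ℝ (y + t • v - x) v * Ker (p - 1) (y + t • v) x)
      (2 * p * ‖v‖ ^ 2 * Ker (p - 1) y x
        + 4 * p * (p - 1) * (inner ℝ (y - x) v) ^ 2 * Ker (p - 2) y x) 0 := by
  have h1 : HasDerivAt (fun t : ℝ => y + t • v - x) v 0 := by
    simpa using (((hasDerivAt_id (0 : ℝ)).smul_const v).const_add y).sub_const x
  have h2 : HasDerivAt (fun t : ℝ => inner ℝ (y + t • v - x) v) (‖v‖ ^ 2) 0 := by
    simpa using h1.inner ℝ (hasDerivAt_const (0 : ℝ) v)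
  have h3 := (h2.const_mul (2 * p)).mul (ker_deriv (p - 1) r v y hy x hx)
  refine h3.congr_deriv ?_
  have : p - 1 - 1 = p - 2 := by ring
  simp only [zero_smul, add_zero, this]
  ring

lemma ker_step (A B : Measure (En n)) [IsFiniteMeasure A] [IsFiniteMeasure B] (r : ℝ)
    (hA : A (closedBall (0 : En n) r)ᶜ = 0) (hB : B (closedBall (0 : En n) r)ᶜ = 0)
    (p : ℝ) (hp : p ≠ 0) (hp' : (n : ℝ) + 2 * p - 2 ≠ 0)
    (h : AgreeOn A B r (Ker p)) : AgreeOn A B r (Ker (p - 1)) := by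
  set S := ({y : En n | r < ‖y‖} ×ˢ closedBall (0 : En n) r) with hS
  have hin : ∀ v : En n, ContinuousOn (fun z : En n × En n => inner ℝ (z.1 - z.2) v) S := by
    intro v; fun_prop
  have hk1 : ContinuousOn (fun z : En n × En n => Ker (p - 1) z.1 z.2) S := ker_cont (p - 1) r
  have hk2 : ContinuousOn (fun z : En n × En n => Ker (p - 2) z.1 z.2) S := ker_cont (p - 2) r
  have c1 : ∀ v : En n, ContinuousOn (Function.uncurry
      (fun y x : En n => 2 * p * inner ℝ (y - x) v * Ker (p - 1) y x)) S := fun v =>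
    (continuousOn_const.mul (hin v)).mul hk1
  have c2 : ∀ v : En n, ContinuousOn (Function.uncurry
      (fun y x : En n => 2 * p * ‖v‖ ^ 2 * Ker (p - 1) y x
        + 4 * p * (p - 1) * (inner ℝ (y - x) v) ^ 2 * Ker (p - 2) y x)) S := fun v =>
    (continuousOn_const.mul hk1).add ((continuousOn_const.mul ((hin v).pow 2)).mul hk2)
  have hag : ∀ v : En n, AgreeOn A B r (fun y x : En n => 2 * p * ‖v‖ ^ 2 * Ker (p - 1) y x
        + 4 * p * (p - 1) * (inner ℝ (y - x) v) ^ 2 * Ker (p - 2) y x) := by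
    intro v
    have h1 := aux_deriv A B r hA hB (Ker p) _ v (ker_cont p r) (c1 v)
      (fun y hy x hx => ker_deriv p r v y hy x hx) h
    exact aux_deriv A B r hA hB _ _ v (c1 v) (c2 v)
      (fun y hy x hx => ker_deriv2 p r v y hy x hx) h1
  intro y hy
  have hsum : ∀ x ∈ closedBall (0 : En n) r,
      ∑ i : Fin n, (2 * p * ‖(EuclideanSpace.single i (1 : ℝ) : En n)‖ ^ 2 * Ker (p - 1) y x
        + 4 * p * (p - 1) * (inner ℝ (y - x) (EuclideanSpace.single i (1 : ℝ) : En n)) ^ 2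
          * Ker (p - 2) y x) = (2 * p * (n + 2 * p - 2)) * Ker (p - 1) y x := by
    intro x hx
    have hq := aux_pos hy hx
    have e : Ker (p - 1) y x = ‖y - x‖ ^ 2 * Ker (p - 2) y x := by
      unfold Ker
      rw [show p - 1 = 1 + (p - 2) by ring, Real.rpow_add hq, Real.rpow_one]
    have e2 : ‖y - x‖ ^ 2 = ∑ i, ((y - x) i) ^ 2 := by
      rw [EuclideanSpace.norm_sq_eq]; simp
    simp only [EuclideanSpace.inner_single_right, PiLp.norm_single]
    simp only [one_mul, conj_trivial]
    rw [Finset.sum_add_distrib, ← Finset.sum_mul (f := fun i => 4 * p * (p - 1) * (y - x) i ^ 2),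
      ← Finset.mul_sum (f := fun i => (y - x) i ^ 2)]
    rw [← e2, e]
    simp
    ring
  have hI : ∀ (M : Measure (En n)) [IsFiniteMeasure M], M (closedBall (0 : En n) r)ᶜ = 0 →
      (2 * p * (n + 2 * p - 2)) * ∫ x, Ker (p - 1) y x ∂M = ∑ i : Fin n, ∫ x,
      (2 * p * ‖(EuclideanSpace.single i (1 : ℝ) : En n)‖ ^ 2 * Ker (p - 1) y x
        + 4 * p * (p - 1) * (inner ℝ (y - x) (EuclideanSpace.single i (1 : ℝ) : En n)) ^ 2
          * Ker (p - 2) y x) ∂M := by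
    intro M _ hM
    rw [← integral_finsetSum, ← integral_const_mul]
    · refine integral_congr_ae ?_
      have hae : ∀ᵐ x ∂M, x ∈ closedBall (0 : En n) r := by rw [ae_iff]; exact hM
      filter_upwards [hae] with x hx
      exact (hsum x hx).symm
    · intro i _
      refine aux_int M r hM _ ?_
      exact (c2 (EuclideanSpace.single i (1 : ℝ))).comp (f := fun x => (y, x)) (by fun_prop)
        (fun x hx => ⟨hy, hx⟩)
  have hne : 2 * p * (n + 2 * p - 2) ≠ 0 := by positivity
  apply mul_left_cancel₀ hne
  rw [hI A hA, hI B hB]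
  exact Finset.sum_congr rfl fun i _ => hag _ y hy

lemma ker_all (A B : Measure (En n)) [IsFiniteMeasure A] [IsFiniteMeasure B] (r : ℝ)
    (hn : 2 ≤ n)
    (hA : A (closedBall (0 : En n) r)ᶜ = 0) (hB : B (closedBall (0 : En n) r)ᶜ = 0)
    (h : AgreeOn A B r (Ker (-(n : ℝ) / 2))) (k : ℕ) :
    AgreeOn A B r (Ker (-(n : ℝ) / 2 - k)) := by
  have hn' : (2 : ℝ) ≤ n := by exact_mod_cast hn
  induction k with
  | zero => simpa using h
  | succ k ih =>
    have hk : (0 : ℝ) ≤ k := by positivity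
    have := ker_step A B r hA hB _ (by linarith) (by linarith) ih
    convert this using 2
    push_cast
    ring

lemma weier (A B : Measure (En n)) [IsFiniteMeasure A] [IsFiniteMeasure B] (r : ℝ)
    (hn : 2 ≤ n)
    (hA : A (closedBall (0 : En n) r)ᶜ = 0) (hB : B (closedBall (0 : En n) r)ᶜ = 0)
    (h : AgreeOn A B r (Ker (-(n : ℝ) / 2))) (H : ℝ → ℝ) (hH : Continuous H)
    (y : En n) (hy : r < ‖y‖) (hr : 0 < r) :
    ∫ x, H (‖y - x‖ ^ 2) ∂A = ∫ x, H (‖y - x‖ ^ 2) ∂B := by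
  set a := ((‖y‖ + r) ^ 2)⁻¹ with ha
  set b := ((‖y‖ - r) ^ 2)⁻¹ with hb
  have hyr : 0 < ‖y‖ - r := by linarith
  have hapos : 0 < a := by positivity
  have hg : ∀ x ∈ closedBall (0 : En n) r, (‖y - x‖ ^ 2)⁻¹ ∈ Set.Icc a b := by
    intro x hx
    have hx' : ‖x‖ ≤ r := by simpa using hx
    have h1 : ‖y - x‖ ≤ ‖y‖ + r := (norm_sub_le _ _).trans (by linarith)
    have h2 : ‖y‖ - r ≤ ‖y - x‖ := le_trans (by linarith) (norm_sub_norm_le y x)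
    have h3 := aux_pos hy hx
    constructor
    · exact inv_anti₀ h3 (by gcongr)
    · exact inv_anti₀ (by positivity) (by gcongr)
  have hkc : ContinuousOn (Ker (-(n : ℝ) / 2) y) (closedBall (0 : En n) r) :=
    (ker_cont (-(n : ℝ) / 2) r).comp (f := fun x => (y, x)) (by fun_prop) (fun x hx => ⟨hy, hx⟩)
  have hgc : ContinuousOn (fun x => (‖y - x‖ ^ 2)⁻¹) (closedBall (0 : En n) r) :=
    ContinuousOn.inv₀ (by fun_prop) fun x hx => (aux_pos hy hx).ne'
  have hHc : ContinuousOn (fun x => H (‖y - x‖ ^ 2)) (closedBall (0 : En n) r) := by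
    fun_prop
  obtain ⟨C, hC⟩ := (isCompact_closedBall (0 : En n) r).exists_bound_of_continuousOn hkc
  have hpoly : ∀ P : Polynomial ℝ, ∫ x, Ker (-(n : ℝ) / 2) y x * P.eval (‖y - x‖ ^ 2)⁻¹ ∂A
      = ∫ x, Ker (-(n : ℝ) / 2) y x * P.eval (‖y - x‖ ^ 2)⁻¹ ∂B := by
    intro P
    have hI : ∀ (M : Measure (En n)) [IsFiniteMeasure M], M (closedBall (0 : En n) r)ᶜ = 0 →
        ∫ x, Ker (-(n : ℝ) / 2) y x * P.eval (‖y - x‖ ^ 2)⁻¹ ∂M =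
        ∑ k ∈ Finset.range (P.natDegree + 1),
          P.coeff k * ∫ x, Ker (-(n : ℝ) / 2 - k) y x ∂M := by
      intro M _ hM
      simp_rw [← integral_const_mul]
      rw [← integral_finsetSum]
      · refine integral_congr_ae ?_
        have hae : ∀ᵐ x ∂M, x ∈ closedBall (0 : En n) r := by rw [ae_iff]; exact hM
        filter_upwards [hae] with x hx
        rw [Polynomial.eval_eq_sum_range, Finset.mul_sum]
        refine Finset.sum_congr rfl fun k _ => ?_
        unfold Ker
        rw [Real.rpow_sub (aux_pos hy hx), Real.rpow_natCast, inv_pow]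
        ring
      · intro k _
        refine (aux_int M r hM _ ?_).const_mul _
        exact (ker_cont (-(n : ℝ) / 2 - k) r).comp (f := fun x => (y, x)) (by fun_prop)
          (fun x hx => ⟨hy, hx⟩)
    rw [hI A hA, hI B hB]
    exact Finset.sum_congr rfl fun k _ => by rw [ker_all A B r hn hA hB h k y hy]
  have hclose : ∀ ε > 0, |∫ x, H (‖y - x‖ ^ 2) ∂A - ∫ x, H (‖y - x‖ ^ 2) ∂B| ≤
      ε * (|C| * (A.real Set.univ + B.real Set.univ)) := by
    intro ε hε
    obtain ⟨P, hP⟩ := exists_polynomial_near_of_continuousOn a b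
      (fun g : ℝ => g ^ (-(n : ℝ) / 2) * H g⁻¹) (by
        have hne : ∀ g ∈ Set.Icc a b, g ≠ 0 := fun g hg => (hapos.trans_le hg.1).ne'
        refine ContinuousOn.mul (continuousOn_id.rpow_const fun g hg => Or.inl (hne g hg)) ?_
        exact hH.comp_continuousOn (continuousOn_id.inv₀ hne)) ε hε
    have hpt : ∀ x ∈ closedBall (0 : En n) r,
        ‖H (‖y - x‖ ^ 2) - Ker (-(n : ℝ) / 2) y x * P.eval (‖y - x‖ ^ 2)⁻¹‖ ≤ ε * |C| := by
      intro x hx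
      have hq := aux_pos hy hx
      have e : H (‖y - x‖ ^ 2) = Ker (-(n : ℝ) / 2) y x *
          (((‖y - x‖ ^ 2)⁻¹) ^ (-(n : ℝ) / 2) * H ((‖y - x‖ ^ 2)⁻¹)⁻¹) := by
        unfold Ker
        rw [inv_inv, Real.inv_rpow hq.le, ← mul_assoc,
          mul_inv_cancel₀ (Real.rpow_pos_of_pos hq _).ne', one_mul]
      rw [e, ← mul_sub, norm_mul, mul_comm]
      have h1 := hP _ (hg x hx)
      have h2 := (hC x hx).trans (le_abs_self C)
      rw [abs_sub_comm] at h1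
      exact mul_le_mul h1.le h2 (norm_nonneg _) hε.le
    have hI : ∀ (M : Measure (En n)) [IsFiniteMeasure M], M (closedBall (0 : En n) r)ᶜ = 0 →
        |∫ x, H (‖y - x‖ ^ 2) ∂M - ∫ x, Ker (-(n : ℝ) / 2) y x * P.eval (‖y - x‖ ^ 2)⁻¹ ∂M| ≤
          ε * |C| * M.real Set.univ := by
      intro M _ hM
      have hi2 : Integrable (fun x => Ker (-(n : ℝ) / 2) y x * P.eval (‖y - x‖ ^ 2)⁻¹) M :=
        aux_int M r hM _ (hkc.mul (P.continuous.comp_continuousOn hgc))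
      rw [← integral_sub (aux_int M r hM _ hHc) hi2]
      rw [← Real.norm_eq_abs]
      refine norm_integral_le_of_norm_le_const ?_
      have hae : ∀ᵐ x ∂M, x ∈ closedBall (0 : En n) r := by rw [ae_iff]; exact hM
      filter_upwards [hae] with x hx using hpt x hx
    have h1 := hI A hA
    have h2 := hI B hB
    rw [hpoly P] at h1
    rw [abs_le] at *
    constructor <;> nlinarith
  have hlim : |∫ x, H (‖y - x‖ ^ 2) ∂A - ∫ x, H (‖y - x‖ ^ 2) ∂B| ≤ 0 := by
    have ht : Filter.Tendsto (fun ε : ℝ => ε * (|C| * (A.real Set.univ + B.real Set.univ)))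
        (nhdsWithin 0 (Set.Ioi 0)) (nhds 0) := by
      have : Filter.Tendsto (fun ε : ℝ => ε * (|C| * (A.real Set.univ + B.real Set.univ)))
        (nhds 0) (nhds (0 * (|C| * (A.real Set.univ + B.real Set.univ)))) :=
        Continuous.tendsto (by fun_prop) 0
      rw [zero_mul] at this
      exact this.mono_left nhdsWithin_le_nhds
    exact ge_of_tendsto ht (by filter_upwards [self_mem_nhdsWithin] with ε hε using hclose ε hε)
  exact sub_eq_zero.1 (abs_eq_zero.1 (le_antisymm hlim (abs_nonneg _)))

end MarkovAux

section MarkovAux2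

variable {n : ℕ}

lemma lim_agree (A B : Measure (En n)) [IsFiniteMeasure A] [IsFiniteMeasure B] (r : ℝ)
    (hn : 2 ≤ n)
    (hA : A (closedBall (0 : En n) r)ᶜ = 0) (hB : B (closedBall (0 : En n) r)ᶜ = 0)
    (h : AgreeOn A B r (Ker (-(n : ℝ) / 2))) (g : ℝ → ℝ) (hg : Continuous g)
    (hg1 : ∀ s, ‖g s‖ ≤ 1) (hr : 0 < r) (t : En n) :
    ∫ x, g (inner ℝ x t) ∂A = ∫ x, g (inner ℝ x t) ∂B := by
  by_cases ht : t = 0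
  · subst ht
    have := weier A B r hn hA hB h (fun _ => g 0) continuous_const
      (EuclideanSpace.single (⟨0, by omega⟩ : Fin n) (r + 1)) (by
        rw [PiLp.norm_single, Real.norm_eq_abs, abs_of_pos (by linarith)]; linarith) hr
    simpa using this
  have ht' : 0 < ‖t‖ := norm_pos_iff.2 ht
  let F : ℕ → En n → ℝ := fun k x =>
    g (((k : ℝ) ^ 2 * ‖t‖ ^ 2 - ‖(k : ℝ) • t - x‖ ^ 2) / (2 * k))
  have hlim : ∀ (M : Measure (En n)) [IsFiniteMeasure M],
      Filter.Tendsto (fun k => ∫ x, F k x ∂M) Filter.atTop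
        (nhds (∫ x, g (inner ℝ x t) ∂M)) := by
    intro M _
    refine tendsto_integral_of_dominated_convergence (fun _ => (1 : ℝ)) ?_ (integrable_const _)
      ?_ ?_
    · intro k
      exact Continuous.aestronglyMeasurable (by fun_prop)
    · intro k
      exact Filter.Eventually.of_forall fun x => hg1 _
    · refine Filter.Eventually.of_forall fun x => ?_
      refine (hg.tendsto _).comp ?_
      have h1 : Filter.Tendsto (fun k : ℕ => inner ℝ x t - ‖x‖ ^ 2 / 2 * ((k : ℝ))⁻¹)
          Filter.atTop (nhds (inner ℝ x t - ‖x‖ ^ 2 / 2 * 0)) :=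
        tendsto_const_nhds.sub (tendsto_const_nhds.mul tendsto_inv_atTop_nhds_zero_nat)
      rw [mul_zero, sub_zero] at h1
      refine h1.congr' ?_
      filter_upwards [Filter.eventually_gt_atTop 0] with k hk
      have hk' : (0 : ℝ) < k := by exact_mod_cast hk
      rw [norm_sub_sq_real, norm_smul, real_inner_smul_left, real_inner_comm, Real.norm_eq_abs,
        mul_pow, sq_abs]
      field_simp
      ring
  refine tendsto_nhds_unique (hlim A) ((hlim B).congr' ?_)
  have hev : ∀ᶠ k : ℕ in Filter.atTop, r / ‖t‖ < k :=
    tendsto_natCast_atTop_atTop.eventually_gt_atTop (r / ‖t‖)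
  filter_upwards [hev] with k hk
  refine (weier A B r hn hA hB h
    (fun q => g (((k : ℝ) ^ 2 * ‖t‖ ^ 2 - q) / (2 * k))) (by fun_prop) ((k : ℝ) • t) ?_ hr).symm
  rw [norm_smul, Real.norm_eq_abs, abs_of_nonneg (by positivity)]
  exact (div_lt_iff₀ ht').1 hk

lemma meas_eq (A B : Measure (En n)) [IsFiniteMeasure A] [IsFiniteMeasure B] (r : ℝ)
    (hn : 2 ≤ n)
    (hA : A (closedBall (0 : En n) r)ᶜ = 0) (hB : B (closedBall (0 : En n) r)ᶜ = 0)
    (h : AgreeOn A B r (Ker (-(n : ℝ) / 2))) (hr : 0 < r) : A = B := by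
  apply Measure.ext_of_charFun
  ext t
  have hM : ∀ (M : Measure (En n)) [IsFiniteMeasure M], charFun M t =
      ((∫ x, Real.cos (inner ℝ x t) ∂M : ℝ) : ℂ)
        + ((∫ x, Real.sin (inner ℝ x t) ∂M : ℝ) : ℂ) * Complex.I := by
    intro M _
    rw [charFun_apply, ← integral_complex_ofReal, ← integral_complex_ofReal,
      ← integral_mul_const, ← integral_add]
    · refine integral_congr_ae (Filter.Eventually.of_forall fun x => ?_)
      simp [Complex.exp_mul_I]
    · refine Integrable.of_bound (C := 1) (Continuous.aestronglyMeasurable (by fun_prop)) ?_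
      refine Filter.Eventually.of_forall fun x => ?_
      rw [Complex.norm_real]
      exact Real.abs_cos_le_one _
    · refine Integrable.mul_const ?_ _
      refine Integrable.of_bound (C := 1) (Continuous.aestronglyMeasurable (by fun_prop)) ?_
      refine Filter.Eventually.of_forall fun x => ?_
      rw [Complex.norm_real]
      exact Real.abs_sin_le_one _
  rw [hM A, hM B,
    lim_agree A B r hn hA hB h Real.cos Real.continuous_cos (fun s => Real.abs_cos_le_one s) hr t,
    lim_agree A B r hn hA hB h Real.sin Real.continuous_sin (fun s => Real.abs_sin_le_one s) hr t]

lemma kernel_eq (r : ℝ) (hr : 0 < r) (y : En n) (hy : r < ‖y‖)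
    (x : En n) (hx : x ∈ closedBall (0 : En n) r) :
    ((‖y‖ : ℂ)) ^ (n - 1) / rPow n (‖y‖ : ℂ) (‖y‖⁻¹ • y) x =
      ((‖y‖ ^ (n - 1) * Ker (-(n : ℝ) / 2) y x : ℝ) : ℂ) := by
  have hy0 : 0 < ‖y‖ := hr.trans hy
  have hq := aux_pos hy hx
  have e : (1 - 2 * ((inner ℝ (‖y‖⁻¹ • y) x : ℝ) : ℂ) / (‖y‖ : ℂ)
      + ((‖x‖ : ℂ)) ^ 2 / (‖y‖ : ℂ) ^ 2) = ((‖y - x‖ ^ 2 / ‖y‖ ^ 2 : ℝ) : ℂ) := by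
    rw [norm_sub_sq_real, real_inner_smul_left]
    push_cast
    have : (‖y‖ : ℂ) ≠ 0 := by exact_mod_cast hy0.ne'
    field_simp
  have e2 : rPow n (‖y‖ : ℂ) (‖y‖⁻¹ • y) x = (((‖y - x‖ ^ 2) ^ ((n : ℝ) / 2) : ℝ) : ℂ) := by
    unfold rPow
    rw [e, show ((n : ℂ) / 2) = (((n : ℝ) / 2 : ℝ) : ℂ) by push_cast; rfl,
      ← Complex.ofReal_cpow (by positivity), ← Complex.ofReal_pow, ← Complex.ofReal_mul]
    congr 1
    rw [Real.div_rpow hq.le (by positivity), ← Real.rpow_natCast ‖y‖ 2, ← Real.rpow_mul hy0.le]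
    rw [show ((2 : ℕ) : ℝ) * ((n : ℝ) / 2) = n by push_cast; ring, Real.rpow_natCast]
    field_simp
  rw [e2]
  unfold Ker
  rw [neg_div, Real.rpow_neg hq.le]
  push_cast
  rfl

lemma omega_ne (hn : 2 ≤ n) : omegaN n ≠ 0 := by
  unfold omegaN sphereMeasure
  rw [Measure.toSphere_apply_univ, ENNReal.toReal_mul]
  refine mul_ne_zero ?_ ?_
  · simp; omega
  · exact (ENNReal.toReal_pos (measure_ball_pos _ _ one_pos).ne' measure_ball_lt_top.ne).ne'

lemma supp_parts (μ : SignedMeasure (En n)) (a r : ℝ) (har : a ≤ r)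
    (h : SuppIn μ (closedBall (0 : En n) a)) :
    μ.toJordanDecomposition.posPart (closedBall (0 : En n) r)ᶜ = 0 ∧
    μ.toJordanDecomposition.negPart (closedBall (0 : En n) r)ᶜ = 0 := by
  have h' : μ.totalVariation (closedBall (0 : En n) r)ᶜ = 0 :=
    measure_mono_null (Set.compl_subset_compl.2 (closedBall_subset_closedBall har)) h
  simpa [SignedMeasure.totalVariation] using h'

end MarkovAux2

/-- A finite signed measure with compact support is uniquely
determined by its multivariate Markov transform. -/
theorem markov_injective
    (n : ℕ) (hn : 2 ≤ n) (μ ν : SignedMeasure (En n))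
    (hμ : ∃ Rc : ℝ, SuppIn μ (closedBall (0 : En n) Rc))
    (hν : ∃ Rc : ℝ, SuppIn ν (closedBall (0 : En n) Rc))
    (R : ℝ) (hR : 0 < R)
    (heq : ∀ ζ : ℂ, R < ‖ζ‖ → ∀ θ : sphere (0 : En n) 1,
      markov μ ζ (θ : En n) = markov ν ζ (θ : En n)) :
    μ = ν := by
  obtain ⟨a, ha⟩ := hμ
  obtain ⟨b, hb⟩ := hν
  set r := max R (max a b) with hr
  have hRr : R ≤ r := le_max_left _ _
  have hr0 : 0 < r := hR.trans_le hRr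
  obtain ⟨p1, p2⟩ := supp_parts μ a r ((le_max_left _ _).trans (le_max_right _ _)) ha
  obtain ⟨q1, q2⟩ := supp_parts ν b r ((le_max_right _ _).trans (le_max_right _ _)) hb
  set μp := μ.toJordanDecomposition.posPart with hμp
  set μm := μ.toJordanDecomposition.negPart with hμm
  set νp := ν.toJordanDecomposition.posPart with hνp
  set νm := ν.toJordanDecomposition.negPart with hνm
  have hint : ∀ (M : Measure (En n)) [IsFiniteMeasure M], M (closedBall (0 : En n) r)ᶜ = 0 →
      ∀ y : En n, r < ‖y‖ → Integrable (Ker (-(n : ℝ) / 2) y) M := by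
    intro M _ hM y hy
    exact aux_int M r hM _ ((ker_cont (-(n : ℝ) / 2) r).comp (f := fun x => (y, x))
      (by fun_prop) (fun x hx => ⟨hy, hx⟩))
  have hI : ∀ (M : Measure (En n)) [IsFiniteMeasure M], M (closedBall (0 : En n) r)ᶜ = 0 →
      ∀ y : En n, r < ‖y‖ →
      ∫ x, ((‖y‖ : ℂ)) ^ (n - 1) / rPow n (‖y‖ : ℂ) (‖y‖⁻¹ • y) x ∂M =
        ((‖y‖ ^ (n - 1) * ∫ x, Ker (-(n : ℝ) / 2) y x ∂M : ℝ) : ℂ) := by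
    intro M _ hM y hy
    rw [← integral_const_mul, ← integral_complex_ofReal]
    refine integral_congr_ae ?_
    have hae : ∀ᵐ x ∂M, x ∈ closedBall (0 : En n) r := by rw [ae_iff]; exact hM
    filter_upwards [hae] with x hx using kernel_eq r hr0 y hy x hx
  have hag : AgreeOn (μp + νm) (νp + μm) r (Ker (-(n : ℝ) / 2)) := by
    intro y hy
    have hy0 : 0 < ‖y‖ := hr0.trans hy
    have hy1 : ‖y‖⁻¹ • y ∈ sphere (0 : En n) 1 := by
      rw [mem_sphere_zero_iff_norm, norm_smul, norm_inv, norm_norm, inv_mul_cancel₀ hy0.ne']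
    have h1 := heq (‖y‖ : ℂ) (by
      rw [Complex.norm_real, norm_norm]; exact hRr.trans_lt hy) ⟨_, hy1⟩
    unfold markov sInt at h1
    have hw : ((omegaN n : ℂ))⁻¹ ≠ 0 := inv_ne_zero (by exact_mod_cast omega_ne hn)
    have h2 := mul_left_cancel₀ hw h1
    simp only [← hμp, ← hμm, ← hνp, ← hνm] at h2
    rw [hI μp p1 y hy, hI μm p2 y hy, hI νp q1 y hy, hI νm q2 y hy] at h2
    have h3 : ‖y‖ ^ (n - 1) * (∫ x, Ker (-(n : ℝ) / 2) y x ∂μp) -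
        ‖y‖ ^ (n - 1) * (∫ x, Ker (-(n : ℝ) / 2) y x ∂μm) =
        ‖y‖ ^ (n - 1) * (∫ x, Ker (-(n : ℝ) / 2) y x ∂νp) -
        ‖y‖ ^ (n - 1) * (∫ x, Ker (-(n : ℝ) / 2) y x ∂νm) := by exact_mod_cast h2
    rw [← mul_sub, ← mul_sub] at h3
    have h4 := mul_left_cancel₀ (pow_pos hy0 (n - 1)).ne' h3
    rw [integral_add_measure (hint μp p1 y hy) (hint νm q2 y hy),
      integral_add_measure (hint νp q1 y hy) (hint μm p2 y hy)]
    linarith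
  have hAB : μp + νm = νp + μm :=
    meas_eq (μp + νm) (νp + μm) r hn (by simp [p1, q2]) (by simp [q1, p2]) hag hr0
  have hs : μp.toSignedMeasure + νm.toSignedMeasure = νp.toSignedMeasure + μm.toSignedMeasure := by
    rw [← Measure.toSignedMeasure_add, ← Measure.toSignedMeasure_add]
    congr 1
  have e1 := SignedMeasure.toSignedMeasure_toJordanDecomposition μ
  have e2 := SignedMeasure.toSignedMeasure_toJordanDecomposition ν
  unfold JordanDecomposition.toSignedMeasure at e1 e2
  rw [← e1, ← e2, sub_eq_sub_iff_add_eq_add]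
  exact hs
end
end

section
/- Let μ be a finite signed measure on ℝⁿ (n ≥ 2) with support in the closed ball of radius R. Then for all ζ ∈ ℂ with |ζ| > R and all θ ∈ S^{n-1}, μ̂(ζ,θ) = Σ_{t=0}^∞ Σ_{k=0}^∞ Σ_{m=1}^{a_k} (Y_{k,m}(θ)/ζ^{2t+k+1}) ∫_{ℝⁿ} |x|^{2t} conj(Y_{k,m}(x)) dμ(x), with absolute convergence of the series. -/
open MeasureTheory Metric MvPolynomial

noncomputable section

lemma integrable_pow_gauss (k : ℕ) :
    Integrable (fun x : ℝ => (x : ℂ) ^ k * ((Real.exp (-x ^ 2) : ℝ) : ℂ)) := by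
  have h := (integrable_rpow_mul_exp_neg_mul_sq (b := 1) one_pos (s := k)
    (by have : (0:ℝ) ≤ k := k.cast_nonneg
        linarith)).ofReal (𝕜 := ℂ)
  refine h.congr (.of_forall fun x => ?_)
  simp

def gm (k : ℕ) : ℂ := ∫ x : ℝ, (x : ℂ) ^ k * ((Real.exp (-x ^ 2) : ℝ) : ℂ)

lemma gm_rec (k : ℕ) : (k : ℂ) * gm (k - 1) = 2 * gm (k + 1) := by
  have hd : ∀ x : ℝ, HasDerivAt (fun x : ℝ => (x : ℂ) ^ k * ((Real.exp (-x ^ 2) : ℝ) : ℂ))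
      ((k : ℂ) * ((x : ℂ) ^ (k - 1) * ((Real.exp (-x ^ 2) : ℝ) : ℂ)) -
        2 * ((x : ℂ) ^ (k + 1) * ((Real.exp (-x ^ 2) : ℝ) : ℂ))) x := by
    intro x
    have h1 : HasDerivAt (fun x : ℝ => x ^ k * Real.exp (-x ^ 2))
        (k * x ^ (k - 1) * Real.exp (-x ^ 2) +
          x ^ k * (Real.exp (-x ^ 2) * (-(2 * x)))) x := by
      have := (hasDerivAt_pow k x).mul ((hasDerivAt_pow 2 x).fun_neg.exp)
      have h2 : (k * x ^ (k - 1) * Real.exp (-x ^ 2) + x ^ k * (Real.exp (-x ^ 2) * (-(2 * x)))) =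
          (k * x ^ (k - 1) * Real.exp (-x ^ 2) +
            x ^ k * (Real.exp (-x ^ 2) * -(((2 : ℕ) : ℝ) * x ^ (2 - 1)))) := by norm_num
      rw [h2]
      exact this
    have h2 := h1.ofReal_comp
    convert h2 using 1
    · ext y; push_cast; rfl
    · push_cast; ring
  have hi1 := (integrable_pow_gauss (k - 1)).const_mul (k : ℂ)
  have hi2 := (integrable_pow_gauss (k + 1)).const_mul (2 : ℂ)
  have := integral_eq_zero_of_hasDerivAt_of_integrable hd (hi1.sub hi2) (integrable_pow_gauss k)
  rw [integral_sub hi1 hi2, integral_const_mul, integral_const_mul, sub_eq_zero] at this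
  exact this

def gw {n : ℕ} (x : En n) : ℂ := ((Real.exp (-‖x‖ ^ 2) : ℝ) : ℂ)

lemma evalR_monomial {n : ℕ} (α : Fin n →₀ ℕ) (c : ℂ) (x : En n) :
    evalR (monomial α c) x = c * ∏ i, (x i : ℂ) ^ α i := by
  simp [evalR, eval_monomial, Finsupp.prod_fintype]

lemma mono_gw {n : ℕ} (α : Fin n →₀ ℕ) (c : ℂ) (x : En n) :
    evalR (monomial α c) x * gw x =
      c * ∏ i, ((x i : ℂ) ^ α i * ((Real.exp (-(x i) ^ 2) : ℝ) : ℂ)) := by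
  rw [evalR_monomial, gw, EuclideanSpace.norm_sq_eq, ← Finset.sum_neg_distrib, Real.exp_sum,
    Finset.prod_mul_distrib]
  simp [mul_assoc]

lemma integrable_mono {n : ℕ} (α : Fin n →₀ ℕ) (c : ℂ) :
    Integrable (fun x : En n => evalR (monomial α c) x * gw x) := by
  simp_rw [mono_gw]
  refine Integrable.const_mul ?_ _
  have h := Integrable.fintype_prod (𝕜 := ℂ) (ι := Fin n) (E := ℝ) (μ := fun _ => volume)
    (f := fun i x => (x : ℂ) ^ α i * ((Real.exp (-x ^ 2) : ℝ) : ℂ))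
    (fun i => integrable_pow_gauss (α i))
  exact ((EuclideanSpace.volume_preserving_symm_measurableEquiv_toLp (Fin n)).integrable_comp_emb
    (MeasurableEquiv.measurableEmbedding _)).2 h

lemma integral_mono_gw {n : ℕ} (α : Fin n →₀ ℕ) (c : ℂ) :
    ∫ x : En n, evalR (monomial α c) x * gw x = c * ∏ i, gm (α i) := by
  simp_rw [mono_gw]
  rw [integral_const_mul]
  congr 1
  have h := integral_fintype_prod_volume_eq_prod (𝕜 := ℂ) (ι := Fin n) (E := fun _ => ℝ)
    (f := fun i x => (x : ℂ) ^ α i * ((Real.exp (-x ^ 2) : ℝ) : ℂ))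
  rw [show (∏ i, gm (α i)) = _ from h.symm]
  exact (EuclideanSpace.volume_preserving_symm_measurableEquiv_toLp (Fin n)).integral_comp
    (MeasurableEquiv.measurableEmbedding _) (fun x : Fin n → ℝ => ∏ i, ((x i : ℂ) ^ α i *
     ((Real.exp (-(x i) ^ 2) : ℝ) : ℂ)))

lemma integrable_gauss {n : ℕ} (P : MvPolynomial (Fin n) ℂ) :
    Integrable (fun x : En n => evalR P x * gw x) := by
  induction P using MvPolynomial.induction_on' with
  | monomial α c => exact integrable_mono α c
  | add p q hp hq =>
    refine (hp.add hq).congr (.of_forall fun x => ?_)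
    simp [evalR, add_mul]

/-- Gaussian integral as a linear functional. -/
def gI (n : ℕ) : MvPolynomial (Fin n) ℂ →ₗ[ℂ] ℂ where
  toFun P := ∫ x : En n, evalR P x * gw x
  map_add' p q := by
    rw [← integral_add (integrable_gauss p) (integrable_gauss q)]
    simp [evalR, add_mul]
  map_smul' c p := by
    rw [RingHom.id_apply, smul_eq_mul, ← integral_const_mul]
    simp [evalR, mul_assoc]

lemma gI_pderiv {n : ℕ} (i : Fin n) (P : MvPolynomial (Fin n) ℂ) :
    gI n (pderiv i P) = 2 * gI n (X i * P) := by
  induction P using MvPolynomial.induction_on' with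
  | add p q hp hq => simp only [map_add, mul_add, hp, hq]
  | monomial α c =>
    have h1 := integral_mono_gw (α - Finsupp.single i 1) (c * (α i : ℂ))
    have h2 := integral_mono_gw (Finsupp.single i 1 + α) c
    rw [pderiv_monomial, X, monomial_mul, one_mul]
    refine (h1.trans ?_).trans (congrArg (2 * ·) h2.symm)
    rw [← Finset.mul_prod_erase _ _ (Finset.mem_univ i),
      ← Finset.mul_prod_erase _ _ (Finset.mem_univ i)]
    have e1 : ∏ j ∈ Finset.univ.erase i, gm ((α - Finsupp.single i 1 : Fin n →₀ ℕ) j) =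
        ∏ j ∈ Finset.univ.erase i, gm (α j) := by
      refine Finset.prod_congr rfl fun j hj => ?_
      have : i ≠ j := fun h => by simp [h] at hj
      simp [this]
    have e2 : ∏ j ∈ Finset.univ.erase i, gm ((Finsupp.single i 1 + α : Fin n →₀ ℕ) j) =
        ∏ j ∈ Finset.univ.erase i, gm (α j) := by
      refine Finset.prod_congr rfl fun j hj => ?_
      have : i ≠ j := fun h => by simp [h] at hj
      simp [this]
    rw [e1, e2]
    have := gm_rec (α i)
    simp only [Finsupp.coe_tsub, Pi.sub_apply, Finsupp.single_eq_same, Finsupp.coe_add,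
      Pi.add_apply, add_comm 1 (α i)]
    linear_combination c * (∏ j ∈ Finset.univ.erase i, gm (α j)) * this

def gJ (p : ℕ) : ℝ := ∫ r in Set.Ioi (0 : ℝ), r ^ p * Real.exp (-r ^ 2)

lemma gJ_eq (p : ℕ) : gJ p = 1 / 2 * Real.Gamma ((p + 1) / 2) := by
  have h := integral_rpow_mul_exp_neg_rpow (p := 2) (q := p) two_pos
    (by have : (0:ℝ) ≤ p := p.cast_nonneg
        linarith)
  rw [← h, gJ]
  refine setIntegral_congr_fun measurableSet_Ioi fun x hx => ?_
  simp

lemma gJ_pos (p : ℕ) : 0 < gJ p := by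
  rw [gJ_eq]
  have := Real.Gamma_pos_of_pos (s := ((p : ℝ) + 1) / 2) (by positivity)
  positivity

lemma gJ_rec (p : ℕ) : gJ (p + 2) = (p + 1) / 2 * gJ p := by
  rw [gJ_eq, gJ_eq, show (((p + 2 : ℕ) : ℝ) + 1) / 2 = ((p : ℝ) + 1) / 2 + 1 by push_cast; ring,
    Real.Gamma_add_one (by positivity)]
  ring

def sphI (n : ℕ) (P : MvPolynomial (Fin n) ℂ) : ℂ :=
  ∫ θ : sphere (0 : En n) 1, evalR P (θ : En n) ∂(sphereMeasure n)

lemma evalR_smul {n d : ℕ} {P : MvPolynomial (Fin n) ℂ} (hP : P.IsHomogeneous d) (r : ℝ)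
    (x : En n) : evalR P (r • x) = (r : ℂ) ^ d * evalR P x := by
  unfold evalR
  rw [eval_eq, eval_eq, Finset.mul_sum]
  refine Finset.sum_congr rfl fun α hα => ?_
  have hd : ∑ i, α i = d := by
    have := hP (mem_support_iff.1 hα)
    simpa [Finsupp.weight_apply, Finsupp.sum_fintype] using this
  simp only [PiLp.smul_apply, smul_eq_mul, Complex.ofReal_mul, mul_pow, Finset.prod_mul_distrib]
  rw [Finset.prod_subset (Finset.subset_univ α.support) (fun i _ hi => by
    rw [Finsupp.notMem_support_iff.1 hi, pow_zero]) (f := fun i => (r : ℂ) ^ α i),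
    Finset.prod_pow_eq_pow_sum, hd]
  ring

lemma gI_polar {n d : ℕ} (hn : 1 ≤ n) {P : MvPolynomial (Fin n) ℂ} (hP : P.IsHomogeneous d) :
    gI n P = sphI n P * gJ (n - 1 + d) := by
  have hdim : Module.finrank ℝ (En n) = n := by simp
  have : Nontrivial (En n) := Module.nontrivial_of_finrank_pos (R := ℝ) (by omega)
  let F : sphere (0 : En n) 1 → ℂ := fun θ => evalR P (θ : En n)
  let G : Set.Ioi (0 : ℝ) → ℂ := fun r => (r : ℂ) ^ d * ((Real.exp (-(r : ℝ) ^ 2) : ℝ) : ℂ)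
  calc gI n P = ∫ x : En n, evalR P x * gw x := rfl
    _ = ∫ x : ({(0)}ᶜ : Set (En n)), evalR P x.1 * gw x.1 ∂((volume : Measure (En n)).comap (↑)) := by
      rw [integral_subtype_comap (measurableSet_singleton _).compl
        fun x : En n => evalR P x * gw x, restrict_compl_singleton]
    _ = ∫ x, F x.1 * G x.2 ∂((volume : Measure (En n)).toSphere.prod
          (.volumeIoiPow (Module.finrank ℝ (En n) - 1))) := by
      rw [← (volume : Measure (En n)).measurePreserving_homeomorphUnitSphereProd.integral_comp
        (Homeomorph.measurableEmbedding _) (fun x => F x.1 * G x.2)]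
      refine integral_congr_ae (.of_forall fun x => ?_)
      have hx : ‖x.1‖ ≠ 0 := norm_ne_zero_iff.2 x.2
      have hx2 : ‖x.1‖ • (‖x.1‖⁻¹ • x.1) = x.1 := by
        rw [smul_smul, mul_inv_cancel₀ hx, one_smul]
      simp only [F, G, homeomorphUnitSphereProd_apply_fst_coe,
        homeomorphUnitSphereProd_apply_snd_coe, gw]
      conv_lhs => rw [← hx2, evalR_smul hP, hx2]
      ring
    _ = sphI n P * ∫ r, G r ∂(.volumeIoiPow (n - 1)) := by
      rw [hdim, integral_prod_mul]
      rfl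
    _ = sphI n P * gJ (n - 1 + d) := by
      congr 1
      simp only [Measure.volumeIoiPow, ENNReal.ofReal]
      rw [integral_withDensity_eq_integral_smul, 
        integral_subtype_comap measurableSet_Ioi fun a : ℝ => Real.toNNReal (a ^ (n - 1)) •
          ((a : ℂ) ^ d * ((Real.exp (-a ^ 2) : ℝ) : ℂ)), gJ, ← integral_complex_ofReal]
      · refine setIntegral_congr_fun measurableSet_Ioi fun x hx => ?_
        have hx' : (0:ℝ) ≤ x := le_of_lt hx
        simp only [NNReal.smul_def, Real.coe_toNNReal _ (pow_nonneg hx' _), Complex.real_smul]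
        push_cast
        ring
      · exact (measurable_subtype_coe.pow_const _).real_toNNReal

lemma euler_hom {n d : ℕ} {P : MvPolynomial (Fin n) ℂ} (hP : P.IsHomogeneous d) :
    ∑ i, X i * pderiv i P = (d : ℂ) • P := by
  rw [hP.sum_X_mul_pderiv, Nat.cast_smul_eq_nsmul]

lemma pderiv_pderiv_comm' {n : ℕ} (i j : Fin n) (P : MvPolynomial (Fin n) ℂ) :
    pderiv i (pderiv j P) = pderiv j (pderiv i P) := by
  have h : ⁅(pderiv i : Derivation ℂ (MvPolynomial (Fin n) ℂ) (MvPolynomial (Fin n) ℂ)),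
      (pderiv j : Derivation ℂ (MvPolynomial (Fin n) ℂ) (MvPolynomial (Fin n) ℂ))⁆ = 0 := by
    refine MvPolynomial.derivation_ext fun k => ?_
    rw [Derivation.commutator_apply]
    simp only [pderiv_X, Derivation.zero_apply]
    by_cases h1 : k = i <;> by_cases h2 : k = j <;> simp [Pi.single_apply, h1, h2] <;> split_ifs <;> simp
  have := congrArg (fun D => D P) h
  simpa [Derivation.commutator_apply, sub_eq_zero] using this

lemma harm_pderiv {n : ℕ} {P : MvPolynomial (Fin n) ℂ} (h : IsHarmonicPoly n P) (i : Fin n) :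
    IsHarmonicPoly n (pderiv i P) := by
  unfold IsHarmonicPoly lap at *
  have := congrArg (pderiv i) h
  rw [map_sum, map_zero] at this
  rw [← this]
  refine Finset.sum_congr rfl fun j _ => ?_
  rw [pderiv_pderiv_comm' j i, pderiv_pderiv_comm' j i]

lemma hom_zero {n : ℕ} {P : MvPolynomial (Fin n) ℂ} (h : P.IsHomogeneous 0) :
    ∃ c, P = C c := ⟨_, totalDegree_eq_zero_iff_eq_C.1 ((totalDegree_zero_iff_isHomogeneous _).2 h)⟩

lemma gI_sum_X {n : ℕ} (f : Fin n → MvPolynomial (Fin n) ℂ) :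
    gI n (∑ i, X i * f i) = 1 / 2 * ∑ i, gI n (pderiv i (f i)) := by
  simp_rw [gI_pderiv, map_sum, ← Finset.mul_sum]
  ring

lemma gI_harm {n k : ℕ} (hk : 0 < k) {H : MvPolynomial (Fin n) ℂ} (hH : H.IsHomogeneous k)
    (hh : IsHarmonicPoly n H) : gI n H = 0 := by
  have h1 := congrArg (gI n) (euler_hom hH)
  rw [gI_sum_X, ← map_sum, show ∑ i, pderiv i (pderiv i H) = 0 from hh, map_zero, mul_zero,
    map_smul, smul_eq_mul] at h1
  have hk' : (k : ℂ) ≠ 0 := by exact_mod_cast hk.ne'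
  simpa [hk'] using h1.symm

lemma gI_lower {n : ℕ} (j : ℕ) : ∀ (k : ℕ), j < k → ∀ Q H : MvPolynomial (Fin n) ℂ,
    Q.IsHomogeneous j → H.IsHomogeneous k → IsHarmonicPoly n H → gI n (Q * H) = 0 := by
  induction j using Nat.strong_induction_on with
  | _ j ih =>
    intro k hk Q H hQ hH hh
    rcases j with _ | j
    · obtain ⟨c, rfl⟩ := hom_zero hQ
      rw [← smul_eq_C_mul, map_smul, gI_harm hk hH hh, smul_zero]
    · have h1 := euler_hom hQ
      have h2 : ∑ i, X i * (pderiv i Q * H) = ((j + 1 : ℕ) : ℂ) • (Q * H) := by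
        rw [← smul_mul_assoc, ← h1, Finset.sum_mul]
        simp_rw [mul_assoc]
      have h3 := congrArg (gI n) h2
      rw [gI_sum_X, map_smul, smul_eq_mul, Finset.sum_eq_zero, mul_zero] at h3
      · have hk' : ((j + 1 : ℕ) : ℂ) ≠ 0 := by exact_mod_cast j.succ_ne_zero
        exact (mul_eq_zero.1 h3.symm).resolve_left hk'
      · intro i _
        rw [Derivation.leibniz, smul_eq_mul, smul_eq_mul, map_add,
          ih j (by omega) (k - 1) (by omega) _ _ hQ.pderiv hH.pderiv (harm_pderiv hh i),
          mul_comm H, ih (j - 1) (by omega) k (by omega) _ _ hQ.pderiv.pderiv hH hh, add_zero]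

/-- the linear form `x ↦ ⟨θ, x⟩` -/
def lin {n : ℕ} (θ : En n) : MvPolynomial (Fin n) ℂ := ∑ i, X i * C (θ i : ℂ)

def rsq (n : ℕ) : MvPolynomial (Fin n) ℂ := ∑ i, X i * X i

lemma lin_hom {n : ℕ} (θ : En n) : (lin θ).IsHomogeneous 1 :=
  IsHomogeneous.sum _ _ _ fun i _ => (isHomogeneous_X _ i).mul (isHomogeneous_C _ _)

lemma rsq_hom (n : ℕ) : (rsq n).IsHomogeneous 2 :=
  IsHomogeneous.sum _ _ _ fun i _ => (isHomogeneous_X _ i).mul (isHomogeneous_X _ _)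

lemma gI_lin_pow {n : ℕ} (θ : En n) (k : ℕ) : ∀ H : MvPolynomial (Fin n) ℂ,
    H.IsHomogeneous k → IsHarmonicPoly n H →
    gI n (lin θ ^ k * H) = k.factorial / 2 ^ k * evalR H θ * gI n 1 := by
  induction k with
  | zero =>
    intro H hH _
    obtain ⟨c, rfl⟩ := hom_zero hH
    rw [← mul_one (C c), ← smul_eq_C_mul]
    simp [evalR]
  | succ k ih =>
    intro H hH hh
    have h1 : lin θ ^ (k + 1) * H = ∑ i, X i * (C (θ i : ℂ) * (lin θ ^ k * H)) := by
      rw [pow_succ', lin, mul_assoc, Finset.sum_mul]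
      simp_rw [mul_assoc]
    have h2 : ∀ i, gI n (pderiv i (C (θ i : ℂ) * (lin θ ^ k * H))) =
        (θ i : ℂ) * (k.factorial / 2 ^ k * evalR (pderiv i H) θ * gI n 1) := by
      intro i
      rw [← smul_eq_C_mul, Derivation.map_smul, Derivation.leibniz, map_smul, map_add, smul_eq_mul,
        smul_eq_mul, smul_eq_mul, ih _ hH.pderiv (harm_pderiv hh i), mul_comm H,
        gI_lower (k - 1) (k + 1) (by omega) _ _ _ hH hh, add_zero]
      have := (lin_hom θ).pow k
      rw [one_mul] at this
      exact this.pderiv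
    have h3 : ∑ i, (θ i : ℂ) * evalR (pderiv i H) θ = (k + 1) * evalR H θ := by
      have := congrArg (fun p => evalR p θ) (euler_hom hH)
      simpa [evalR] using this
    rw [h1, gI_sum_X]
    simp_rw [h2]
    have h4 : ∑ i, (θ i : ℂ) * (k.factorial / 2 ^ k * evalR (pderiv i H) θ * gI n 1) =
        (k.factorial / 2 ^ k * gI n 1) * ∑ i, (θ i : ℂ) * evalR (pderiv i H) θ := by
      rw [Finset.mul_sum]
      exact Finset.sum_congr rfl fun i _ => by ring
    rw [h4, h3, Nat.factorial_succ]
    push_cast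
    field_simp
    ring

lemma gI_rsq {n j k : ℕ} (hjk : j < k) {S H : MvPolynomial (Fin n) ℂ} (hS : S.IsHomogeneous j)
    (hH : H.IsHomogeneous k) (hh : IsHarmonicPoly n H) : gI n (rsq n * S * H) = 0 := by
  have h0 := gI_lower j k hjk S H hS hH hh
  have h1 : rsq n * S * H = ∑ i, X i * (X i * (S * H)) := by
    rw [rsq, mul_assoc, Finset.sum_mul]
    simp_rw [mul_assoc]
  have h2 : ∑ i, pderiv i (X i * (S * H)) = ((n + (j + k : ℕ)) : ℂ) • (S * H) := by
    have h3 : ∀ i, pderiv i (X i * (S * H)) = X i * pderiv i (S * H) + S * H := fun i => by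
      rw [Derivation.leibniz, pderiv_X_self, smul_eq_mul, smul_eq_mul, mul_one]
    simp_rw [h3]
    rw [Finset.sum_add_distrib, euler_hom (hS.mul hH)]
    simp [add_smul]
    rw [Nat.cast_smul_eq_nsmul ℂ n, nsmul_eq_mul]; ring
  rw [h1, gI_sum_X, ← map_sum, h2, map_smul, h0]
  simp

/-- Gegenbauer-type recursion: the coefficients of `(1 - 2 l w + s w²)^(-n/2)`. -/
def gG (n : ℕ) {A : Type*} [CommRing A] [Algebra ℚ A] (l s : A) : ℕ → A
  | 0 => 1
  | 1 => n * l
  | N + 2 => algebraMap ℚ A (1 / (N + 2)) *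
      ((2 * N + n + 2) * l * gG n l s (N + 1) - (N + n) * s * gG n l s N)

def gE (n : ℕ) {A : Type*} [CommRing A] [Algebra ℚ A] (l s : A) : ℕ → A
  | 0 => 1
  | 1 => n * l
  | N + 2 => gG n l s (N + 2) - s * gG n l s N

lemma gG_map (n : ℕ) {A B : Type*} [CommRing A] [Algebra ℚ A] [CommRing B] [Algebra ℚ B]
    (f : A →+* B) (l s : A) (N : ℕ) : f (gG n l s N) = gG n (f l) (f s) N := by
  induction N using Nat.strong_induction_on with
  | _ N ih =>
    rcases N with _ | _ | N
    · simp [gG]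
    · simp [gG]
    · have : f (algebraMap ℚ A (1 / (N + 2))) = algebraMap ℚ B (1 / (N + 2)) :=
        congrFun (congrArg DFunLike.coe (Subsingleton.elim (f.comp (algebraMap ℚ A)) (algebraMap ℚ B))) _
      simp only [gG, map_mul, map_sub, map_add, ih (N + 1) (by omega), ih N (by omega), this,
        map_natCast, map_ofNat]

lemma gE_map (n : ℕ) {A B : Type*} [CommRing A] [Algebra ℚ A] [CommRing B] [Algebra ℚ B]
    (f : A →+* B) (l s : A) (N : ℕ) : f (gE n l s N) = gE n (f l) (f s) N := by
  rcases N with _ | _ | N <;> simp [gE, gG_map]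

def lead (n : ℕ) : ℕ → ℚ
  | 0 => 1
  | k + 1 => (2 * k + n) / (k + 1) * lead n k

lemma hom_cmul {n d : ℕ} {P : MvPolynomial (Fin n) ℂ} (hP : P.IsHomogeneous d) (q : ℚ) :
    (algebraMap ℚ (MvPolynomial (Fin n) ℂ) q * P).IsHomogeneous d := by
  rw [show algebraMap ℚ (MvPolynomial (Fin n) ℂ) q = C (algebraMap ℚ ℂ q) from rfl]
  exact hP.C_mul _

lemma gG_lead {n : ℕ} (θ : En n) (N : ℕ) :
    (gG n (lin θ) (rsq n) N).IsHomogeneous N ∧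
    ∃ S : MvPolynomial (Fin n) ℂ, (∀ Q, S * Q ≠ 0 → 2 ≤ N) ∧ S.IsHomogeneous (N - 2) ∧
      gG n (lin θ) (rsq n) N = algebraMap ℚ _ (lead n N) * lin θ ^ N + rsq n * S := by
  induction N using Nat.strong_induction_on with
  | _ N ih =>
    rcases N with _ | _ | N
    · exact ⟨isHomogeneous_one _ _, 0, by simp, isHomogeneous_zero _ _ _, by simp [gG, lead]⟩
    · refine ⟨?_, 0, by simp, isHomogeneous_zero _ _ _, by simp [gG, lead]⟩
      have := hom_cmul (lin_hom θ) n
      rw [map_natCast] at this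
      exact this
    · obtain ⟨h1, S, hS0, hS, hS1⟩ := ih (N + 1) (by omega)
      obtain ⟨h2, -⟩ := ih N (by omega)
      have hS' : (lin θ * S).IsHomogeneous N := by
        by_cases hz : S = 0
        · rw [hz, mul_zero]; exact isHomogeneous_zero _ _ _
        · have := hS0 1 (by simpa using hz)
          have h := (lin_hom θ).mul hS
          rwa [show 1 + (N + 1 - 2) = N by omega] at h
      have hSS : ∀ q q' : ℚ, (algebraMap ℚ _ q * (lin θ * S) - algebraMap ℚ _ q' *
          gG n (lin θ) (rsq n) N).IsHomogeneous N := fun q q' =>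
        (hom_cmul hS' q).sub (hom_cmul h2 q')
      have key : gG n (lin θ) (rsq n) (N + 2) = algebraMap ℚ _ (lead n (N + 2)) * lin θ ^ (N + 2) +
          rsq n * (algebraMap ℚ _ ((2 * N + n + 2) / (N + 2)) * (lin θ * S) -
            algebraMap ℚ _ ((N + n) / (N + 2)) * gG n (lin θ) (rsq n) N) := by
        rw [gG, hS1]
        have e1 : lead n (N + 2) = 1 / (N + 2) * (2 * N + n + 2) * lead n (N + 1) := by
          rw [lead]; push_cast; ring
        have e2 : ((2 * N + n + 2) / (N + 2) : ℚ) = 1 / (N + 2) * (2 * N + n + 2) := by ring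
        have e3 : ((N + n) / (N + 2) : ℚ) = 1 / (N + 2) * (N + n) := by ring
        rw [e1, e2, e3]
        simp only [map_mul, map_add, map_natCast, map_ofNat]
        ring
      refine ⟨?_, _, fun _ _ => by omega, hSS _ _, key⟩
      have ht := (rsq_hom n).mul (hSS ((2 * N + n + 2) / (N + 2)) ((N + n) / (N + 2)))
      rw [show 2 + N = N + 2 by omega] at ht
      have hp := (lin_hom θ).pow (N + 2)
      rw [one_mul] at hp
      rw [key]
      exact (hom_cmul hp _).add ht

lemma gE_lead {n : ℕ} (θ : En n) (N : ℕ) :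
    (gE n (lin θ) (rsq n) N).IsHomogeneous N ∧
    ∃ S : MvPolynomial (Fin n) ℂ, (∀ Q, S * Q ≠ 0 → 2 ≤ N) ∧ S.IsHomogeneous (N - 2) ∧
      gE n (lin θ) (rsq n) N = algebraMap ℚ _ (lead n N) * lin θ ^ N + rsq n * S := by
  rcases N with _ | _ | N
  · exact gG_lead θ 0
  · exact gG_lead θ 1
  · obtain ⟨h1, S, hS0, hS, hS1⟩ := gG_lead θ (N + 2)
    obtain ⟨h2, -⟩ := gG_lead θ N
    refine ⟨?_, S - gG n (lin θ) (rsq n) N, fun _ _ => by omega, hS.sub h2, ?_⟩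
    · have ht := (rsq_hom n).mul h2
      rw [show 2 + N = N + 2 by omega] at ht
      exact h1.sub ht
    · rw [gE, hS1]; ring

lemma lead_gJ {n : ℕ} (hn : 1 ≤ n) (k : ℕ) :
    (lead n k : ℝ) * (k.factorial / 2 ^ k) * gJ (n - 1) = gJ (n - 1 + 2 * k) := by
  induction k with
  | zero => simp [lead]
  | succ k ih =>
    rw [show n - 1 + 2 * (k + 1) = n - 1 + 2 * k + 2 by ring, gJ_rec, ← ih, lead,
      Nat.factorial_succ]
    push_cast [Nat.cast_sub hn]
    field_simp
    ring

lemma sphI_one (n : ℕ) : sphI n 1 = omegaN n := by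
  simp [sphI, evalR, omegaN, Measure.real]

lemma reproduce {n : ℕ} (hn : 1 ≤ n) (θ : En n) (k : ℕ) {H : MvPolynomial (Fin n) ℂ}
    (hH : H.IsHomogeneous k) (hh : IsHarmonicPoly n H) :
    sphI n (gE n (lin θ) (rsq n) k * H) = omegaN n * evalR H θ := by
  obtain ⟨h1, S, hS0, hS, hS1⟩ := gE_lead θ k
  have hg : gI n (gE n (lin θ) (rsq n) k * H) = (lead n k : ℂ) * (k.factorial / 2 ^ k * evalR H θ * gI n 1) := by
    rw [hS1, add_mul, map_add, mul_assoc,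
      show algebraMap ℚ (MvPolynomial (Fin n) ℂ) (lead n k) = C (algebraMap ℚ ℂ (lead n k)) from rfl,
      ← smul_eq_C_mul, map_smul, gI_lin_pow θ k H hH hh]
    have : gI n (rsq n * S * H) = 0 := by
      by_cases hz : S = 0
      · simp [hz]
      · have := hS0 1 (by simpa using hz)
        exact gI_rsq (by omega) hS hH hh
    rw [this, add_zero]
    simp
  rw [gI_polar hn (h1.mul hH), gI_polar hn (isHomogeneous_one _ _), sphI_one,
    ← two_mul k, ← lead_gJ hn k] at hg
  have hJ : (gJ (n - 1) : ℂ) ≠ 0 := by exact_mod_cast (gJ_pos _).ne'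
  have hl : (lead n k : ℂ) * (k.factorial / 2 ^ k) ≠ 0 := by
    have h := lead_gJ hn k
    have h2 := (gJ_pos (n - 1 + 2 * k)).ne'
    rw [← h] at h2
    have h3 := Complex.ofReal_ne_zero.2 (left_ne_zero_of_mul h2)
    push_cast at h3
    exact h3
  push_cast at hg
  rw [add_zero] at hg
  refine mul_right_cancel₀ (mul_ne_zero hl hJ) ?_
  linear_combination hg

section ps
variable {A : Type*} [CommRing A] [Algebra ℚ A]

def psF (n : ℕ) (l s : A) : PowerSeries A := PowerSeries.mk (gG n l s)

def psD (l s : A) : PowerSeries A :=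
  1 - PowerSeries.C (2 * l) * PowerSeries.X + PowerSeries.C s * PowerSeries.X ^ 2

lemma psF_ode (n : ℕ) (l s : A) :
    psD l s * PowerSeries.derivative A (psF n l s) =
      (n : PowerSeries A) * (PowerSeries.C l - PowerSeries.C s * PowerSeries.X) * psF n l s := by
  have hr : ∀ N : ℕ, gG n l s (N + 2) * (N + 2) =
      (2 * N + n + 2) * l * gG n l s (N + 1) - (N + n) * s * gG n l s N := by
    intro N
    rw [gG]
    have : algebraMap ℚ A (1 / (N + 2)) * (N + 2) = 1 := by
      have h : ((1 : ℚ) / (N + 2)) * (N + 2) = 1 := by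
        have : (N + 2 : ℚ) ≠ 0 := by positivity
        field_simp
      have := congrArg (algebraMap ℚ A) h
      simpa only [map_mul, map_add, map_natCast, map_ofNat, map_one] using this
    linear_combination ((2 * N + n + 2) * l * gG n l s (N + 1) - (N + n) * s * gG n l s N) * this
  have e1 : psD l s * PowerSeries.derivative A (psF n l s) =
      PowerSeries.derivative A (psF n l s) -
      PowerSeries.C (2 * l) * (PowerSeries.X * PowerSeries.derivative A (psF n l s)) +
      PowerSeries.C s * (PowerSeries.X * (PowerSeries.X *
        PowerSeries.derivative A (psF n l s))) := by
    rw [psD]; ring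
  have e2 : (n : PowerSeries A) * (PowerSeries.C l - PowerSeries.C s * PowerSeries.X) * psF n l s =
      PowerSeries.C (n * l) * psF n l s - PowerSeries.C (n * s) * (PowerSeries.X * psF n l s) := by
    rw [map_mul, map_mul, map_natCast]; ring
  rw [e1, e2]
  ext N
  rcases N with _ | _ | N
  · simp only [map_add, map_sub, PowerSeries.coeff_C_mul,
      PowerSeries.coeff_zero_X_mul, PowerSeries.coeff_derivative, psF, PowerSeries.coeff_mk]
    simp [gG]
  · have := hr 0
    simp only [map_add, map_sub, PowerSeries.coeff_C_mul, PowerSeries.coeff_succ_X_mul,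
      PowerSeries.coeff_zero_X_mul, PowerSeries.coeff_derivative, psF, PowerSeries.coeff_mk]
    simp only [gG] at this ⊢
    push_cast at this ⊢
    linear_combination this
  · have := hr (N + 1)
    simp only [map_add, map_sub, PowerSeries.coeff_C_mul, PowerSeries.coeff_succ_X_mul,
      PowerSeries.coeff_derivative, psF, PowerSeries.coeff_mk]
    push_cast at this ⊢
    linear_combination this

lemma psD_const (l s : A) : PowerSeries.constantCoeff (psD l s) = 1 := by
  simp [psD]

lemma psF_const (n : ℕ) (l s : A) : PowerSeries.constantCoeff (psF n l s) = 1 := by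
  rw [← PowerSeries.coeff_zero_eq_constantCoeff_apply]
  simp [psF, gG]

lemma psF_sq [IsAddTorsionFree A] (n : ℕ) (l s : A) : psF n l s ^ 2 * psD l s ^ n = 1 := by
  apply PowerSeries.derivative.ext
  · rw [PowerSeries.derivative_one, Derivation.leibniz, PowerSeries.derivative_pow,
      PowerSeries.derivative_pow, smul_eq_mul, smul_eq_mul]
    have hD : PowerSeries.derivative A (psD l s) =
        -2 * (PowerSeries.C l - PowerSeries.C s * PowerSeries.X) := by
      have c2 : (PowerSeries.C (2 : A)) = 2 := map_ofNat _ 2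
      rw [psD, map_add, map_sub, Derivation.leibniz, Derivation.leibniz, PowerSeries.derivative_pow]
      have d2 : PowerSeries.derivative A (2 : PowerSeries A) = 0 := by
        rw [← c2, PowerSeries.derivative_C]
      simp [c2, d2]
      ring
    have ho := psF_ode n l s
    rcases n with _ | n
    · have : PowerSeries.derivative A (psF 0 l s) = 0 := by
        have h2 : IsUnit (psD l s) := by
          rw [PowerSeries.isUnit_iff_constantCoeff, psD_const]; exact isUnit_one
        refine h2.mul_left_cancel ?_
        rw [ho]; simp
      simp [this]
    · rw [hD]
      simp only [Nat.add_sub_cancel]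
      push_cast at ho ⊢
      linear_combination (2 * psF (n+1) l s * psD l s ^ n) * ho
  · simp [psF_const, psD_const]

lemma coeff_TF (n : ℕ) (l s : A) (k : ℕ) :
    PowerSeries.coeff k ((1 - PowerSeries.C s * PowerSeries.X ^ 2) * psF n l s) = gE n l s k := by
  have : (1 - PowerSeries.C s * PowerSeries.X ^ 2) * psF n l s =
      psF n l s - PowerSeries.C s * (PowerSeries.X * (PowerSeries.X * psF n l s)) := by ring
  rw [this]
  rcases k with _ | _ | k
  · simp [psF, gG, gE]
  · simp only [map_sub, PowerSeries.coeff_C_mul, PowerSeries.coeff_succ_X_mul,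
      PowerSeries.coeff_zero_X_mul, psF, PowerSeries.coeff_mk]
    simp [gG, gE]
  · simp only [map_sub, PowerSeries.coeff_C_mul, PowerSeries.coeff_succ_X_mul,
      psF, PowerSeries.coeff_mk, gE]

end ps

/-- coefficientwise partial derivative -/
def psd {n : ℕ} (i : Fin n) : Derivation ℂ (PowerSeries (MvPolynomial (Fin n) ℂ))
    (PowerSeries (MvPolynomial (Fin n) ℂ)) :=
  Derivation.mk'
    { toFun := fun f => PowerSeries.mk fun N => pderiv i (PowerSeries.coeff N f)
      map_add' := fun f g => by ext1 N; simp
      map_smul' := fun c f => by ext1 N; simp }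
    (fun f g => by
      ext1 N
      simp only [LinearMap.coe_mk, AddHom.coe_mk, smul_eq_mul, PowerSeries.coeff_mk, map_add,
        PowerSeries.coeff_mul, map_sum, Derivation.leibniz, Finset.sum_add_distrib]
      congr 1
      rw [← Finset.Nat.sum_antidiagonal_swap]
      rfl)

lemma coeff_psd {n : ℕ} (i : Fin n) (f : PowerSeries (MvPolynomial (Fin n) ℂ)) (N : ℕ) :
    PowerSeries.coeff N (psd i f) = pderiv i (PowerSeries.coeff N f) :=
  PowerSeries.coeff_mk (R := MvPolynomial (Fin n) ℂ) N (fun N => pderiv i (PowerSeries.coeff N f))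

lemma psd_C {n : ℕ} (i : Fin n) (p : MvPolynomial (Fin n) ℂ) :
    psd i (PowerSeries.C p) = PowerSeries.C (pderiv i p) := by
  ext1 N
  rw [coeff_psd, PowerSeries.coeff_C, PowerSeries.coeff_C]
  split_ifs <;> simp

lemma psd_X {n : ℕ} (i : Fin n) :
    psd i (PowerSeries.X : PowerSeries (MvPolynomial (Fin n) ℂ)) = 0 := by
  ext1 N
  rw [coeff_psd, PowerSeries.coeff_X]
  split_ifs <;> simp

lemma pderiv_lin {n : ℕ} (θ : En n) (i : Fin n) : pderiv i (lin θ) = C (θ i : ℂ) := by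
  simp only [lin, map_sum, Derivation.leibniz, pderiv_C, pderiv_X, smul_zero, zero_add, smul_eq_mul]
  rw [Finset.sum_eq_single i] <;> simp +contextual [Pi.single_apply]

lemma pderiv_rsq {n : ℕ} (i : Fin n) : pderiv i (rsq n) = 2 * X i := by
  simp only [rsq, map_sum, Derivation.leibniz, pderiv_X, smul_eq_mul]
  rw [Finset.sum_eq_single i] <;> simp +contextual [Pi.single_apply]
  ring

lemma gE_harm {n : ℕ} (hn : 1 ≤ n) (θ : En n) (hθ : ‖θ‖ = 1) (k : ℕ) :
    IsHarmonicPoly n (gE n (lin θ) (rsq n) k) := by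
  set W : PowerSeries (MvPolynomial (Fin n) ℂ) := PowerSeries.X with hW
  set D := psD (lin θ) (rsq n) with hD
  set F := psF n (lin θ) (rsq n) with hF
  set T : PowerSeries (MvPolynomial (Fin n) ℂ) := 1 - PowerSeries.C (rsq n) * W ^ 2 with hT
  let c : Fin n → PowerSeries (MvPolynomial (Fin n) ℂ) := fun i => PowerSeries.C (C (θ i : ℂ))
  let x : Fin n → PowerSeries (MvPolynomial (Fin n) ℂ) := fun i => PowerSeries.C (X i)
  have hD0 : D ≠ 0 := fun h => by
    have := psD_const (lin θ) (rsq n); rw [← hD, h] at this; simp at this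
  have hF0 : F ≠ 0 := fun h => by
    have := psF_const n (lin θ) (rsq n); rw [← hF, h] at this; simp at this
  have d2 : ∀ i, psd i (2 : PowerSeries (MvPolynomial (Fin n) ℂ)) = 0 := fun i => by
    have := Derivation.map_natCast (psd i) 2
    exact_mod_cast this
  have dW : ∀ i, psd i W = 0 := fun i => psd_X i
  have c2 : (PowerSeries.C (2 : MvPolynomial (Fin n) ℂ)) = 2 := map_ofNat _ 2
  have dD : ∀ i, psd i D = -2 * c i * W + 2 * x i * W ^ 2 := fun i => by
    simp only [hD, psD, map_add, map_sub, Derivation.leibniz, psd_C, Derivation.leibniz_pow, psd_X,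
      Derivation.map_one_eq_zero, pderiv_rsq, pderiv_lin, dW, c2, c, x, smul_eq_mul,
      map_mul, d2]
    simp
    ring
  have dx : ∀ i, psd i (x i) = 1 := fun i => by simp [x, psd_C]
  have dc : ∀ i j, psd i (c j) = 0 := fun i j => by simp [c, psd_C]
  have ddD : ∀ i, psd i (psd i D) = 2 * W ^ 2 := fun i => by
    rw [dD]
    simp only [map_add, map_neg, neg_mul, Derivation.leibniz, Derivation.leibniz_pow, dW, dx, dc, smul_eq_mul,
      d2]
    simp
    ring
  have dT : ∀ i, psd i T = -2 * x i * W ^ 2 := fun i => by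
    simp only [hT, map_sub, Derivation.leibniz, psd_C, Derivation.leibniz_pow, dW, c2,
      Derivation.map_one_eq_zero, pderiv_rsq, x, smul_eq_mul, map_mul]
    simp
    ring
  have ddT : ∀ i, psd i (psd i T) = -2 * W ^ 2 := fun i => by
    rw [dT]
    simp only [map_neg, neg_mul, Derivation.leibniz, Derivation.leibniz_pow, dW, dx, smul_eq_mul,
      d2]
    simp
    ring
  have dF : ∀ i, 2 * D * psd i F = -n * F * psd i D := fun i => by
    have h := congrArg (psd i) (psF_sq n (lin θ) (rsq n))
    rw [← hF, ← hD, Derivation.map_one_eq_zero, Derivation.leibniz, Derivation.leibniz_pow,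
      Derivation.leibniz_pow] at h
    obtain ⟨m, rfl⟩ : ∃ m, n = m + 1 := ⟨n - 1, by omega⟩
    simp only [Nat.add_sub_cancel, nsmul_eq_mul, smul_eq_mul] at h
    have hz : (F * D ^ m) * (2 * D * psd i F - -((m + 1 : ℕ) : PowerSeries _) * F * psd i D) = 0 := by
      rw [← h]; push_cast; ring
    exact sub_eq_zero.1 ((mul_eq_zero.1 hz).resolve_left (mul_ne_zero hF0 (pow_ne_zero _ hD0)))
  have ddF : ∀ i, 4 * D ^ 2 * psd i (psd i F) =
      n * (n + 2) * F * (psd i D) ^ 2 - 2 * n * D * F * psd i (psd i D) := fun i => by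
    have h := congrArg (psd i) (dF i)
    simp only [map_neg, neg_mul, Derivation.leibniz, smul_eq_mul, d2,
      Derivation.map_natCast] at h
    linear_combination 2 * D * h - (n + 2) * psd i D * dF i
  have hcc : ∑ i, c i * c i = 1 := by
    have h : ∑ i, (θ i : ℂ) * (θ i : ℂ) = 1 := by
      have h1 : ∑ i, θ i * θ i = 1 := by
        have := EuclideanSpace.real_norm_sq_eq θ
        rw [hθ] at this
        simpa [← sq] using this.symm
      exact_mod_cast h1
    simp only [c, ← map_mul, ← map_sum]
    rw [h]; simp
  have hcx : ∑ i, x i * c i = PowerSeries.C (lin θ) := by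
    simp only [c, x, ← map_mul, ← map_sum]; rfl
  have hxx : ∑ i, x i * x i = PowerSeries.C (rsq n) := by
    simp only [x, ← map_mul, ← map_sum]; rfl
  have hDe : D = 1 - 2 * PowerSeries.C (lin θ) * W + PowerSeries.C (rsq n) * W ^ 2 := by
    rw [hD, psD, map_mul, map_ofNat]
  have each : ∀ i, 4 * D ^ 2 * psd i (psd i (T * F)) =
      (D * F * W ^ 2) * (-8 * D + 16 * n * W * (W * (x i * x i) - x i * c i) * 1 - 4 * n * T)
       + 4 * n * (n + 2) * T * F * W ^ 2 *
        (c i * c i - 2 * W * (x i * c i) + W ^ 2 * (x i * x i)) := fun i => by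
    have h1 : psd i (psd i (T * F)) =
        T * psd i (psd i F) + 2 * psd i T * psd i F + psd i (psd i T) * F := by
      simp only [Derivation.leibniz, smul_eq_mul, map_add]
      ring
    have h2 := ddF i
    have h3 := dF i
    rw [ddD, dD] at h2
    rw [dD] at h3
    rw [h1, ddT, dT]
    linear_combination T * h2 + 4 * D * (-2 * x i * W ^ 2) * h3
  have tot : 4 * D ^ 2 * ∑ i, psd i (psd i (T * F)) = 0 := by
    rw [Finset.mul_sum, Finset.sum_congr rfl fun i _ => each i]
    simp only [mul_one, mul_add, mul_sub, Finset.sum_add_distrib, Finset.sum_sub_distrib,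
      ← Finset.mul_sum, hcc, hcx, hxx]
    simp only [← mul_assoc, Finset.sum_const, Finset.card_univ, Fintype.card_fin, nsmul_eq_mul]
    simp only [mul_assoc, ← Finset.mul_sum, hxx]
    rw [hDe, hT]
    ring
  have h4 : (4 : PowerSeries (MvPolynomial (Fin n) ℂ)) * D ^ 2 ≠ 0 :=
    mul_ne_zero (fun h => by
      have := congrArg PowerSeries.constantCoeff h
      rw [map_ofNat, map_zero] at this; norm_num at this) (pow_ne_zero _ hD0)
  have tot' := (mul_eq_zero.1 tot).resolve_left h4
  have := congrArg (PowerSeries.coeff k) tot'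
  rw [map_sum, map_zero] at this
  simp_rw [coeff_psd, hT, hF, hW, coeff_TF] at this
  exact this

def bsr (n : ℕ) (a : ℂ) : PowerSeries ℂ :=
  PowerSeries.rescale (-a) (PowerSeries.binomialSeries ℂ (-((n : ℂ) / 2)))

lemma bsr_sq (n : ℕ) (a : ℂ) :
    bsr n a ^ 2 * (1 - PowerSeries.C a * PowerSeries.X) ^ n = 1 := by
  have h : PowerSeries.binomialSeries ℂ (-((n : ℂ) / 2)) ^ 2 * (1 + PowerSeries.X) ^ n = 1 := by
    have := PowerSeries.binomialSeries_nat (R := ℂ) (A := ℂ) n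
    rw [← this, sq, ← PowerSeries.binomialSeries_add, ← PowerSeries.binomialSeries_add,
      ← PowerSeries.binomialSeries_zero (R := ℂ)]
    congr 1; ring
  have h2 := congrArg (PowerSeries.rescale (-a)) h
  rw [map_mul, map_pow, map_pow, map_add, map_one, PowerSeries.rescale_X] at h2
  rw [map_neg, neg_mul, ← sub_eq_add_neg] at h2
  exact h2

lemma bsr_const (n : ℕ) (a : ℂ) : PowerSeries.constantCoeff (bsr n a) = 1 := by
  rw [← PowerSeries.coeff_zero_eq_constantCoeff_apply]
  simp [bsr, PowerSeries.coeff_rescale]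

lemma psF_eq (n : ℕ) (a b : ℂ) : psF n ((a + b) / 2) (a * b) = bsr n a * bsr n b := by
  have h1 := psF_sq n ((a + b) / 2) (a * b)
  have hD : psD ((a + b) / 2) (a * b) = (1 - PowerSeries.C a * PowerSeries.X) *
      (1 - PowerSeries.C b * PowerSeries.X) := by
    rw [psD, mul_div_cancel₀ _ (two_ne_zero), map_add, map_mul]; ring
  have h2 : (bsr n a * bsr n b) ^ 2 * psD ((a + b) / 2) (a * b) ^ n = 1 := by
    rw [hD, mul_pow, mul_pow]
    linear_combination (bsr n b ^ 2 * (1 - PowerSeries.C b * PowerSeries.X) ^ n) * bsr_sq n a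
      + bsr_sq n b
  have hu : IsUnit (psD ((a + b) / 2) (a * b) ^ n) := IsUnit.of_mul_eq_one_right _ h1
  have h3 := hu.mul_right_cancel (h1.trans h2.symm)
  rcases sq_eq_sq_iff_eq_or_eq_neg.1 h3 with h | h
  · exact h
  · have := congrArg PowerSeries.constantCoeff h
    rw [map_neg, map_mul, psF_const, bsr_const, bsr_const] at this
    norm_num at this

lemma bsr_hasSum (n : ℕ) (a w : ℂ) (h : ‖a * w‖ < 1) :
    HasSum (fun i => PowerSeries.coeff i (bsr n a) * w ^ i) ((1 - a * w) ^ (-((n : ℂ) / 2))) := by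
  have := (Complex.one_add_cpow_hasFPowerSeriesOnBall_zero (a := -((n : ℂ) / 2))).hasSum
    (y := -(a * w)) (by
      rw [Metric.mem_eball, edist_zero_right, ← ofReal_norm, norm_neg]
      exact ENNReal.ofReal_lt_one.2 h)
  have e : (fun i => PowerSeries.coeff i (bsr n a) * w ^ i) =
      fun i : ℕ => binomialSeries ℂ (-((n : ℂ) / 2)) i (fun _ : Fin i => -(a * w)) := by
    funext i
    simp only [binomialSeries_apply, List.ofFn_const, List.prod_replicate, smul_eq_mul]
    simp [bsr, PowerSeries.coeff_rescale]
    rw [neg_mul_eq_neg_mul, mul_pow]; ring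
  have e3 : 1 + (0 + -(a * w)) = 1 - a * w := by ring
  rw [e, ← e3]
  exact this

lemma cpow_mul_pos {x y : ℂ} (hx : 0 < x.re) (hy : 0 < y.re) (c : ℂ) :
    (x * y) ^ c = x ^ c * y ^ c := by
  have hx0 : x ≠ 0 := fun h => by simp [h] at hx
  have hy0 : y ≠ 0 := fun h => by simp [h] at hy
  have ax := abs_lt.1 (Complex.abs_arg_lt_pi_div_two_iff.2 (Or.inl hx))
  have ay := abs_lt.1 (Complex.abs_arg_lt_pi_div_two_iff.2 (Or.inl hy))
  rw [Complex.cpow_def_of_ne_zero (mul_ne_zero hx0 hy0), Complex.cpow_def_of_ne_zero hx0,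
    Complex.cpow_def_of_ne_zero hy0, Complex.log_mul hx0 hy0, add_mul, Complex.exp_add]
  constructor <;> linarith [ax.1, ax.2, ay.1, ay.2]

lemma gG_hasSum_ab (n : ℕ) (a b w : ℂ) (ha : ‖a * w‖ < 1) (hb : ‖b * w‖ < 1) :
    HasSum (fun N => gG n ((a + b) / 2) (a * b) N * w ^ N)
      ((1 - 2 * ((a + b) / 2) * w + a * b * w ^ 2) ^ (-((n : ℂ) / 2))) := by
  have hA := bsr_hasSum n a w ha
  have hB := bsr_hasSum n b w hb
  have re : ∀ z : ℂ, ‖z‖ < 1 → 0 < (1 - z).re := fun z hz => by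
    have := Complex.re_le_norm z
    simp; linarith
  have e : (1 - 2 * ((a + b) / 2) * w + a * b * w ^ 2) = (1 - a * w) * (1 - b * w) := by ring
  rw [e, cpow_mul_pos (re _ ha) (re _ hb), ← hA.tsum_eq, ← hB.tsum_eq,
    tsum_mul_tsum_eq_tsum_sum_antidiagonal_of_summable_norm hA.summable.norm hB.summable.norm]
  have e2 : (fun N => gG n ((a + b) / 2) (a * b) N * w ^ N) = fun N =>
      ∑ kl ∈ Finset.HasAntidiagonal.antidiagonal N, PowerSeries.coeff kl.1 (bsr n a) * w ^ kl.1 *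
        (PowerSeries.coeff kl.2 (bsr n b) * w ^ kl.2) := by
    funext N
    have : gG n ((a + b) / 2) (a * b) N = PowerSeries.coeff N (bsr n a * bsr n b) := by
      rw [← psF_eq, psF, PowerSeries.coeff_mk]
    rw [this, PowerSeries.coeff_mul, Finset.sum_mul]
    refine Finset.sum_congr rfl fun kl hkl => ?_
    rw [← Finset.HasAntidiagonal.mem_antidiagonal.1 hkl, pow_add]; ring
  rw [e2]
  exact (summable_sum_mul_antidiagonal_of_summable_norm' hA.summable.norm hA.summable
    hB.summable.norm hB.summable).hasSum

lemma gG_hasSum (n : ℕ) (l r : ℝ) (hl : |l| ≤ r) (w : ℂ) (hw : r * ‖w‖ < 1) :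
    HasSum (fun N => gG n (l : ℂ) ((r : ℂ) ^ 2) N * w ^ N)
      ((1 - 2 * (l : ℂ) * w + (r : ℂ) ^ 2 * w ^ 2) ^ (-((n : ℂ) / 2))) := by
  have hr : 0 ≤ r := (abs_nonneg _).trans hl
  have h2 : 0 ≤ r ^ 2 - l ^ 2 := by
    have := sq_le_sq' (neg_le_of_abs_le hl) (le_of_abs_le hl); linarith
  set s := Real.sqrt (r ^ 2 - l ^ 2) with hs
  have hss : s ^ 2 = r ^ 2 - l ^ 2 := Real.sq_sqrt h2
  have n1 : ‖(l + s * Complex.I : ℂ)‖ = r := by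
    rw [Complex.norm_add_mul_I, hss]; simp [Real.sqrt_sq hr]
  have n2 : ‖(l - s * Complex.I : ℂ)‖ = r := by
    have : (l - s * Complex.I : ℂ) = (l + ((-s : ℝ) : ℂ) * Complex.I : ℂ) := by push_cast; ring
    rw [this, Complex.norm_add_mul_I, neg_sq, hss]; simp [Real.sqrt_sq hr]
  have := gG_hasSum_ab n (l + s * Complex.I) (l - s * Complex.I) w
    (by rw [norm_mul, n1]; exact hw) (by rw [norm_mul, n2]; exact hw)
  have e1 : ((l + s * Complex.I : ℂ) + (l - s * Complex.I : ℂ)) / 2 = l := by ring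
  have e2 : (l + s * Complex.I : ℂ) * (l - s * Complex.I : ℂ) = (r : ℂ) ^ 2 := by
    have : (s : ℂ) ^ 2 = (r : ℂ) ^ 2 - (l : ℂ) ^ 2 := by exact_mod_cast hss
    linear_combination this - (s:ℂ) ^ 2 * Complex.I_sq
  rwa [e1, e2] at this

/-- the `gE` series -/
lemma gE_hasSum (n : ℕ) (l r : ℝ) (hl : |l| ≤ r) (w : ℂ) (hw : r * ‖w‖ < 1) :
    HasSum (fun N => gE n (l : ℂ) ((r : ℂ) ^ 2) N * w ^ N)
      ((1 - (r : ℂ) ^ 2 * w ^ 2) *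
        (1 - 2 * (l : ℂ) * w + (r : ℂ) ^ 2 * w ^ 2) ^ (-((n : ℂ) / 2))) := by
  have h := gG_hasSum n l r hl w hw
  set f := (1 - 2 * (l : ℂ) * w + (r : ℂ) ^ 2 * w ^ 2) ^ (-((n : ℂ) / 2))
  rw [← hasSum_nat_add_iff' 2]
  have h2 := ((hasSum_nat_add_iff' 2).2 h).sub (h.mul_left ((r : ℂ) ^ 2 * w ^ 2))
  convert h2 using 1
  · funext N
    rw [gE, pow_add]; ring
  · simp [Finset.sum_range_succ, gE, gG]; ring

lemma evalR_gE {n : ℕ} (θ x : En n) (k : ℕ) :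
    evalR (gE n (lin θ) (rsq n) k) x = gE n ((inner ℝ θ x : ℝ) : ℂ) ((‖x‖ : ℂ) ^ 2) k := by
  rw [evalR, gE_map _ (MvPolynomial.eval (fun i => (x i : ℂ)))]
  congr 1
  · simp [lin, PiLp.inner_apply]
  · have := EuclideanSpace.real_norm_sq_eq x
    rw [← Complex.ofReal_pow, this]
    simp [rsq, sq]

lemma conj_gE (n : ℕ) (l s : ℝ) (k : ℕ) :
    (starRingEnd ℂ) (gE n (l : ℂ) (s : ℂ) k) = gE n (l : ℂ) (s : ℂ) k := by
  rw [gE_map _ (starRingEnd ℂ)]; simp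

lemma omegaN_pos {n : ℕ} (hn : 2 ≤ n) : 0 < omegaN n := by
  have : Nontrivial (En n) := by
    have : Nonempty (Fin n) := ⟨⟨0, by omega⟩⟩
    infer_instance
  have : IsFiniteMeasure (sphereMeasure n) := by unfold sphereMeasure; infer_instance
  rw [omegaN]
  refine ENNReal.toReal_pos ?_ (measure_ne_top _ _)
  rw [Ne, Measure.measure_univ_eq_zero]
  exact Measure.toSphere_ne_zero _

lemma continuous_evalR {n : ℕ} (P : MvPolynomial (Fin n) ℂ) : Continuous (fun x : En n => evalR P x) := by
  unfold evalR
  exact P.continuous_eval.comp (by fun_prop)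

lemma evalR_conj {n : ℕ} (P : MvPolynomial (Fin n) ℂ) (x : En n) :
    evalR (MvPolynomial.map (starRingEnd ℂ) P) x = (starRingEnd ℂ) (evalR P x) := by
  rw [evalR, evalR, MvPolynomial.eval_map, ← MvPolynomial.eval₂_id, MvPolynomial.hom_eval₂]
  simp [Function.comp_def]

lemma harm_conj {n : ℕ} {P : MvPolynomial (Fin n) ℂ} (h : IsHarmonicPoly n P) :
    IsHarmonicPoly n (MvPolynomial.map (starRingEnd ℂ) P) := by
  unfold IsHarmonicPoly lap at *
  simp_rw [MvPolynomial.pderiv_map]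
  rw [← map_sum, h, map_zero]

lemma integrable_sph {n : ℕ} {f : En n → ℂ} (hf : Continuous f) :
    Integrable (fun θ : sphere (0 : En n) 1 => f θ) (sphereMeasure n) := by
  have : IsFiniteMeasure (sphereMeasure n) := by unfold sphereMeasure; infer_instance
  have : CompactSpace (sphere (0 : En n) 1) := isCompact_iff_compactSpace.1 (isCompact_sphere _ _)
  exact (hf.comp continuous_subtype_val).integrable_of_hasCompactSupport
    (HasCompactSupport.of_compactSpace _)

lemma kernel {n : ℕ} (hn : 2 ≤ n) {k a : ℕ} (Y : Fin a → MvPolynomial (Fin n) ℂ)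
    (hYhom : ∀ m, (Y m).IsHomogeneous k)
    (hYharm : ∀ m, IsHarmonicPoly n (Y m))
    (hYon : ∀ m m', ∫ θ : sphere (0 : En n) 1, evalR (Y m) (θ : En n) *
        (starRingEnd ℂ) (evalR (Y m') (θ : En n)) ∂(sphereMeasure n)
      = if m = m' then 1 else 0)
    (hYbasis : ∀ (Q : MvPolynomial (Fin n) ℂ), Q.IsHomogeneous k →
      IsHarmonicPoly n Q → ∃ c : Fin a → ℂ, Q = ∑ m, c m • Y m)
    (θ : En n) (hθ : ‖θ‖ = 1) (x : En n) :
    (omegaN n : ℂ) * ∑ m, evalR (Y m) θ * (starRingEnd ℂ) (evalR (Y m) x) =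
      gE n ((inner ℝ θ x : ℝ) : ℂ) ((‖x‖ : ℂ) ^ 2) k := by
  obtain ⟨c, hc⟩ := hYbasis _ (gE_lead θ k).1 (gE_harm (by omega) θ hθ k)
  have ev : ∀ y, evalR (gE n (lin θ) (rsq n) k) y = ∑ m, c m * evalR (Y m) y := fun y => by
    rw [hc]; simp [evalR, map_sum, MvPolynomial.smul_eval]
  have hcm : ∀ m, c m = omegaN n * (starRingEnd ℂ) (evalR (Y m) θ) := fun m => by
    have h1 := reproduce (by omega) θ k (H := MvPolynomial.map (starRingEnd ℂ) (Y m))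
      ((hYhom m).map _) (harm_conj (hYharm m))
    rw [evalR_conj] at h1
    rw [← h1, sphI]
    have : ∀ y : sphere (0 : En n) 1, evalR (gE n (lin θ) (rsq n) k *
        MvPolynomial.map (starRingEnd ℂ) (Y m)) y =
        ∑ m', c m' * (evalR (Y m') y * (starRingEnd ℂ) (evalR (Y m) y)) := fun y => by
      rw [← evalR_conj]
      have e : evalR (gE n (lin θ) (rsq n) k * MvPolynomial.map (starRingEnd ℂ) (Y m)) y =
        evalR (gE n (lin θ) (rsq n) k) y * evalR (MvPolynomial.map (starRingEnd ℂ) (Y m)) y :=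
        map_mul _ _ _
      rw [e, ev, Finset.sum_mul]
      simp only [mul_assoc]
    simp_rw [this]
    rw [integral_finsetSum]
    · simp_rw [integral_const_mul, hYon]
      simp
    · intro i _
      refine (integrable_sph (f := fun y => evalR (Y i) y * (starRingEnd ℂ) (evalR (Y m) y))
        ?_).const_mul _
      exact (continuous_evalR _).mul (Complex.continuous_conj.comp (continuous_evalR _))
  have h2 := congrArg (starRingEnd ℂ) (ev x)
  rw [evalR_gE, ← Complex.ofReal_pow, conj_gE, map_sum] at h2
  rw [← Complex.ofReal_pow, h2, Finset.mul_sum]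
  refine Finset.sum_congr rfl fun m _ => ?_
  rw [hcm]; simp; ring

lemma hasSum_congr_aux {ι : Type*} {f g : ι → ℂ} {c : ℂ} (h : ∀ p, f p = g p) (hg : HasSum g c) :
    HasSum f c := by
  rw [funext h]; exact hg

/-- The value of the zonal kernel on the diagonal. -/
def Mk (n k : ℕ) : ℝ := ‖gE n (((1 : ℝ)) : ℂ) (((1 : ℝ) : ℂ) ^ 2) k‖ / omegaN n

lemma Mk_nonneg {n : ℕ} (hn : 2 ≤ n) (k : ℕ) : 0 ≤ Mk n k :=
  div_nonneg (norm_nonneg _) (omegaN_pos hn).le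

lemma Mk_summable (n : ℕ) (q : ℝ) (h0 : 0 ≤ q) (h1 : q < 1) :
    Summable (fun k => Mk n k * q ^ k) := by
  have h := (gE_hasSum n 1 1 (by simp) (q : ℂ) (by simpa [abs_of_nonneg h0] using h1)).summable.norm
  refine (h.mul_right (omegaN n)⁻¹).congr fun k => ?_
  rw [norm_mul, norm_pow, Complex.norm_real, Real.norm_of_nonneg h0, Mk]
  ring

lemma sum_sigma {n : ℕ} (hn : 2 ≤ n) (a : ℕ → ℕ) (b : (Σ k : ℕ, Fin (a k)) → ℝ)
    (hb : ∀ p, 0 ≤ b p) (c q : ℝ) (h0 : 0 ≤ q) (h1 : q < 1)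
    (hs : ∀ k, ∑ m, b ⟨k, m⟩ ≤ c * (Mk n k * q ^ k)) : Summable b := by
  rw [summable_sigma_of_nonneg hb]
  refine ⟨fun k => (hasSum_fintype _).summable, ?_⟩
  refine Summable.of_nonneg_of_le (fun k => tsum_nonneg fun m => hb _) (fun k => ?_)
    ((Mk_summable n q h0 h1).mul_left c)
  rw [tsum_fintype]
  exact hs k

lemma diag {n : ℕ} (hn : 2 ≤ n) {a : ℕ → ℕ} {Y : (k : ℕ) → Fin (a k) → MvPolynomial (Fin n) ℂ}
    (hK : ∀ (k : ℕ) (θ : En n), ‖θ‖ = 1 → ∀ x : En n,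
      (omegaN n : ℂ) * ∑ m, evalR (Y k m) θ * (starRingEnd ℂ) (evalR (Y k m) x) =
      gE n ((inner ℝ θ x : ℝ) : ℂ) ((‖x‖ : ℂ) ^ 2) k)
    (k : ℕ) (θ : En n) (hθ : ‖θ‖ = 1) : ∑ m, ‖evalR (Y k m) θ‖ ^ 2 = Mk n k := by
  have h := hK k θ hθ θ
  have h1 : ∑ m, evalR (Y k m) θ * (starRingEnd ℂ) (evalR (Y k m) θ) =
      ((∑ m, ‖evalR (Y k m) θ‖ ^ 2 : ℝ) : ℂ) := by
    push_cast
    exact Finset.sum_congr rfl fun m _ => Complex.mul_conj' _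
  rw [h1, real_inner_self_eq_norm_sq, hθ, one_pow] at h
  rw [Mk, ← h, norm_mul, Complex.norm_real, Complex.norm_real,
    Real.norm_of_nonneg (omegaN_pos hn).le,
    Real.norm_of_nonneg (Finset.sum_nonneg fun m _ => by positivity)]
  field_simp [(omegaN_pos hn).ne']

lemma offdiag {n : ℕ} (hn : 2 ≤ n) {a : ℕ → ℕ} {Y : (k : ℕ) → Fin (a k) → MvPolynomial (Fin n) ℂ}
    (hYhom : ∀ (k : ℕ) (m : Fin (a k)), (Y k m).IsHomogeneous k)
    (hK : ∀ (k : ℕ) (θ : En n), ‖θ‖ = 1 → ∀ x : En n,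
      (omegaN n : ℂ) * ∑ m, evalR (Y k m) θ * (starRingEnd ℂ) (evalR (Y k m) x) =
      gE n ((inner ℝ θ x : ℝ) : ℂ) ((‖x‖ : ℂ) ^ 2) k)
    (k : ℕ) (θ : En n) (hθ : ‖θ‖ = 1) (x : En n) :
    ∑ m, ‖evalR (Y k m) θ‖ * ‖evalR (Y k m) x‖ ≤ Mk n k * ‖x‖ ^ k := by
  obtain ⟨η, hη, hx⟩ : ∃ η : En n, ‖η‖ = 1 ∧ x = ‖x‖ • η := by
    by_cases h : x = 0
    · exact ⟨θ, hθ, by simp [h]⟩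
    · have : ‖x‖ ≠ 0 := norm_ne_zero_iff.2 h
      exact ⟨‖x‖⁻¹ • x, by simp [norm_smul, this], by rw [smul_smul, mul_inv_cancel₀ this, one_smul]⟩
  have e : ∀ m, ‖evalR (Y k m) x‖ = ‖x‖ ^ k * ‖evalR (Y k m) η‖ := fun m => by
    conv_lhs => rw [hx, evalR_smul (hYhom k m)]
    simp
  have d1 := diag hn hK k θ hθ
  have d2 := diag hn hK k η hη
  have : ∑ m, ‖evalR (Y k m) θ‖ * ‖evalR (Y k m) η‖ ≤
      ∑ m, (‖evalR (Y k m) θ‖ ^ 2 / 2 + ‖evalR (Y k m) η‖ ^ 2 / 2) :=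
    Finset.sum_le_sum fun m _ => by
      nlinarith [sq_nonneg (‖evalR (Y k m) θ‖ - ‖evalR (Y k m) η‖)]
  rw [Finset.sum_add_distrib, ← Finset.sum_div, ← Finset.sum_div, d1, d2, add_halves] at this
  calc _ = ‖x‖ ^ k * ∑ m, ‖evalR (Y k m) θ‖ * ‖evalR (Y k m) η‖ := by
        rw [Finset.mul_sum]
        exact Finset.sum_congr rfl fun m _ => by rw [e]; ring
    _ ≤ ‖x‖ ^ k * Mk n k := by gcongr
    _ = _ := mul_comm _ _

lemma pointwise {n : ℕ} (hn : 2 ≤ n) {a : ℕ → ℕ} {Y : (k : ℕ) → Fin (a k) → MvPolynomial (Fin n) ℂ}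
    (hYhom : ∀ (k : ℕ) (m : Fin (a k)), (Y k m).IsHomogeneous k)
    (hK : ∀ (k : ℕ) (θ : En n), ‖θ‖ = 1 → ∀ x : En n,
      (omegaN n : ℂ) * ∑ m, evalR (Y k m) θ * (starRingEnd ℂ) (evalR (Y k m) x) =
      gE n ((inner ℝ θ x : ℝ) : ℂ) ((‖x‖ : ℂ) ^ 2) k)
    (ζ : ℂ) (θ : En n) (hθ : ‖θ‖ = 1) (x : En n) (hx : ‖x‖ < ‖ζ‖) :
    HasSum (fun p : ℕ × Σ k : ℕ, Fin (a k) =>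
        evalR (Y p.2.1 p.2.2) θ / ζ ^ (2 * p.1 + p.2.1 + 1) *
          ((‖x‖ : ℂ) ^ (2 * p.1) * (starRingEnd ℂ) (evalR (Y p.2.1 p.2.2) x)))
      ((omegaN n : ℂ)⁻¹ * (ζ ^ (n - 1) / rPow n ζ θ x)) := by
  have hz0 : 0 < ‖ζ‖ := (norm_nonneg _).trans_lt hx
  have hz : ζ ≠ 0 := norm_pos_iff.1 hz0
  have hω : (omegaN n : ℂ) ≠ 0 := by exact_mod_cast (omegaN_pos hn).ne'
  set w := ζ⁻¹ with hw
  have hq : ‖x‖ * ‖w‖ < 1 := by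
    rw [hw, norm_inv, ← div_eq_mul_inv, div_lt_one hz0]; exact hx
  have hq0 : 0 ≤ ‖x‖ * ‖w‖ := by positivity
  let f : ℕ → ℂ := fun t => ((‖x‖ : ℂ) ^ 2 * w ^ 2) ^ t * w
  let g : (Σ k : ℕ, Fin (a k)) → ℂ := fun p =>
    evalR (Y p.1 p.2) θ * (starRingEnd ℂ) (evalR (Y p.1 p.2) x) * w ^ p.1
  have hn2 : ‖(‖x‖ : ℂ) ^ 2 * w ^ 2‖ < 1 := by
    rw [← mul_pow, norm_pow, norm_mul, Complex.norm_real, norm_norm]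
    exact pow_lt_one₀ hq0 hq two_ne_zero
  have hf : HasSum f ((1 - (‖x‖ : ℂ) ^ 2 * w ^ 2)⁻¹ * w) :=
    (hasSum_geometric_of_norm_lt_one hn2).mul_right w
  have gs : Summable fun p => ‖g p‖ := by
    refine sum_sigma hn a _ (fun p => norm_nonneg _) 1 (‖x‖ * ‖w‖) hq0 hq fun k => ?_
    have := offdiag hn hYhom hK k θ hθ x
    simp only [g, norm_mul, RCLike.norm_conj, norm_pow]
    rw [← Finset.sum_mul, one_mul, mul_pow, ← mul_assoc]
    gcongr
  set F := (1 - 2 * ((inner ℝ θ x : ℝ) : ℂ) * w + (‖x‖ : ℂ) ^ 2 * w ^ 2) ^ (-((n : ℂ) / 2)) with hF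
  have hg : HasSum g ((omegaN n : ℂ)⁻¹ * ((1 - (‖x‖ : ℂ) ^ 2 * w ^ 2) * F)) := by
    have h1 := (gE_hasSum n (inner ℝ θ x) ‖x‖ (by
      have := abs_real_inner_le_norm θ x; rwa [hθ, one_mul] at this) w hq).mul_left (omegaN n : ℂ)⁻¹
    refine HasSum.sigma_of_hasSum h1 (fun k => ?_) gs.of_norm
    convert hasSum_fintype (fun m => g ⟨k, m⟩) using 1
    rw [← hK k θ hθ x, ← mul_assoc, inv_mul_cancel_left₀ hω, Finset.sum_mul]
  have hfg : Summable fun p : ℕ × (Σ k : ℕ, Fin (a k)) => f p.1 * g p.2 :=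
    summable_mul_of_summable_norm hf.summable.norm gs
  have h := hf.mul hg hfg
  have hne : (1 - (‖x‖ : ℂ) ^ 2 * w ^ 2) ≠ 0 := fun h0 => by
    rw [← sub_eq_zero.1 h0] at hn2; simp at hn2
  have hval : (1 - (‖x‖ : ℂ) ^ 2 * w ^ 2)⁻¹ * w *
      ((omegaN n : ℂ)⁻¹ * ((1 - (‖x‖ : ℂ) ^ 2 * w ^ 2) * F)) =
      (omegaN n : ℂ)⁻¹ * (ζ ^ (n - 1) / rPow n ζ θ x) := by
    have h1 : ζ ^ (n - 1) / rPow n ζ θ x = w * F := by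
      rw [rPow, hF, Complex.cpow_neg, div_mul_eq_div_div, div_eq_mul_inv (_ / _)]
      congr 1
      · obtain ⟨m, rfl⟩ : ∃ m, n = m + 1 := ⟨n - 1, by omega⟩
        rw [hw, Nat.add_sub_cancel, pow_succ]; field_simp
      · rw [hw, inv_pow]; rfl
    rw [h1]; field_simp
  rw [hval] at h
  refine hasSum_congr_aux (fun p => ?_) h
  simp only [f, g, hw]
  rw [pow_add, pow_add, pow_mul, pow_mul, mul_pow, inv_pow, inv_pow, inv_pow]
  field_simp

lemma measure_version {n : ℕ} (hn : 2 ≤ n) {a : ℕ → ℕ} {Y : (k : ℕ) → Fin (a k) → MvPolynomial (Fin n) ℂ}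
    (hYhom : ∀ (k : ℕ) (m : Fin (a k)), (Y k m).IsHomogeneous k)
    (hK : ∀ (k : ℕ) (θ : En n), ‖θ‖ = 1 → ∀ x : En n,
      (omegaN n : ℂ) * ∑ m, evalR (Y k m) θ * (starRingEnd ℂ) (evalR (Y k m) x) =
      gE n ((inner ℝ θ x : ℝ) : ℂ) ((‖x‖ : ℂ) ^ 2) k)
    (R : ℝ) (hR : 0 ≤ R) (ν : Measure (En n)) [IsFiniteMeasure ν]
    (hν : ν (closedBall (0 : En n) R)ᶜ = 0) (ζ : ℂ) (hζ : R < ‖ζ‖) (θ : En n) (hθ : ‖θ‖ = 1) :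
    HasSum (fun p : ℕ × Σ k : ℕ, Fin (a k) =>
        evalR (Y p.2.1 p.2.2) θ / ζ ^ (2 * p.1 + p.2.1 + 1) *
          ∫ x, (‖x‖ : ℂ) ^ (2 * p.1) * (starRingEnd ℂ) (evalR (Y p.2.1 p.2.2) x) ∂ν)
      ((omegaN n : ℂ)⁻¹ * ∫ x, ζ ^ (n - 1) / rPow n ζ θ x ∂ν) := by
  have hz0 : 0 < ‖ζ‖ := hR.trans_lt hζ
  have hae : ∀ᵐ x ∂ν, ‖x‖ ≤ R := by
    rw [ae_iff]
    convert hν using 2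
    ext x; simp
  have hcint : ∀ f : En n → ℂ, Continuous f → Integrable f ν := fun f hf => by
    have h1 : ν.restrict (closedBall (0 : En n) R) = ν :=
      Measure.restrict_eq_self_of_ae_mem (by filter_upwards [hae] with x hx; simpa using hx)
    have := hf.continuousOn.integrableOn_compact (μ := ν) (isCompact_closedBall (0 : En n) R)
    rwa [IntegrableOn, h1] at this
  have hYc : ∀ k m, Continuous fun x : En n => (starRingEnd ℂ) (evalR (Y k m) x) := fun k m =>
    Complex.continuous_conj.comp (continuous_evalR _)
  let F : (ℕ × Σ k : ℕ, Fin (a k)) → En n → ℂ := fun p x =>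
    evalR (Y p.2.1 p.2.2) θ / ζ ^ (2 * p.1 + p.2.1 + 1) *
      ((‖x‖ : ℂ) ^ (2 * p.1) * (starRingEnd ℂ) (evalR (Y p.2.1 p.2.2) x))
  have hF : ∀ p, Integrable (F p) ν := fun p => hcint _ (by
    have := hYc p.2.1 p.2.2
    fun_prop)
  let f : ℕ → ℝ := fun t => ((R * ‖ζ‖⁻¹) ^ 2) ^ t * ‖ζ‖⁻¹
  let g : (Σ k : ℕ, Fin (a k)) → ℝ := fun p =>
    (‖evalR (Y p.1 p.2) θ‖ * ∫ x, ‖evalR (Y p.1 p.2) x‖ ∂ν) * (‖ζ‖⁻¹) ^ p.1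
  have hq : R * ‖ζ‖⁻¹ < 1 := by rw [← div_eq_mul_inv, div_lt_one hz0]; exact hζ
  have hq0 : 0 ≤ R * ‖ζ‖⁻¹ := by positivity
  have hf : Summable f :=
    (summable_geometric_of_lt_one (sq_nonneg _) (pow_lt_one₀ hq0 hq two_ne_zero)).mul_right _
  have hni : ∀ k m, Integrable (fun x => ‖evalR (Y k m) x‖) ν := fun k m =>
    (hcint _ (continuous_evalR (Y k m))).norm
  have hg0 : ∀ p, 0 ≤ g p := fun p =>
    mul_nonneg (mul_nonneg (norm_nonneg _) (integral_nonneg fun x => norm_nonneg _)) (by positivity)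
  have hg : Summable g := by
    refine sum_sigma hn a _ hg0 (ν.real Set.univ) (R * ‖ζ‖⁻¹) hq0 hq fun k => ?_
    have e : ∑ m, ‖evalR (Y k m) θ‖ * ∫ x, ‖evalR (Y k m) x‖ ∂ν =
        ∫ x, ∑ m, ‖evalR (Y k m) θ‖ * ‖evalR (Y k m) x‖ ∂ν := by
      rw [integral_finsetSum _ fun m _ => (hni k m).const_mul _]
      simp_rw [integral_const_mul]
    have e2 : ∫ x, ∑ m, ‖evalR (Y k m) θ‖ * ‖evalR (Y k m) x‖ ∂ν ≤ ∫ _x, Mk n k * R ^ k ∂ν := by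
      refine integral_mono_ae (integrable_finsetSum _ fun m _ => (hni k m).const_mul _)
        (integrable_const _) ?_
      filter_upwards [hae] with x hx
      refine (offdiag hn hYhom hK k θ hθ x).trans ?_
      have := Mk_nonneg hn k
      gcongr
    rw [integral_const, smul_eq_mul] at e2
    simp only [g]
    rw [← Finset.sum_mul, e, mul_pow, ← mul_assoc (Mk n k), ← mul_assoc]
    gcongr
  have hsum : Summable fun p => ∫ x, ‖F p x‖ ∂ν := by
    have hfg := hf.mul_of_nonneg hg (fun t => by positivity) hg0
    refine Summable.of_nonneg_of_le (fun p => integral_nonneg fun x => norm_nonneg _) (fun p => ?_) hfg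
    have e : f p.1 * g p.2 = ∫ x, ((R * ‖ζ‖⁻¹) ^ 2) ^ p.1 * ‖ζ‖⁻¹ *
        ((‖evalR (Y p.2.1 p.2.2) θ‖ * ‖evalR (Y p.2.1 p.2.2) x‖) * (‖ζ‖⁻¹) ^ p.2.1) ∂ν := by
      rw [integral_const_mul, integral_mul_const, integral_const_mul]
    rw [e]
    refine integral_mono_ae (hF p).norm
      ((((hni _ _).const_mul _).mul_const _).const_mul _) ?_
    filter_upwards [hae] with x hx
    have e3 : ‖F p x‖ = ((‖x‖ * ‖ζ‖⁻¹) ^ 2) ^ p.1 * ‖ζ‖⁻¹ *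
        ((‖evalR (Y p.2.1 p.2.2) θ‖ * ‖evalR (Y p.2.1 p.2.2) x‖) * (‖ζ‖⁻¹) ^ p.2.1) := by
      simp only [F, norm_mul, norm_div, norm_pow, RCLike.norm_conj, Complex.norm_real, norm_norm]
      rw [pow_add, pow_add, pow_mul, pow_mul, mul_pow, mul_pow, inv_pow, inv_pow, inv_pow]
      field_simp
    rw [e3]
    gcongr
  have h := hasSum_integral_of_summable_integral_norm hF hsum
  have e4 : ∫ x, ∑' p, F p x ∂ν = (omegaN n : ℂ)⁻¹ * ∫ x, ζ ^ (n - 1) / rPow n ζ θ x ∂ν := by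
    rw [← integral_const_mul]
    refine integral_congr_ae ?_
    filter_upwards [hae] with x hx
    exact (pointwise hn hYhom hK ζ θ hθ x (hx.trans_lt hζ)).tsum_eq
  rw [e4] at h
  refine hasSum_congr_aux (fun p => ?_) h
  rw [← integral_const_mul]

/-- Asymptotic expansion of the multivariate Markov transform:
`μ̂(ζ,θ) = Σ_{t,k,m} Y_{k,m}(θ) ζ^{-(2t+k+1)} ∫ |x|^{2t} conj(Y_{k,m}(x)) dμ(x)`,
with absolute (here: unconditional, which in `ℂ` is equivalent) convergence. -/
theorem markov_asymptotic_expansion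
    (n : ℕ) (hn : 2 ≤ n) (R : ℝ)
    (μ : SignedMeasure (En n)) (hμ : SuppIn μ (closedBall (0 : En n) R))
    (a : ℕ → ℕ) (Y : (k : ℕ) → Fin (a k) → MvPolynomial (Fin n) ℂ)
    (hYhom : ∀ (k : ℕ) (m : Fin (a k)), (Y k m).IsHomogeneous k)
    (hYharm : ∀ (k : ℕ) (m : Fin (a k)), IsHarmonicPoly n (Y k m))
    (hYon : ∀ (k : ℕ) (m m' : Fin (a k)),
      ∫ θ : sphere (0 : En n) 1, evalR (Y k m) (θ : En n) *
        (starRingEnd ℂ) (evalR (Y k m') (θ : En n)) ∂(sphereMeasure n)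
      = if m = m' then 1 else 0)
    (hYbasis : ∀ (k : ℕ) (Q : MvPolynomial (Fin n) ℂ), Q.IsHomogeneous k →
      IsHarmonicPoly n Q → ∃ c : Fin (a k) → ℂ, Q = ∑ m, c m • Y k m) :
    ∀ (ζ : ℂ), R < ‖ζ‖ → ∀ θ : sphere (0 : En n) 1,
      HasSum (fun p : ℕ × Σ k : ℕ, Fin (a k) =>
        evalR (Y p.2.1 p.2.2) (θ : En n) / ζ ^ (2 * p.1 + p.2.1 + 1) *
          sInt μ (fun x => (‖x‖ : ℂ) ^ (2 * p.1) *
            (starRingEnd ℂ) (evalR (Y p.2.1 p.2.2) x)))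
        (markov μ ζ (θ : En n)) := by
  intro ζ hζ θ
  have hθ : ‖(θ : En n)‖ = 1 := by simpa using θ.2
  have hK := fun k => kernel hn (Y k) (hYhom k) (hYharm k) (hYon k) (hYbasis k)
  rw [SuppIn, SignedMeasure.totalVariation, Measure.add_apply, add_eq_zero] at hμ
  obtain ⟨hp, hm⟩ := hμ
  rcases lt_or_ge R 0 with hR | hR
  · rw [closedBall_eq_empty.2 hR, Set.compl_empty, Measure.measure_univ_eq_zero] at hp hm
    have h0 : ∀ f : En n → ℂ, sInt μ f = 0 := fun f => by simp [sInt, hp, hm]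
    simp only [markov, h0, mul_zero]
    exact hasSum_zero
  · have h1 := measure_version hn hYhom hK R hR _ hp ζ hζ θ hθ
    have h2 := measure_version hn hYhom hK R hR _ hm ζ hζ θ hθ
    have h := h1.sub h2
    rw [← mul_sub] at h
    refine hasSum_congr_aux (fun p => ?_) h
    rw [sInt, mul_sub]
end
end

section
/- Let P be a polynomial on ℝⁿ (n ≥ 2), let μ be a finite signed measure with support in the closed ball of radius R, and let Q_P(ζ,θ) be the function of the second kind. Then for every R₁ > R and every polynomial h on ℝⁿ, (1/(2πi)) ∮_{Γ_{R₁}} ∫_{S^{n-1}} h(ζθ) Q_P(ζ,θ) dθ dζ = 0. -/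
open MeasureTheory Metric MvPolynomial

noncomputable section

set_option linter.all false

namespace SK

open Set in
lemma eval_scale {n : ℕ} {A : MvPolynomial (Fin n) ℂ} {d : ℕ} (hA : A.IsHomogeneous d)
    (c : ℂ) (y : Fin n → ℂ) : eval (fun i => c * y i) A = c ^ d * eval y A := by
  rw [eval_eq', eval_eq', Finset.mul_sum]
  apply Finset.sum_congr rfl
  intro a ha
  have hd : a.degree = d := by
    have := hA (mem_support_iff.mp ha)
    rw [Finsupp.degree_eq_weight_one]; exact this
  simp only [mul_pow, Finset.prod_mul_distrib]
  rw [Finset.prod_pow_eq_pow_sum, ← hd, Finsupp.degree_eq_sum]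
  ring

lemma evalC_hom {n : ℕ} {A : MvPolynomial (Fin n) ℂ} {d : ℕ} (hA : A.IsHomogeneous d)
    (c : ℂ) (θ : En n) : evalC A c θ = c ^ d * evalR A θ := eval_scale hA c _

lemma evalR_smul {n : ℕ} {A : MvPolynomial (Fin n) ℂ} {d : ℕ} (hA : A.IsHomogeneous d)
    (c : ℝ) (θ : En n) : evalR A (c • θ) = (c : ℂ) ^ d * evalR A θ := by
  rw [evalR, evalR, ← eval_scale hA]
  simp

lemma evalR_cont {n : ℕ} (A : MvPolynomial (Fin n) ℂ) : Continuous (evalR A : En n → ℂ) := by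
  unfold evalR
  exact (MvPolynomial.continuous_eval A).comp (by fun_prop)

instance {n : ℕ} : IsFiniteMeasure (sphereMeasure n) := by
  unfold sphereMeasure; infer_instance

lemma evalR_int {n : ℕ} (A : MvPolynomial (Fin n) ℂ) :
    Integrable (fun θ : sphere (0 : En n) 1 => evalR A (θ : En n)) (sphereMeasure n) := by
  have h : Continuous (fun θ : sphere (0 : En n) 1 => evalR A (θ : En n)) :=
    (evalR_cont A).comp continuous_subtype_val
  exact h.integrable_of_hasCompactSupport (HasCompactSupport.of_compactSpace _)

/-- integration of polynomials over the sphere -/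
def II (n : ℕ) : MvPolynomial (Fin n) ℂ →ₗ[ℂ] ℂ where
  toFun A := ∫ θ : sphere (0 : En n) 1, evalR A (θ : En n) ∂(sphereMeasure n)
  map_add' A B := by
    rw [← integral_add (evalR_int A) (evalR_int B)]
    simp [evalR]
  map_smul' c A := by
    simp only [RingHom.id_apply, smul_eq_mul]
    rw [← integral_const_mul]
    simp [evalR]

open Set in
lemma polar {n : ℕ} (hn : 2 ≤ n) (A : MvPolynomial (Fin n) ℂ) {d : ℕ} (hA : A.IsHomogeneous d) (b : ℝ → ℂ) :
    ∫ y : En n, evalR A y * b ‖y‖ = II n A * ∫ r in Ioi (0:ℝ), (r : ℂ) ^ (d + (n - 1)) * b r := by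
  have hdim : Module.finrank ℝ (En n) = n := by simp
  haveI : Nonempty (Fin n) := ⟨⟨0, by omega⟩⟩
  haveI : Nontrivial (En n) := Module.nontrivial_of_finrank_pos (R := ℝ) (by rw [hdim]; omega)
  calc
    ∫ y : En n, evalR A y * b ‖y‖ 
      = ∫ x : ({(0)}ᶜ : Set (En n)), evalR A x.1 * b ‖x.1‖ ∂((volume : Measure (En n)).comap (↑)) := by
      rw [integral_subtype_comap (measurableSet_singleton _).compl fun x ↦ evalR A x * b ‖x‖,
        restrict_compl_singleton]
    _ = ∫ x : sphere (0 : En n) 1 × Ioi (0:ℝ), evalR A (x.1 : En n) * (((x.2 : ℝ) : ℂ) ^ d * b x.2)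
          ∂((volume : Measure (En n)).toSphere.prod (.volumeIoiPow (n - 1))) := by
      have h := (volume : Measure (En n)).measurePreserving_homeomorphUnitSphereProd.integral_comp
        (Homeomorph.measurableEmbedding _)
        (fun x : sphere (0 : En n) 1 × Ioi (0:ℝ) => evalR A (x.1 : En n) * (((x.2 : ℝ) : ℂ) ^ d * b x.2))
      rw [hdim] at h
      rw [← h]
      apply integral_congr_ae
      filter_upwards with x
      have hx : ‖x.1‖ ≠ 0 := norm_ne_zero_iff.mpr x.2
      have e : x.1 = ‖x.1‖ • (‖x.1‖⁻¹ • x.1) := by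
        rw [smul_smul, mul_inv_cancel₀ hx, one_smul]
      have e2 : evalR A x.1 = (‖x.1‖ : ℂ) ^ d * evalR A (‖x.1‖⁻¹ • x.1) := by
        conv_lhs => rw [e]
        exact evalR_smul hA _ _
      rw [e2]
      simp
      ring
    _ = II n A * ∫ r : Ioi (0:ℝ), ((r : ℝ) : ℂ) ^ d * b r ∂(.volumeIoiPow (n - 1)) := by
      exact integral_prod_mul (fun x : sphere (0 : En n) 1 => evalR A (x : En n))
        (fun r : Ioi (0:ℝ) => ((r : ℝ) : ℂ) ^ d * b r)
    _ = _ := by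
      congr 1
      simp only [Measure.volumeIoiPow, ENNReal.ofReal]
      rw [integral_withDensity_eq_integral_smul,
        integral_subtype_comap measurableSet_Ioi
          fun a ↦ Real.toNNReal (a ^ (n - 1)) • ((a : ℂ) ^ d * b a),
        setIntegral_congr_fun measurableSet_Ioi fun x hx ↦ ?_]
      · beta_reduce
        rw [NNReal.smul_def, Real.coe_toNNReal _ (pow_nonneg hx.out.le _), Complex.real_smul, pow_add]
        push_cast
        ring
      · exact (measurable_subtype_coe.pow_const _).real_toNNReal

lemma lineDeriv {n : ℕ} (A : MvPolynomial (Fin n) ℂ) (i : Fin n) (y : En n) :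
    HasLineDerivAt ℝ (evalR A) (evalR (pderiv i A) y) y (EuclideanSpace.single i (1:ℝ)) := by
  induction A using MvPolynomial.induction_on with
  | C a =>
    simp only [HasLineDerivAt, evalR, eval_C, pderiv_C, map_zero]
    exact hasDerivAt_const _ _
  | add p q hp hq =>
    have := HasDerivAt.add hp hq
    simp only [HasLineDerivAt, evalR, map_add] at this ⊢
    exact this
  | mul_X p j hp =>
    have hX : HasDerivAt (fun t : ℝ => (((y + t • EuclideanSpace.single i (1:ℝ) : En n) j : ℝ) : ℂ))
      (if i = j then 1 else 0) 0 := by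
      by_cases h : i = j
      · subst h
        simp only [if_true]
        have : HasDerivAt (fun t : ℝ => y i + t) 1 0 := (hasDerivAt_id (0:ℝ)).const_add _
        simpa using this.ofReal_comp
      · have h' : j ≠ i := fun e => h e.symm
        simp [h, h']
        exact hasDerivAt_const _ _
    have := HasDerivAt.mul hp hX
    simp only [HasLineDerivAt, evalR, map_mul, eval_X, Derivation.leibniz, smul_eq_mul, pderiv_X,
      Pi.single_apply, map_add] at this ⊢
    refine HasDerivAt.congr_deriv this ?_
    by_cases h : i = j
    · simp [h]; ring
    · have h' : j ≠ i := fun e => h e.symm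
      simp [h, h']; ring

open Set in
lemma sphere_ibp {n : ℕ} (hn : 2 ≤ n) (p : MvPolynomial (Fin n) ℂ) {d : ℕ} (hp : p.IsHomogeneous d)
    (i : Fin n) : II n (pderiv i p) = ((d + n - 1 : ℕ) : ℂ) * II n (X i * p) := by
  obtain ⟨e, he⟩ : ∃ e, d + n = e + 2 := ⟨d + n - 2, by omega⟩
  let φ : ContDiffBump (2:ℝ) := ⟨1/2, 1, by norm_num, by norm_num⟩
  let ψ : ℝ → ℝ := φ
  have hψ : ContDiff ℝ 2 ψ := φ.contDiff
  have hψ0 : ∀ t, t ≤ 1 ∨ 3 ≤ t → ψ t = 0 := by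
    intro t ht
    apply φ.zero_of_le_dist
    rw [Real.dist_eq]
    change (1:ℝ) ≤ |t - 2|
    rcases ht with h | h
    · rw [abs_of_nonpos (by linarith)]; linarith
    · rw [abs_of_nonneg (by linarith)]; linarith
  have hψnn : ∀ t, 0 ≤ ψ t := fun t => φ.nonneg
  have hψ2 : ψ 2 = 1 := φ.one_of_mem_closedBall (by simp [φ])
  have hdψ_cont : Continuous (deriv ψ) := hψ.continuous_deriv (by norm_num)
  have hψd : ∀ t, HasDerivAt ψ (deriv ψ t) t := fun t =>
    ((hψ.differentiable (by norm_num)) t).hasDerivAt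
  have hdψ_zero : ∀ t, 4 ≤ t → deriv ψ t = 0 := by
    intro t ht
    have : ψ =ᶠ[nhds t] fun _ => 0 := by
      filter_upwards [lt_mem_nhds (show (3:ℝ) < t by linarith)] with u hu
      exact hψ0 u (Or.inr hu.le)
    rw [this.deriv_eq]; simp
  let g : En n → ℂ := fun y => (ψ (‖y‖ ^ 2) : ℂ)
  let g' : En n → ℂ := fun y => evalR (X i) y * ((2 * deriv ψ (‖y‖ ^ 2) : ℝ) : ℂ)
  have hgd : ∀ y, HasLineDerivAt ℝ g (g' y) y (EuclideanSpace.single i (1:ℝ)) := by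
    intro y
    have h1 : HasLineDerivAt ℝ (fun y : En n => ‖y‖ ^ 2) (2 * y i) y (EuclideanSpace.single i (1:ℝ)) := by
      have := ((hasStrictFDerivAt_norm_sq y).hasFDerivAt).hasLineDerivAt (EuclideanSpace.single i (1:ℝ))
      have e : ((2 : ℕ) • (innerSL ℝ) y) (EuclideanSpace.single i (1:ℝ)) = 2 * y i := by
        rw [ContinuousLinearMap.smul_apply, innerSL_apply_apply, EuclideanSpace.inner_single_right]; simp
      have e' := e ▸ this
      exact e'
    have h2 : HasDerivAt (fun t : ℝ => ψ (‖y + t • EuclideanSpace.single i (1:ℝ)‖ ^ 2))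
      (deriv ψ (‖y‖ ^ 2) * (2 * y i)) 0 := by
      have := (hψd (‖y + (0:ℝ) • EuclideanSpace.single i (1:ℝ)‖ ^ 2)).comp (0:ℝ) h1
      simp only [zero_smul, add_zero] at this
      exact this
    have h3 := h2.ofReal_comp
    simp only [HasLineDerivAt, g]
    refine HasDerivAt.congr_deriv h3 ?_
    simp [g', evalR]
    ring
  have hcs : ∀ (A : MvPolynomial (Fin n) ℂ) (b : ℝ → ℂ), Continuous b → (∀ t, 4 ≤ t → b t = 0) →
      Integrable (fun y : En n => evalR A y * b (‖y‖ ^ 2)) := by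
    intro A b hb hb0
    apply Continuous.integrable_of_hasCompactSupport
    · exact (evalR_cont A).mul (hb.comp (by fun_prop))
    · apply HasCompactSupport.intro (isCompact_closedBall (0 : En n) 2)
      intro y hy
      simp only [mem_closedBall, dist_zero_right, not_le] at hy
      rw [hb0 _ (by nlinarith), mul_zero]
  have key := integral_bilinear_hasLineDerivAt_right_eq_neg_left_of_integrable
    (μ := (volume : Measure (En n))) (f := evalR p) (f' := evalR (pderiv i p)) (g := g) (g' := g')
    (v := EuclideanSpace.single i (1:ℝ)) (B := ContinuousLinearMap.mul ℝ ℂ)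
    (hcs (pderiv i p) (fun t => (ψ t : ℂ)) (Complex.continuous_ofReal.comp hψ.continuous)
      (fun t ht => by simp [hψ0 t (Or.inr (by linarith))]))
    (by
      have := hcs (p * X i) (fun t => ((2 * deriv ψ t : ℝ) : ℂ)) (by fun_prop)
        (fun t ht => by simp [hdψ_zero t ht])
      refine this.congr ?_
      filter_upwards with y
      simp [g', evalR]
      ring)
    (hcs p (fun t => (ψ t : ℂ)) (Complex.continuous_ofReal.comp hψ.continuous)
      (fun t ht => by simp [hψ0 t (Or.inr (by linarith))]))
    (fun y _ => lineDeriv p i y) (fun y _ => hgd y)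
  simp only [ContinuousLinearMap.mul_apply'] at key
  -- left side
  have hXp : (X i * p).IsHomogeneous (1 + d) := (isHomogeneous_X ℂ i).mul hp
  have L := polar hn (X i * p) hXp (fun r => ((2 * deriv ψ (r ^ 2) : ℝ) : ℂ))
  have Rr := polar hn (pderiv i p) hp.pderiv (fun r => (ψ (r ^ 2) : ℂ))
  have e1 : ∫ y : En n, evalR p y * g' y = ∫ y : En n, evalR (X i * p) y * ((2 * deriv ψ (‖y‖ ^ 2) : ℝ) : ℂ) := by
    congr 1; ext y; simp [g', evalR]; ring
  rw [e1, L, Rr] at key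
  -- one-dimensional integrals
  set S : ℝ := ∫ r in Ioi (0:ℝ), r ^ e * ψ (r ^ 2) with hS
  have hcont : Continuous fun r : ℝ => r ^ e * ψ (r ^ 2) := by
    have := hψ.continuous; fun_prop
  have hzero : ∀ r : ℝ, 2 < |r| → ψ (r ^ 2) = 0 := by
    intro r hr
    apply hψ0; right
    rw [← sq_abs]; nlinarith
  have hzero' : ∀ r : ℝ, 2 < |r| → deriv ψ (r ^ 2) = 0 := by
    intro r hr
    apply hdψ_zero
    rw [← sq_abs]; nlinarith
  have hcs1 : ∀ f : ℝ → ℝ, (∀ r : ℝ, 2 < |r| → f r = 0) → HasCompactSupport f := by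
    intro f hf
    apply HasCompactSupport.intro (isCompact_closedBall (0 : ℝ) 2)
    intro y hy
    simp only [mem_closedBall, dist_zero_right, not_le, Real.norm_eq_abs] at hy
    exact hf y hy
  have hSi : Integrable fun r : ℝ => r ^ e * ψ (r ^ 2) :=
    hcont.integrable_of_hasCompactSupport (hcs1 _ (fun r hr => by simp [hzero r hr]))
  have hSpos : 0 < S := by
    rw [hS, setIntegral_pos_iff_support_of_nonneg_ae]
    · have ho : IsOpen (Function.support (fun r : ℝ => r ^ e * ψ (r ^ 2)) ∩ Ioi 0) :=
        hcont.isOpen_support.inter isOpen_Ioi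
      refine ho.measure_pos volume ⟨Real.sqrt 2, ?_, ?_⟩
      · simp [hψ2]
      · simp
    · filter_upwards [ae_restrict_mem measurableSet_Ioi] with r hr
      exact mul_nonneg (pow_nonneg (le_of_lt hr) _) (hψnn _)
    · exact hSi.integrableOn
  have hT : ∫ r in Ioi (0:ℝ), r ^ (e + 2) * (2 * deriv ψ (r ^ 2)) = - ((e + 1 : ℕ) : ℝ) * S := by
    have hW : ContDiff ℝ 1 (fun r : ℝ => r ^ (e + 1) * ψ (r ^ 2)) := by
      have := hψ.of_le (show (1 : WithTop ℕ∞) ≤ 2 by norm_num)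
      exact (contDiff_id.pow _).mul (this.comp (contDiff_id.pow 2))
    have h0 := HasCompactSupport.integral_Ioi_deriv_eq hW
      (hcs1 _ (fun r hr => by simp [hzero r hr])) 0
    have hd : ∀ r : ℝ, deriv (fun r : ℝ => r ^ (e + 1) * ψ (r ^ 2)) r =
        ((e + 1 : ℕ) : ℝ) * (r ^ e * ψ (r ^ 2)) + r ^ (e + 2) * (2 * deriv ψ (r ^ 2)) := by
      intro r
      have h1 := (hasDerivAt_pow (e + 1) r).mul ((hψd (r ^ 2)).comp r (hasDerivAt_pow 2 r))
      refine (h1.deriv).trans ?_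
      simp
      ring
    simp only [hd] at h0
    rw [integral_add, integral_const_mul] at h0
    · simp at h0
      push_cast
      linarith
    · exact (hSi.const_mul _).integrableOn
    · refine (Continuous.integrable_of_hasCompactSupport (by fun_prop) 
        (hcs1 _ (fun r hr => by simp [hzero' r hr]))).integrableOn
  have c1 : ∫ r in Ioi (0:ℝ), (r : ℂ) ^ (1 + d + (n - 1)) * ((2 * deriv ψ (r ^ 2) : ℝ) : ℂ)
      = ((- ((e + 1 : ℕ) : ℝ) * S : ℝ) : ℂ) := by
    rw [← hT, ← integral_complex_ofReal]
    congr 1; ext r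
    rw [show 1 + d + (n - 1) = e + 2 by omega]
    push_cast; ring
  rw [c1] at key
  have c2 : II n (pderiv i p) * ∫ r in Ioi (0:ℝ), (r : ℂ) ^ (d - 1 + (n - 1)) * (ψ (r ^ 2) : ℂ)
      = II n (pderiv i p) * (S : ℂ) := by
    rcases Nat.eq_zero_or_pos d with h0 | h0
    · have : pderiv i p = 0 := by
        rw [h0] at hp
        rw [(totalDegree_eq_zero_iff_eq_C).mp (Nat.le_zero.mp hp.totalDegree_le), pderiv_C]
      rw [this]; simp
    · congr 1
      rw [hS, ← integral_complex_ofReal]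
      congr 1; ext r
      rw [show d - 1 + (n - 1) = e by omega]
      push_cast; ring
  rw [c2] at key
  have hSne : (S : ℂ) ≠ 0 := by exact_mod_cast hSpos.ne'
  apply mul_right_cancel₀ hSne
  rw [show d + n - 1 = e + 1 by omega]
  push_cast at key ⊢
  linear_combination key

end SK

set_option linter.all false

namespace SK

/-- coefficientwise partial derivative on formal power series over polynomials -/
def dl (n : ℕ) (j : Fin n) : Derivation ℂ (PowerSeries (MvPolynomial (Fin n) ℂ))
    (PowerSeries (MvPolynomial (Fin n) ℂ)) :=
  Derivation.mk'
    { toFun := fun f => PowerSeries.mk fun k => pderiv j (PowerSeries.coeff k f)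
      map_add' := by intro f g; ext1 k; simp
      map_smul' := by
        intro c f; ext1 k; simp }
    (by
      intro f g
      ext1 k
      simp only [LinearMap.coe_mk, AddHom.coe_mk, PowerSeries.coeff_mk, PowerSeries.coeff_mul,
        map_sum, smul_eq_mul, map_add, Derivation.leibniz, Finset.sum_add_distrib]
      congr 1
      exact (Finset.Nat.sum_antidiagonal_swap (n := k) (f := fun p =>
        (PowerSeries.coeff p.1) g * (pderiv j) ((PowerSeries.coeff p.2) f))))

lemma coeff_dl {n : ℕ} (j : Fin n) (f : PowerSeries (MvPolynomial (Fin n) ℂ)) (k : ℕ) :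
    PowerSeries.coeff k (dl n j f) = pderiv j (PowerSeries.coeff k f) := by
  simp [dl]

lemma dl_C {n : ℕ} (j : Fin n) (a : MvPolynomial (Fin n) ℂ) :
    dl n j (PowerSeries.C a) = PowerSeries.C (pderiv j a) := by
  ext1 k
  rw [coeff_dl, PowerSeries.coeff_C, PowerSeries.coeff_C]
  split_ifs <;> simp

lemma dl_X {n : ℕ} (j : Fin n) :
    dl n j (PowerSeries.X) = 0 := by
  ext1 k
  rw [coeff_dl, PowerSeries.coeff_X]
  split_ifs <;> simp

variable {n : ℕ}

/-- the linear form `x·y` -/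
def uu (x : En n) : MvPolynomial (Fin n) ℂ := ∑ i, C (x i : ℂ) * X i
/-- `|y|²` -/
def qq (n : ℕ) : MvPolynomial (Fin n) ℂ := ∑ i, X i ^ 2
/-- `|x|²` -/
def rr (x : En n) : ℂ := ∑ i, (x i : ℂ) ^ 2

/-- shifted coefficients of `(1 - 2 s x·y + s²|x|²|y|²)^(-n/2)` -/
def gg (x : En n) : ℕ → MvPolynomial (Fin n) ℂ
  | 0 => 0
  | 1 => 1
  | k + 2 => C ((k + 1 : ℂ)⁻¹) * (C (2 * k + n : ℂ) * uu x * gg x (k + 1)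
      - C (k + n - 1 : ℂ) * C (rr x) * qq n * gg x k)

lemma gg_rec (x : En n) (k : ℕ) : C (k + 1 : ℂ) * gg x (k + 2) =
    C (2 * k + n : ℂ) * uu x * gg x (k + 1) - C (k + n - 1 : ℂ) * C (rr x) * qq n * gg x k := by
  rw [gg, ← mul_assoc, ← C_mul, mul_inv_cancel₀ (by exact_mod_cast Nat.succ_ne_zero k), C_1, one_mul]

lemma uu_hom (x : En n) : (uu x).IsHomogeneous 1 := by
  apply IsHomogeneous.sum
  intro i _
  simpa using (isHomogeneous_C (Fin n) (x i : ℂ)).mul (isHomogeneous_X ℂ i)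

lemma qq_hom : (qq n).IsHomogeneous 2 := by
  apply IsHomogeneous.sum
  intro i _
  simpa using (isHomogeneous_X ℂ i).pow 2

lemma gg_hom (x : En n) (k : ℕ) : (gg x (k + 1)).IsHomogeneous k := by
  induction k using Nat.strong_induction_on with
  | _ k ih =>
    match k with
    | 0 => simpa [gg] using isHomogeneous_one (Fin n) ℂ
    | 1 =>
      simp only [gg]
      have := (isHomogeneous_C (Fin n) (((0:ℕ) + 1 : ℂ)⁻¹)).mul
        (((isHomogeneous_C (Fin n) (2 * (0:ℕ) + n : ℂ)).mul (uu_hom x)))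
      simpa using this
    | k + 2 =>
      rw [gg]
      have h1 := ih (k + 1) (by omega)
      have h0 := ih k (by omega)
      have a1 := ((isHomogeneous_C (Fin n) (2 * ((k + 1 : ℕ) : ℂ) + n : ℂ)).mul (uu_hom x)).mul h1
      have a2 := (((isHomogeneous_C (Fin n) (((k + 1 : ℕ) : ℂ) + n - 1 : ℂ)).mul
        (isHomogeneous_C (Fin n) (rr x))).mul (qq_hom (n := n))).mul h0
      have e1 : 0 + 1 + (k + 1) = k + 2 := by ring
      have e2 : 0 + 0 + 2 + k = k + 2 := by ring
      rw [e1] at a1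
      rw [e2] at a2
      have := (isHomogeneous_C (Fin n) ((((k + 1 : ℕ) : ℂ) + 1)⁻¹)).mul (a1.sub a2)
      rwa [zero_add] at this

/-- `1 - 2 s x·y + s²|x|²|y|²` -/
def DD (x : En n) : PowerSeries (MvPolynomial (Fin n) ℂ) :=
  1 - 2 * PowerSeries.C (uu x) * PowerSeries.X
    + PowerSeries.C (C (rr x)) * PowerSeries.C (qq n) * PowerSeries.X ^ 2

/-- The kernel series. -/
def KK (x : En n) : PowerSeries (MvPolynomial (Fin n) ℂ) :=
  PowerSeries.mk fun k => gg x (k + 1)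

lemma KK_ode (x : En n) :
    2 * DD x * PowerSeries.derivative _ (KK x) = - (n : PowerSeries (MvPolynomial (Fin n) ℂ)) *
      PowerSeries.derivative _ (DD x) * KK x := by
  have h1 : PowerSeries.derivative _ (DD x) = 2 * (- PowerSeries.C (uu x)
      + PowerSeries.C (C (rr x)) * PowerSeries.C (qq n) * PowerSeries.X) := by
    simp only [DD, map_add, map_sub, Derivation.leibniz, Derivation.leibniz_pow,
      PowerSeries.derivative_C, PowerSeries.derivative_X, smul_eq_mul]
    have : PowerSeries.derivative (MvPolynomial (Fin n) ℂ) (2 : PowerSeries (MvPolynomial (Fin n) ℂ)) = 0 := by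
      exact_mod_cast Derivation.map_natCast _ 2
    rw [this]
    simp
    ring
  rw [h1]
  have key : DD x * PowerSeries.derivative _ (KK x) = - (n : PowerSeries (MvPolynomial (Fin n) ℂ)) *
     (- PowerSeries.C (uu x)
      + PowerSeries.C (C (rr x)) * PowerSeries.C (qq n) * PowerSeries.X) * KK x := by
    have hn : (n : PowerSeries (MvPolynomial (Fin n) ℂ)) = PowerSeries.C (C (n:ℂ)) := by
      rw [map_natCast, map_natCast]
    have h2 : (2 : PowerSeries (MvPolynomial (Fin n) ℂ)) = PowerSeries.C (C (2:ℂ)) := by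
      rw [map_ofNat, map_ofNat]
    have e : DD x * PowerSeries.derivative _ (KK x) - (- (n : PowerSeries (MvPolynomial (Fin n) ℂ)) *
     (- PowerSeries.C (uu x)
      + PowerSeries.C (C (rr x)) * PowerSeries.C (qq n) * PowerSeries.X) * KK x) = 
      PowerSeries.derivative _ (KK x) - PowerSeries.C (C 2 * uu x) * (PowerSeries.X * PowerSeries.derivative _ (KK x))
      + PowerSeries.C (C (rr x) * qq n) * (PowerSeries.X * (PowerSeries.X * PowerSeries.derivative _ (KK x)))
      - PowerSeries.C (C (n:ℂ) * uu x) * KK x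
      + PowerSeries.C (C (n:ℂ) * C (rr x) * qq n) * (PowerSeries.X * KK x) := by
      rw [DD, hn, h2]
      simp only [map_mul]
      ring
    rw [← sub_eq_zero, e]
    ext1 k
    match k with
    | 0 =>
      have := gg_rec x 0
      simp only [KK, map_add, map_sub, PowerSeries.coeff_C_mul, PowerSeries.coeff_succ_X_mul, PowerSeries.coeff_zero_X_mul, PowerSeries.coeff_derivative, PowerSeries.coeff_mk, map_zero]
      simp only [map_add, map_mul, map_sub, map_natCast, map_ofNat, map_one, Nat.cast_one, zero_add, one_add_one_eq_two, Nat.reduceAdd, Nat.cast_zero, map_zero, gg] at this ⊢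
      linear_combination this
    | 1 =>
      have := gg_rec x 1
      simp only [KK, map_add, map_sub, PowerSeries.coeff_C_mul, PowerSeries.coeff_succ_X_mul, PowerSeries.coeff_zero_X_mul, PowerSeries.coeff_derivative, PowerSeries.coeff_mk, map_zero]
      simp only [map_add, map_mul, map_sub, map_natCast, map_ofNat, map_one, Nat.cast_one, zero_add, one_add_one_eq_two, Nat.reduceAdd, Nat.cast_zero] at this ⊢
      linear_combination this
    | k + 2 =>
      have := gg_rec x (k + 2)
      simp only [KK, map_add, map_sub, PowerSeries.coeff_C_mul, PowerSeries.coeff_succ_X_mul, PowerSeries.coeff_zero_X_mul, PowerSeries.coeff_derivative, PowerSeries.coeff_mk, map_zero]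
      simp only [map_add, map_mul, map_sub, map_natCast, map_ofNat, map_one, Nat.cast_add, Nat.cast_one, Nat.cast_ofNat] at this ⊢
      linear_combination this
  linear_combination 2 * key

lemma DD_cc (x : En n) : PowerSeries.constantCoeff (DD x) = 1 := by
  simp [DD]

lemma KK_cc (x : En n) : PowerSeries.constantCoeff (KK x) = 1 := by
  simp [KK, ← PowerSeries.coeff_zero_eq_constantCoeff, gg]

lemma DD_ne (x : En n) : DD x ≠ 0 := by
  intro h; have := DD_cc x; simp [h] at this

lemma KK_ne (x : En n) : KK x ≠ 0 := by
  intro h; have := KK_cc x; simp [h] at this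

lemma KK_sq (hn : 2 ≤ n) (x : En n) : KK x ^ 2 * DD x ^ n = 1 := by
  apply PowerSeries.derivative.ext
  · obtain ⟨m, rfl⟩ : ∃ m, n = m + 1 := ⟨n - 1, by omega⟩
    have := KK_ode x
    simp only [Derivation.leibniz, Derivation.leibniz_pow, smul_eq_mul, nsmul_eq_mul,
      PowerSeries.derivative_one]
    simp only [Nat.add_sub_cancel]
    push_cast at this ⊢
    linear_combination (KK x * DD x ^ m) * this
  · simp [DD_cc, KK_cc]

lemma dl_KK (hn : 2 ≤ n) (x : En n) (j : Fin n) :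
    2 * DD x * dl n j (KK x) = - (n : PowerSeries (MvPolynomial (Fin n) ℂ)) *
      KK x * dl n j (DD x) := by
  have h := congrArg (dl n j) (KK_sq hn x)
  obtain ⟨m, hm⟩ : ∃ m, n = m + 1 := ⟨n - 1, by omega⟩
  have hm' : n - 1 = m := by omega
  simp only [Derivation.leibniz, Derivation.leibniz_pow, smul_eq_mul, nsmul_eq_mul,
      Derivation.map_one_eq_zero] at h
  have e : DD x ^ n = DD x ^ m * DD x := by
    rw [← pow_succ]; congr 1
  rw [e, hm'] at h
  have hne : KK x * DD x ^ m ≠ 0 := mul_ne_zero (KK_ne x) (pow_ne_zero _ (DD_ne x))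
  apply mul_left_cancel₀ hne
  simp only [Nat.cast_ofNat] at h
  linear_combination h

/-- harmonic series -/
def VV (x : En n) (i : Fin n) : PowerSeries (MvPolynomial (Fin n) ℂ) :=
  (PowerSeries.C (X i) - PowerSeries.C (C (x i : ℂ)) * PowerSeries.C (qq n) * PowerSeries.X) * KK x

lemma pd_qq (j : Fin n) : pderiv j (qq n) = 2 * X j := by
  simp only [qq, map_sum, Derivation.leibniz_pow, pderiv_X, Pi.single_apply]
  simp [Finset.sum_ite_eq]

lemma pd_uu (x : En n) (j : Fin n) : pderiv j (uu x) = C (x j : ℂ) := by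
  simp only [uu, map_sum, Derivation.leibniz, pderiv_C, pderiv_X, Pi.single_apply]
  simp [Finset.sum_ite_eq]

lemma VV_harm (hn : 2 ≤ n) (x : En n) (i : Fin n) :
    ∑ j, dl n j (dl n j (VV x i)) = 0 := by
  set w : PowerSeries (MvPolynomial (Fin n) ℂ) :=
    PowerSeries.C (X i) - PowerSeries.C (C (x i : ℂ)) * PowerSeries.C (qq n) * PowerSeries.X with hw
  set N : PowerSeries (MvPolynomial (Fin n) ℂ) := (n : PowerSeries (MvPolynomial (Fin n) ℂ))
  have two0 : ∀ j, dl n j (2 : PowerSeries (MvPolynomial (Fin n) ℂ)) = 0 := fun j => by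
    exact_mod_cast Derivation.map_natCast _ 2
  have N0 : ∀ j, dl n j N = 0 := fun j => Derivation.map_natCast _ n
  have step : ∀ j, 4 * DD x ^ 2 * dl n j (dl n j (VV x i)) = KK x * (
      4 * DD x ^ 2 * dl n j (dl n j w) - 4 * N * DD x * (dl n j w * dl n j (DD x))
      + w * (N * (N + 2) * (dl n j (DD x)) ^ 2 - 2 * N * DD x * dl n j (dl n j (DD x)))) := by
    intro j
    have h1 := dl_KK hn x j
    have h2 := congrArg (dl n j) h1
    change dl n j _ = dl n j (-N * _ * _) at h2
    change _ = -N * _ * _ at h1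
    simp only [Derivation.leibniz, smul_eq_mul, two0, N0, map_neg] at h2
    rw [show VV x i = w * KK x from rfl]
    simp only [Derivation.leibniz, smul_eq_mul, map_add]
    linear_combination (2 * DD x * w) * h2 + (4 * DD x * dl n j w - (N + 2) * w * dl n j (DD x)) * h1
  set s : PowerSeries (MvPolynomial (Fin n) ℂ) := PowerSeries.X
  set r : PowerSeries (MvPolynomial (Fin n) ℂ) := PowerSeries.C (C (rr x)) with hr
  set Y : Fin n → PowerSeries (MvPolynomial (Fin n) ℂ) := fun j => PowerSeries.C (X j) with hY
  set ξ : Fin n → PowerSeries (MvPolynomial (Fin n) ℂ) := fun j => PowerSeries.C (C (x j : ℂ)) with hξ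
  set U := PowerSeries.C (uu x) with hU
  set Q := PowerSeries.C (qq n) with hQ
  have dD : ∀ j, dl n j (DD x) = -2 * s * ξ j + 2 * s ^ 2 * r * Y j := by
    intro j
    simp only [DD, Derivation.leibniz, Derivation.leibniz_pow, smul_eq_mul, map_add, map_sub,
      two0, dl_C, dl_X, Derivation.map_one_eq_zero, pd_uu, pd_qq, pderiv_C, map_mul, map_zero, map_ofNat]
    simp [hξ, hY, s, hr]
    ring
  have dY : ∀ j k, dl n j (Y k) = if j = k then 1 else 0 := by
    intro j k
    simp only [hY, dl_C, pderiv_X, Pi.single_apply]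
    by_cases h : j = k <;> simp [h, eq_comm]
  have dw : ∀ j, dl n j w = (if j = i then 1 else 0) - 2 * s * ξ i * Y j := by
    intro j
    have : w = Y i - ξ i * Q * s := rfl
    rw [this, map_sub, dY]
    simp only [Derivation.leibniz, smul_eq_mul, map_add, map_sub, s, Q, ξ,
      dl_C, dl_X, pd_qq, pderiv_C, map_mul, map_zero, map_ofNat]
    ring
  have dξ : ∀ j k, dl n j (ξ k) = 0 := by intro j k; simp [hξ, dl_C]
  have dr : ∀ j, dl n j r = 0 := by intro j; simp [hr, dl_C]
  have ds : ∀ j, dl n j s = 0 := fun j => dl_X j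
  have ddD : ∀ j, dl n j (dl n j (DD x)) = 2 * s ^ 2 * r := by
    intro j
    rw [dD]
    simp [Derivation.leibniz, Derivation.leibniz_pow, two0, dξ, dr, ds, dY]
  have ddw : ∀ j, dl n j (dl n j w) = - 2 * s * ξ i := by
    intro j
    rw [dw]
    have : dl n j (if j = i then (1 : PowerSeries (MvPolynomial (Fin n) ℂ)) else 0) = 0 := by
      split_ifs <;> simp
    simp only [Derivation.leibniz, two0, dξ, ds, dY, this, map_sub, smul_eq_mul, if_true]
    ring
  have sU : ∑ j, ξ j * Y j = U := by simp [hU, uu, hξ, hY]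
  have sQ : ∑ j, Y j ^ 2 = Q := by simp [hQ, qq, hY]
  have sr : ∑ j, ξ j ^ 2 = r := by simp [hr, rr, hξ]
  have hD : DD x = 1 - 2 * U * s + r * Q * s ^ 2 := rfl
  have sdD : ∑ j, (dl n j (DD x)) ^ 2 = 4 * s ^ 2 * r * DD x := by
    have : ∀ j, (dl n j (DD x)) ^ 2 = 4 * s ^ 2 * ξ j ^ 2 - 8 * s ^ 3 * r * (ξ j * Y j)
      + 4 * s ^ 4 * r ^ 2 * Y j ^ 2 := by intro j; rw [dD]; ring
    simp only [this, Finset.sum_add_distrib, Finset.sum_sub_distrib, ← Finset.mul_sum, sU, sQ, sr]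
    rw [hD]; ring
  have swD : ∑ j, (dl n j w * dl n j (DD x)) = -2 * s * ξ i + 2 * s ^ 2 * r * Y i
      + 4 * s ^ 2 * ξ i * U - 4 * s ^ 3 * r * ξ i * Q := by
    have : ∀ j, (dl n j w * dl n j (DD x)) = (if j = i then (-2 * s * ξ j + 2 * s ^ 2 * r * Y j) else 0)
      + 4 * s ^ 2 * ξ i * (ξ j * Y j) - 4 * s ^ 3 * r * ξ i * Y j ^ 2 := by
      intro j; rw [dD, dw]; split_ifs <;> ring
    simp only [this, Finset.sum_add_distrib, Finset.sum_sub_distrib, ← Finset.mul_sum, sU, sQ]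
    simp
  have hne : 4 * DD x ^ 2 ≠ 0 := by
    refine mul_ne_zero ?_ (pow_ne_zero _ (DD_ne x))
    intro h
    have := congrArg PowerSeries.constantCoeff h
    rw [map_ofNat, map_zero] at this
    have := congrArg MvPolynomial.constantCoeff this
    rw [map_ofNat, map_zero] at this
    norm_num at this
  apply mul_left_cancel₀ hne
  rw [Finset.mul_sum, mul_zero]
  simp only [step]
  rw [← Finset.mul_sum, Finset.sum_add_distrib, Finset.sum_sub_distrib, ← Finset.mul_sum,
    ← Finset.mul_sum, ← Finset.mul_sum, Finset.sum_sub_distrib, ← Finset.mul_sum, ← Finset.mul_sum, sdD, swD]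
  simp only [ddD, ddw, Finset.sum_const, Finset.card_univ, Fintype.card_fin, nsmul_eq_mul]
  change KK x * (4 * DD x ^ 2 * (N * _) - _ + w * (_ - 2 * N * DD x * (N * _))) = 0
  have hw' : w = Y i - ξ i * Q * s := rfl
  rw [hw', hD]
  ring

/-- harmonic polynomial coming from the kernel -/
def hh (x : En n) (i : Fin n) (k : ℕ) : MvPolynomial (Fin n) ℂ :=
  X i * gg x (k + 1) - C (x i : ℂ) * qq n * gg x k

lemma hh_harm (hn : 2 ≤ n) (x : En n) (i : Fin n) (k : ℕ) : lap n (hh x i k) = 0 := by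
  have e : PowerSeries.coeff k (VV x i) = hh x i k := by
    have : VV x i = PowerSeries.C (X i) * KK x
      - PowerSeries.C (C (x i : ℂ) * qq n) * (PowerSeries.X * KK x) := by
      rw [VV, map_mul]; ring
    rw [this]
    cases k with
    | zero => simp [hh, KK, gg]
    | succ k => simp only [map_sub, PowerSeries.coeff_C_mul, PowerSeries.coeff_succ_X_mul, KK,
        PowerSeries.coeff_mk, hh]
  have h := congrArg (PowerSeries.coeff k) (VV_harm hn x i)
  simp only [map_sum, coeff_dl, e, map_zero] at h
  exact h

lemma hh_hom (x : En n) (i : Fin n) (k : ℕ) : (hh x i (k + 1)).IsHomogeneous (k + 2) := by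
  have a1 := (isHomogeneous_X ℂ i).mul (gg_hom x (k + 1))
  have a2 := ((isHomogeneous_C (Fin n) (x i : ℂ)).mul (qq_hom (n := n))).mul (gg_hom x k)
  have e1 : 1 + (k + 1) = k + 2 := by ring
  have e2 : 0 + 2 + k = k + 2 := by ring
  rw [e1] at a1
  rw [e2] at a2
  exact a1.sub a2

end SK

namespace SK

lemma lap_pderiv {n : ℕ} (Y : MvPolynomial (Fin n) ℂ) (i : Fin n) (h : lap n Y = 0) :
    lap n (pderiv i Y) = 0 := by
  have hc : ∀ (j : Fin n) (p : MvPolynomial (Fin n) ℂ), pderiv j (pderiv i p) = pderiv i (pderiv j p) := by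
    intro j p
    induction p using MvPolynomial.induction_on with
    | C a => simp
    | add p q hp hq => simp [hp, hq]
    | mul_X p k hp =>
      simp only [Derivation.leibniz, smul_eq_mul, map_add, pderiv_X, hp, Pi.single_apply]
      split_ifs <;> simp <;> ring
  have : lap n (pderiv i Y) = pderiv i (lap n Y) := by
    simp only [lap, map_sum]
    refine Finset.sum_congr rfl fun j _ => ?_
    rw [hc, hc]
  rw [this, h, map_zero]

lemma sphere_ibp' {n : ℕ} (hn : 2 ≤ n) (p : MvPolynomial (Fin n) ℂ) {d : ℕ} (hp : p.IsHomogeneous d)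
    (i : Fin n) : II n (X i * p) = ((d + n - 1 : ℕ) : ℂ)⁻¹ * II n (pderiv i p) := by
  have h : ((d + n - 1 : ℕ) : ℂ) ≠ 0 := by
    norm_cast; omega
  rw [sphere_ibp hn p hp i, inv_mul_cancel_left₀ h]

lemma hom_orth {n : ℕ} (hn : 2 ≤ n) : ∀ (m k : ℕ) (q Y : MvPolynomial (Fin n) ℂ), m < k →
    q.IsHomogeneous m → Y.IsHomogeneous k → lap n Y = 0 → II n (q * Y) = 0 := by
  intro m
  induction m using Nat.strong_induction_on with
  | _ m ih =>
  intro k q Y hmk hq hY hlap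
  rcases Nat.eq_zero_or_pos m with h0 | h0
  · subst h0
    rw [(totalDegree_eq_zero_iff_eq_C).mp (Nat.le_zero.mp hq.totalDegree_le)]
    have hk : (k : ℂ) ≠ 0 := by norm_cast; omega
    have e := congrArg (II n) hY.sum_X_mul_pderiv
    rw [map_sum] at e
    have e2 : ∑ i, II n (X i * pderiv i Y) = 0 := by
      simp_rw [fun i => sphere_ibp' hn _ (hY.pderiv (i := i)) i]
      rw [← Finset.mul_sum, ← map_sum]
      change _ * II n (lap n Y) = 0
      rw [hlap]; simp
    rw [e2, map_nsmul, nsmul_eq_mul] at e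
    have : II n Y = 0 := by
      rcases mul_eq_zero.mp e.symm with h | h
      · exact absurd h hk
      · exact h
    rw [← smul_eq_C_mul, map_smul, this, smul_zero]
  · have hm : (m : ℂ) ≠ 0 := by norm_cast; omega
    have e := congrArg (fun t => II n (t * Y)) hq.sum_X_mul_pderiv
    simp only [Finset.sum_mul, map_sum, smul_mul_assoc, map_nsmul] at e
    have e2 : ∑ i, II n (X i * pderiv i q * Y) = 0 := by
      apply Finset.sum_eq_zero
      intro i _
      rw [mul_assoc, sphere_ibp' hn _ ((hq.pderiv (i := i)).mul hY) i, Derivation.leibniz]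
      simp only [smul_eq_mul, map_add]
      have t1 : II n (pderiv i q * pderiv i Y) = 0 :=
        ih (m - 1) (by omega) (k - 1) _ _ (by omega) hq.pderiv hY.pderiv (lap_pderiv _ _ hlap)
      have t2 : II n (Y * pderiv i (pderiv i q)) = 0 := by
        rw [mul_comm]
        rcases Nat.lt_or_ge m 2 with h | h
        · have : m = 1 := by omega
          subst this
          have h1 : (pderiv i q).IsHomogeneous 0 := hq.pderiv
          rw [(totalDegree_eq_zero_iff_eq_C).mp (Nat.le_zero.mp h1.totalDegree_le), pderiv_C]
          simp
        · exact ih (m - 1 - 1) (by omega) k _ _ (by omega) hq.pderiv.pderiv hY hlap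
      rw [t1, t2]; simp
    rw [e2, nsmul_eq_mul] at e
    rcases mul_eq_zero.mp e.symm with h | h
    · exact absurd h hm
    · exact h

lemma sphere_sum {n : ℕ} {θ : En n} (h : ‖θ‖ = 1) : ∑ i, ((θ i : ℝ) : ℂ) ^ 2 = 1 := by
  have := EuclideanSpace.real_norm_sq_eq θ
  rw [h] at this
  norm_cast
  rw [← this]; norm_num

lemma evalR_qq {n : ℕ} {θ : En n} (h : ‖θ‖ = 1) : evalR (qq n) θ = 1 := by
  rw [← sphere_sum h]; simp [evalR, qq]

lemma II_qq {n : ℕ} (p : MvPolynomial (Fin n) ℂ) : II n (qq n * p) = II n p := by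
  change ∫ θ : sphere (0 : En n) 1, evalR (qq n * p) (θ : En n) ∂(sphereMeasure n) = _
  refine integral_congr_ae (Filter.Eventually.of_forall fun θ => ?_)
  have := evalR_qq (n := n) (θ := θ) (by simpa using θ.2)
  simp only [evalR, map_mul] at this ⊢
  rw [this, one_mul]

lemma II_step {n : ℕ} (hn : 2 ≤ n) (x : En n) (i : Fin n) {m : ℕ} (f : MvPolynomial (Fin n) ℂ)
    (hf : f.IsHomogeneous m) :
    II n (X i * f * gg x (m + 2)) = (x i : ℂ) * II n (f * gg x (m + 1)) := by
  have h := hom_orth hn m (m + 2) f (hh x i (m + 1)) (by omega) hf (hh_hom x i m) (hh_harm hn x i (m + 1))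
  have e : f * hh x i (m + 1) = X i * f * gg x (m + 2) - (x i : ℂ) • (qq n * (f * gg x (m + 1))) := by
    rw [hh, smul_eq_C_mul]; ring
  rw [e, map_sub, map_smul, II_qq, sub_eq_zero] at h
  rw [h, smul_eq_mul]

def Psi {n : ℕ} (x : En n) : MvPolynomial (Fin n) ℂ →ₗ[ℂ] MvPolynomial (Fin n) ℂ :=
  (basisMonomials (Fin n) ℂ).constr ℂ (fun α => monomial α 1 * gg x (α.degree + 1))

lemma Psi_mon {n : ℕ} (x : En n) (α : Fin n →₀ ℕ) (c : ℂ) :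
    Psi x (monomial α c) = monomial α c * gg x (α.degree + 1) := by
  have h1 : monomial α c = c • (monomial α (1:ℂ)) := by rw [smul_monomial]; simp
  have h2 : Psi x (monomial α 1) = monomial α 1 * gg x (α.degree + 1) := by
    have := (basisMonomials (Fin n) ℂ).constr_basis ℂ (fun α => monomial α (1:ℂ) * gg x (α.degree + 1)) α
    rwa [coe_basisMonomials] at this
  rw [h1, map_smul, h2, smul_mul_assoc]

lemma J_X {n : ℕ} (hn : 2 ≤ n) (x : En n) (i : Fin n) (f : MvPolynomial (Fin n) ℂ) :
    II n (Psi x (X i * f)) = (x i : ℂ) * II n (Psi x f) := by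
  induction f using MvPolynomial.induction_on' with
  | monomial α c =>
    have e : (X i : MvPolynomial (Fin n) ℂ) * monomial α c = monomial (Finsupp.single i 1 + α) c := by
      rw [X, monomial_mul, one_mul]
    rw [e, Psi_mon, Psi_mon, ← e]
    have hd : (Finsupp.single i 1 + α).degree + 1 = α.degree + 2 := by
      rw [map_add, Finsupp.degree_single]; ring
    rw [hd]
    exact II_step hn x i _ (isHomogeneous_monomial c rfl)
  | add p q hp hq =>
    rw [mul_add, map_add, map_add, hp, hq, map_add, map_add]; ring

lemma J_mul {n : ℕ} (hn : 2 ≤ n) (x : En n) (P h : MvPolynomial (Fin n) ℂ) :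
    II n (Psi x (P * h)) = evalR P x * II n (Psi x h) := by
  induction P using MvPolynomial.induction_on generalizing h with
  | C a => simp [evalR, ← smul_eq_C_mul]
  | add p q hp hq => 
    rw [add_mul, map_add, map_add, hp, hq]; simp [evalR]; ring
  | mul_X p j hp => 
    rw [mul_assoc, hp, J_X hn]; simp [evalR]; ring

end SK

namespace SK

lemma slit {t r : ℝ} (htr : |t| ≤ r) {s : ℂ} (hs : r * ‖s‖ < 1) :
    1 - 2 * (t : ℂ) * s + (r : ℂ) ^ 2 * s ^ 2 ∈ Complex.slitPlane := by
  rw [Complex.mem_slitPlane_iff]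
  by_contra! hcon
  obtain ⟨h1, h2⟩ := hcon
  have hr : 0 ≤ r := (abs_nonneg t).trans htr
  have hns : ‖s‖ ^ 2 = s.re ^ 2 + s.im ^ 2 := by
    rw [← Complex.normSq_eq_norm_sq, Complex.normSq_apply]; ring
  have h3 : r ^ 2 * (s.re ^ 2 + s.im ^ 2) < 1 := by
    rw [← hns]
    have : 0 ≤ r * ‖s‖ := by positivity
    nlinarith
  simp [pow_two, Complex.mul_re, Complex.mul_im] at h1 h2
  have h4 : s.im * (r ^ 2 * s.re - t) = 0 := by nlinarith
  rcases mul_eq_zero.mp h4 with h | h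
  · rw [h] at h1 h3
    have h5 : |t * s.re| ≤ r * |s.re| := by
      rw [abs_mul]; exact mul_le_mul_of_nonneg_right htr (abs_nonneg _)
    have h6 := le_abs_self (t * s.re)
    have h7 : r * |s.re| < 1 := (mul_le_mul_of_nonneg_left (Complex.abs_re_le_norm s) hr).trans_lt hs
    have h8 : |s.re| ^ 2 = s.re ^ 2 := sq_abs _
    nlinarith [sq_pos_of_pos (sub_pos.mpr h7)]
  · have : t = r ^ 2 * s.re := by linarith
    rw [this] at h1
    nlinarith

def EE (t r : ℝ) (ζ : ℂ) : ℂ := 1 - 2 * (t : ℂ) / ζ + (r : ℂ) ^ 2 / ζ ^ 2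

lemma EE_slit {t r R : ℝ} (htr : |t| ≤ r) (hrR : r < R) {ζ : ℂ} (hζ : ‖ζ‖ = R) :
    EE t r ζ ∈ Complex.slitPlane := by
  have hr : 0 ≤ r := (abs_nonneg t).trans htr
  have h : r * ‖ζ⁻¹‖ < 1 := by
    rw [norm_inv, hζ, ← div_eq_mul_inv, div_lt_one (by linarith)]; exact hrR
  have := slit htr h
  have e : EE t r ζ = 1 - 2 * (t : ℂ) * ζ⁻¹ + (r : ℂ) ^ 2 * ζ⁻¹ ^ 2 := by
    rw [EE, inv_pow]; ring
  rw [e]; exact this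

lemma circle_inv {R : ℝ} (hR : 0 < R) (f : ℂ → ℂ) :
    (∮ ζ in C(0, R), (ζ ^ 2)⁻¹ * f ζ⁻¹) = ∮ s in C(0, R⁻¹), f s := by
  simp only [circleIntegral, deriv_circleMap, smul_eq_mul]
  have := intervalIntegral.integral_comp_sub_left (a := 0) (b := 2 * Real.pi)
    (fun u => circleMap 0 R⁻¹ u * Complex.I * f (circleMap 0 R⁻¹ u)) (2 * Real.pi)
  simp only [sub_self, sub_zero] at this
  rw [← this]
  congr 1
  ext u
  have hinv : circleMap 0 R⁻¹ (2 * Real.pi - u) = (circleMap 0 R u)⁻¹ := by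
    simp only [circleMap, zero_add, mul_inv, ← Complex.exp_neg]
    rw [← Complex.exp_periodic (-(u * Complex.I))]
    push_cast
    congr 2
    ring
  rw [hinv]
  have : circleMap 0 R u ≠ 0 := circleMap_ne_center hR.ne'
  field_simp

def bb (n : ℕ) (t r R : ℝ) (j : ℕ) : ℂ :=
  ∮ ζ in C(0, R), ζ ^ ((j : ℤ) - 2) * EE t r ζ ^ (-((n : ℂ) / 2))

lemma gfun_diff {t r R : ℝ} (n : ℕ) (htr : |t| ≤ r) (hrR : r < R) :
    DifferentiableOn ℂ (fun s : ℂ => (1 - 2 * (t : ℂ) * s + (r : ℂ) ^ 2 * s ^ 2) ^ (-((n : ℂ) / 2)))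
      (closedBall 0 R⁻¹) := by
  have hr : 0 ≤ r := (abs_nonneg t).trans htr
  have hR : 0 < R := by linarith
  intro s hs
  apply DifferentiableAt.differentiableWithinAt
  apply DifferentiableAt.cpow (by fun_prop) (by fun_prop)
  apply slit htr
  simp only [mem_closedBall, dist_zero_right] at hs
  calc r * ‖s‖ ≤ r * R⁻¹ := mul_le_mul_of_nonneg_left hs hr
    _ < 1 := by rw [← div_eq_mul_inv, div_lt_one hR]; exact hrR

lemma EE_inv (t r : ℝ) (ζ : ℂ) : EE t r ζ = 1 - 2 * (t : ℂ) * ζ⁻¹ + (r : ℂ) ^ 2 * ζ⁻¹ ^ 2 := by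
  rw [EE, inv_pow]; ring

lemma bb_zero {t r R : ℝ} (n : ℕ) (htr : |t| ≤ r) (hrR : r < R) : bb n t r R 0 = 0 := by
  have hr : 0 ≤ r := (abs_nonneg t).trans htr
  have hR : 0 < R := by linarith
  have h := circle_inv hR (fun s : ℂ => (1 - 2 * (t : ℂ) * s + (r : ℂ) ^ 2 * s ^ 2) ^ (-((n : ℂ) / 2)))
  have h2 : (∮ s in C(0, R⁻¹), (fun s : ℂ => (1 - 2 * (t : ℂ) * s + (r : ℂ) ^ 2 * s ^ 2) ^ (-((n : ℂ) / 2))) s) = 0 := by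
    refine DiffContOnCl.circleIntegral_eq_zero (by positivity) (DifferentiableOn.diffContOnCl ?_)
    rw [closure_ball _ (by positivity)]
    exact gfun_diff n htr hrR
  rw [h2] at h
  rw [bb]
  refine Eq.trans ?_ h
  refine circleIntegral.integral_congr hR.le fun ζ hζ => ?_
  simp only [EE_inv]
  congr 1

lemma bb_one {t r R : ℝ} (n : ℕ) (htr : |t| ≤ r) (hrR : r < R) :
    bb n t r R 1 = 2 * Real.pi * Complex.I := by
  have hr : 0 ≤ r := (abs_nonneg t).trans htr
  have hR : 0 < R := by linarith
  have h := circle_inv hR (fun s : ℂ => (s - 0)⁻¹ • (1 - 2 * (t : ℂ) * s + (r : ℂ) ^ 2 * s ^ 2) ^ (-((n : ℂ) / 2)))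
  have h2 := (gfun_diff n htr hrR).circleIntegral_sub_inv_smul (w := 0) (by simp; positivity)
  rw [h2] at h
  simp only [mul_zero, sub_zero, ne_eq, OfNat.ofNat_ne_zero, not_false_eq_true, zero_pow, add_zero,
    Complex.one_cpow, smul_eq_mul, mul_one] at h
  rw [bb, ← h]
  refine circleIntegral.integral_congr hR.le fun ζ hζ => ?_
  have hz : ζ ≠ 0 := by rintro rfl; simp at hζ; linarith
  simp only [EE_inv, ← mul_assoc]
  congr 1
  rw [inv_inv]
  simp
  field_simp

lemma bb_int {t r R : ℝ} (a : ℂ) (htr : |t| ≤ r) (hrR : r < R) (m : ℤ) :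
    CircleIntegrable (fun ζ => ζ ^ m * EE t r ζ ^ a) 0 R := by
  have hr : 0 ≤ r := (abs_nonneg t).trans htr
  have hR : 0 < R := by linarith
  apply ContinuousOn.circleIntegrable hR.le
  intro ζ hζ
  have hζ' : ‖ζ‖ = R := by simpa using hζ
  have hz : ζ ≠ 0 := by rintro rfl; simp at hζ; linarith
  apply ContinuousAt.continuousWithinAt
  apply ContinuousAt.mul
  · exact continuousAt_zpow₀ _ _ (Or.inl hz)
  · apply ContinuousAt.cpow _ continuousAt_const (EE_slit htr hrR hζ')
    unfold EE
    fun_prop (disch := simp [hz])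

lemma bb_rec {t r R : ℝ} (n : ℕ) (htr : |t| ≤ r) (hrR : r < R) (k : ℕ) :
    ((k : ℂ) + 1) * bb n t r R (k + 2) = (2 * k + n : ℂ) * t * bb n t r R (k + 1)
      - (k + n - 1 : ℂ) * (r : ℂ) ^ 2 * bb n t r R k := by
  have hr : 0 ≤ r := (abs_nonneg t).trans htr
  have hR : 0 < R := by linarith
  have h0 : (∮ ζ in C(0, R), (((k : ℂ) + 1) * (ζ ^ (((k + 2 : ℕ) : ℤ) - 2) * EE t r ζ ^ (-((n : ℂ) / 2)))
      - ((2 * k + n : ℂ) * t) * (ζ ^ (((k + 1 : ℕ) : ℤ) - 2) * EE t r ζ ^ (-((n : ℂ) / 2)))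
      + ((k + n - 1 : ℂ) * (r : ℂ) ^ 2) * (ζ ^ ((k : ℤ) - 2) * EE t r ζ ^ (-((n : ℂ) / 2))))) = 0 := by
    apply circleIntegral.integral_eq_zero_of_hasDerivWithinAt (f := fun ζ => ζ ^ (k + 1) * EE t r ζ ^ (-((n : ℂ) / 2) + 1)) hR.le
    intro ζ hζ
    have hζ' : ‖ζ‖ = R := by simpa using hζ
    have hz : ζ ≠ 0 := by rintro rfl; simp at hζ; linarith
    have hsl := EE_slit htr hrR hζ'
    have hE : HasDerivAt (EE t r) (2 * t / ζ ^ 2 - 2 * (r : ℂ) ^ 2 / ζ ^ 3) ζ := by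
      have h1 := ((hasDerivAt_inv hz).const_mul (2 * (t : ℂ))).const_sub 1
      have h2 := (((hasDerivAt_inv hz).pow 2).const_mul ((r : ℂ) ^ 2))
      have h3 := h1.add h2
      have h4 : HasDerivAt (EE t r) _ ζ := h3.congr_of_eventuallyEq (Filter.Eventually.of_forall fun z => by
        simp [EE_inv])
      refine h4.congr_deriv ?_
      simp
      field_simp
      try ring
    have hF := (hasDerivAt_pow (k + 1) ζ).mul (hE.cpow_const (c := -((n : ℂ) / 2) + 1) hsl)
    refine (hF.congr_deriv ?_).hasDerivWithinAt
    rw [add_sub_cancel_right, Complex.cpow_add _ _ (Complex.slitPlane_ne_zero hsl), Complex.cpow_one]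
    set W := EE t r ζ ^ (-((n : ℂ) / 2)) with hW
    have z1 : ζ ^ (((k + 2 : ℕ) : ℤ) - 2) = ζ ^ k := by
      rw [show (((k + 2 : ℕ) : ℤ) - 2) = (k : ℤ) by push_cast; ring, zpow_natCast]
    have z2 : ζ ^ (((k + 1 : ℕ) : ℤ) - 2) = ζ ^ k * ζ⁻¹ := by
      rw [show (((k + 1 : ℕ) : ℤ) - 2) = (k : ℤ) - 1 by push_cast; ring, zpow_sub_one₀ hz, zpow_natCast]
    have z3 : ζ ^ ((k : ℤ) - 2) = ζ ^ k * (ζ ^ 2)⁻¹ := by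
      rw [zpow_sub₀ hz, zpow_natCast]; rfl
    rw [z1, z2, z3]
    simp only [EE, add_tsub_cancel_right, Nat.cast_add, Nat.cast_one]
    field_simp
    ring
  have i1 := bb_int (-((n : ℂ) / 2)) htr hrR (((k + 2 : ℕ) : ℤ) - 2)
  have i2 := bb_int (-((n : ℂ) / 2)) htr hrR (((k + 1 : ℕ) : ℤ) - 2)
  have i3 := bb_int (-((n : ℂ) / 2)) htr hrR ((k : ℤ) - 2)
  rw [circleIntegral.integral_add, circleIntegral.integral_sub, circleIntegral.integral_const_mul,
    circleIntegral.integral_const_mul, circleIntegral.integral_const_mul] at h0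
  · simp only [bb]
    linear_combination h0
  · exact i1.const_smul (a := (k : ℂ) + 1)
  · exact i2.const_smul (a := (2 * k + n : ℂ) * t)
  · exact (i1.const_smul (a := (k : ℂ) + 1)).sub (i2.const_smul (a := (2 * k + n : ℂ) * t))
  · exact i3.const_smul (a := (k + n - 1 : ℂ) * (r : ℂ) ^ 2)

lemma evalR_uu {n : ℕ} (x θ : En n) : evalR (uu x) θ = ((inner ℝ θ x : ℝ) : ℂ) := by
  simp [evalR, uu, PiLp.inner_apply]

lemma rr_eq {n : ℕ} (x : En n) : rr x = (‖x‖ : ℂ) ^ 2 := by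
  rw [rr]
  norm_cast
  rw [EuclideanSpace.real_norm_sq_eq]

lemma bb_gg {n : ℕ} (x θ : En n) (hθ : ‖θ‖ = 1) {R : ℝ} (hx : ‖x‖ < R) (j : ℕ) :
    bb n (inner ℝ θ x) ‖x‖ R j = 2 * Real.pi * Complex.I * evalR (gg x j) θ := by
  have htr : |inner ℝ θ x| ≤ ‖x‖ := by
    have := abs_real_inner_le_norm θ x
    rwa [hθ, one_mul] at this
  induction j using Nat.strong_induction_on with
  | _ j ih =>
  match j with
  | 0 => rw [bb_zero n htr hx]; simp [gg, evalR]
  | 1 => rw [bb_one n htr hx]; simp [gg, evalR]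
  | k + 2 =>
    have h1 := bb_rec n htr hx k
    rw [ih (k + 1) (by omega), ih k (by omega)] at h1
    have h2 := congrArg (fun p => evalR p θ) (gg_rec x k)
    have h3 := evalR_qq hθ
    have h4 := evalR_uu x θ
    simp only [evalR, map_mul, map_sub, eval_C] at h2 h3 h4
    rw [h3, h4, rr_eq] at h2
    have hk : (k : ℂ) + 1 ≠ 0 := by exact_mod_cast Nat.succ_ne_zero k
    apply mul_left_cancel₀ hk
    rw [h1]
    simp only [evalR]
    linear_combination (-2 * Real.pi * Complex.I) * h2

/-- the kernel -/
def Kn (n : ℕ) (ζ : ℂ) (θ x : En n) : ℂ := ζ ^ (n - 1) / rPow n ζ θ x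

lemma Kn_eq {n : ℕ} (hn : 2 ≤ n) {ζ : ℂ} (hz : ζ ≠ 0) (θ x : En n) :
    Kn n ζ θ x = ζ⁻¹ * EE (inner ℝ θ x) ‖x‖ ζ ^ (-((n : ℂ) / 2)) := by
  obtain ⟨k, rfl⟩ : ∃ k, n = k + 1 := ⟨n - 1, by omega⟩
  rw [Kn, rPow, Complex.cpow_neg, EE, add_tsub_cancel_right, pow_succ, ← div_eq_mul_inv, mul_assoc, ← div_div,
    div_self (pow_ne_zero _ hz), div_mul_eq_div_div, one_div]

lemma point {n : ℕ} (hn : 2 ≤ n) (x θ : En n) (hθ : ‖θ‖ = 1) {R : ℝ} (hx : ‖x‖ < R)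
    (f : MvPolynomial (Fin n) ℂ) :
    CircleIntegrable (fun ζ => evalC f ζ θ * Kn n ζ θ x) 0 R ∧ 
    (∮ ζ in C(0, R), evalC f ζ θ * Kn n ζ θ x) = 2 * Real.pi * Complex.I * evalR (Psi x f) θ := by
  have htr : |inner ℝ θ x| ≤ ‖x‖ := by
    have := abs_real_inner_le_norm θ x
    rwa [hθ, one_mul] at this
  have hR : 0 < R := (norm_nonneg x).trans_lt hx
  induction f using MvPolynomial.induction_on' with
  | monomial α c =>
    have hom : (monomial α c).IsHomogeneous α.degree := isHomogeneous_monomial c rfl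
    have hc : ∀ ζ ∈ sphere (0:ℂ) R, evalC (monomial α c) ζ θ * Kn n ζ θ x =
      evalR (monomial α c) θ * (ζ ^ (((α.degree + 1 : ℕ) : ℤ) - 2) * EE (inner ℝ θ x) ‖x‖ ζ ^ (-((n : ℂ) / 2))) := by
      intro ζ hζ
      have hz : ζ ≠ 0 := by rintro rfl; simp at hζ; linarith
      rw [evalC_hom hom, Kn_eq hn hz]
      rw [show (((α.degree + 1 : ℕ) : ℤ) - 2) = (α.degree : ℤ) - 1 by push_cast; ring, zpow_sub_one₀ hz, zpow_natCast]
      ring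
    constructor
    · have := (bb_int (-((n : ℂ) / 2)) htr hx (((α.degree + 1 : ℕ) : ℤ) - 2)).const_smul (a := evalR (monomial α c) θ)
      refine (circleIntegrable_congr ?_).mpr this
      intro ζ hζ
      rw [abs_of_pos hR] at hζ
      exact hc ζ hζ
    · rw [circleIntegral.integral_congr hR.le hc, circleIntegral.integral_const_mul]
      have := bb_gg x θ hθ hx (α.degree + 1)
      rw [bb] at this
      rw [this, Psi_mon]
      simp only [evalR, map_mul]
      ring
  | add p q hp hq =>
    have e : ∀ ζ, evalC (p + q) ζ θ * Kn n ζ θ x = evalC p ζ θ * Kn n ζ θ x + evalC q ζ θ * Kn n ζ θ x := by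
      intro ζ; simp only [evalC, map_add, add_mul]
    simp only [e]
    refine ⟨hp.1.add hq.1, ?_⟩
    rw [circleIntegral.integral_add hp.1 hq.1, hp.2, hq.2, map_add]
    simp only [evalR, map_add, mul_add]

end SK

namespace SK

/-- the full integrand -/
def FF {n : ℕ} (P h : MvPolynomial (Fin n) ℂ) (R : ℝ) (t : ℝ) (θ x : En n) : ℂ :=
  deriv (circleMap 0 R) t * (evalC h (circleMap 0 R t) θ *
    ((evalC P (circleMap 0 R t) θ - evalR P x) * circleMap 0 R t ^ (n - 1) / rPow n (circleMap 0 R t) θ x))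

lemma FF_cont {n : ℕ} (P h : MvPolynomial (Fin n) ℂ) {R R₁ : ℝ} (hR : R < R₁) (hR₁ : 0 < R₁) :
    ContinuousOn (fun z : (ℝ × sphere (0 : En n) 1) × En n => FF P h R₁ z.1.1 z.1.2 z.2)
      ((Set.Icc 0 (2 * Real.pi) ×ˢ Set.univ) ×ˢ closedBall 0 R) := by
  rintro z ⟨-, hz⟩
  apply ContinuousAt.continuousWithinAt
  have hx : ‖z.2‖ < R₁ := by
    have : ‖z.2‖ ≤ R := by simpa using hz
    linarith
  have hθ : ‖(z.1.2 : En n)‖ = 1 := by simpa using z.1.2.2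
  have htr : |inner ℝ (z.1.2 : En n) z.2| ≤ ‖z.2‖ := by
    have := abs_real_inner_le_norm (z.1.2 : En n) z.2
    rwa [hθ, one_mul] at this
  have hne : circleMap 0 R₁ z.1.1 ≠ 0 := circleMap_ne_center hR₁.ne'
  have hsl := EE_slit htr hx (ζ := circleMap 0 R₁ z.1.1) (by simp [abs_of_pos hR₁])
  have cc : Continuous (fun z : (ℝ × sphere (0 : En n) 1) × En n => circleMap 0 R₁ z.1.1) :=
    (continuous_circleMap 0 R₁).comp (by fun_prop)
  have ce : ∀ A : MvPolynomial (Fin n) ℂ, Continuous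
      (fun z : (ℝ × sphere (0 : En n) 1) × En n => evalC A (circleMap 0 R₁ z.1.1) (z.1.2 : En n)) := by
    intro A
    unfold evalC
    exact (MvPolynomial.continuous_eval A).comp (by fun_prop)
  have cr : Continuous (fun z : (ℝ × sphere (0 : En n) 1) × En n => evalR P z.2) :=
    (evalR_cont P).comp continuous_snd
  have cE : ContinuousAt (fun z : (ℝ × sphere (0 : En n) 1) × En n =>
      EE (inner ℝ (z.1.2 : En n) z.2) ‖z.2‖ (circleMap 0 R₁ z.1.1)) z := by
    unfold EE
    apply ContinuousAt.add
    · apply ContinuousAt.sub continuousAt_const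
      apply ContinuousAt.div _ cc.continuousAt hne
      have : Continuous (fun z : (ℝ × sphere (0 : En n) 1) × En n => 
        2 * ((inner ℝ (z.1.2 : En n) z.2 : ℝ) : ℂ)) := by fun_prop
      exact this.continuousAt
    · apply ContinuousAt.div _ (cc.pow 2).continuousAt (pow_ne_zero _ hne)
      have : Continuous (fun z : (ℝ × sphere (0 : En n) 1) × En n => (‖z.2‖ : ℂ) ^ 2) := by fun_prop
      exact this.continuousAt
  unfold FF
  simp only [deriv_circleMap]
  apply ContinuousAt.mul (cc.mul continuous_const).continuousAt
  apply ContinuousAt.mul (ce h).continuousAt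
  apply ContinuousAt.div
  · exact (((ce P).sub cr).mul (cc.pow _)).continuousAt
  · unfold rPow
    exact (cc.pow n).continuousAt.mul (cE.cpow continuousAt_const hsl)
  · unfold rPow
    refine mul_ne_zero (pow_ne_zero _ hne) ?_
    have := Complex.slitPlane_ne_zero hsl
    intro h0
    rw [Complex.cpow_eq_zero_iff] at h0
    exact this h0.1

abbrev tau : Measure ℝ := volume.restrict (Set.Ioc 0 (2 * Real.pi))

lemma FF_int {n : ℕ} (P h : MvPolynomial (Fin n) ℂ) {R R₁ : ℝ} (hR : R < R₁) (hR₁ : 0 < R₁)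
    (ν : Measure (En n)) [IsFiniteMeasure ν] (hν : ν (closedBall 0 R)ᶜ = 0) :
    Integrable (fun z : (ℝ × sphere (0 : En n) 1) × En n => FF P h R₁ z.1.1 z.1.2 z.2)
      ((tau.prod (sphereMeasure n)).prod ν) := by
  have e1 : ν.restrict (closedBall 0 R) = ν := Measure.restrict_eq_self_of_ae_mem (by
    rw [ae_iff]; exact hν)
  have e2 : (tau.prod (sphereMeasure n)).prod ν =
      (((volume : Measure ℝ).prod (sphereMeasure n)).prod ν).restrict
        ((Set.Ioc 0 (2 * Real.pi) ×ˢ Set.univ) ×ˢ closedBall 0 R) := by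
    rw [← Measure.prod_restrict, ← Measure.prod_restrict, e1, Measure.restrict_univ]
  rw [e2]
  have hK : IsCompact ((Set.Icc 0 (2 * Real.pi) ×ˢ (Set.univ : Set (sphere (0 : En n) 1))) ×ˢ closedBall (0 : En n) R) :=
    (isCompact_Icc.prod isCompact_univ).prod (isCompact_closedBall _ _)
  have := (FF_cont P h hR hR₁).integrableOn_compact
    (μ := ((volume : Measure ℝ).prod (sphereMeasure n)).prod ν) hK
  exact this.mono_set (Set.prod_mono (Set.prod_mono Set.Ioc_subset_Icc_self subset_rfl) subset_rfl)

lemma FF_zero {n : ℕ} (hn : 2 ≤ n) (P h : MvPolynomial (Fin n) ℂ) {R₁ : ℝ} (hR₁ : 0 < R₁)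
    (x : En n) (hx : ‖x‖ < R₁) :
    ∫ θ : sphere (0 : En n) 1, ∫ t, FF P h R₁ t θ x ∂tau ∂(sphereMeasure n) = 0 := by
  have h1 : ∀ θ : sphere (0 : En n) 1, ∫ t, FF P h R₁ t θ x ∂tau =
      2 * Real.pi * Complex.I * (evalR (Psi x (P * h)) (θ : En n) - evalR P x * evalR (Psi x h) (θ : En n)) := by
    intro θ
    have hθ : ‖(θ : En n)‖ = 1 := by simpa using θ.2
    obtain ⟨i1, v1⟩ := point hn x θ hθ hx (P * h)
    obtain ⟨i2, v2⟩ := point hn x θ hθ hx h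
    rw [← intervalIntegral.integral_of_le (by positivity)]
    have e : (∮ ζ in C(0, R₁), (evalC (P * h) ζ (θ : En n) * Kn n ζ θ x
        - evalR P x * (evalC h ζ (θ : En n) * Kn n ζ θ x))) = ∫ t in (0:ℝ)..(2 * Real.pi), FF P h R₁ t θ x := by
      unfold circleIntegral
      congr 1
      ext t
      simp only [FF, Kn, smul_eq_mul, evalC, map_mul]
      ring
    have i3 : CircleIntegrable (fun ζ => evalR P x * (evalC h ζ (θ : En n) * Kn n ζ θ x)) 0 R₁ :=
      i2.const_smul (a := evalR P x)
    rw [← e, circleIntegral.integral_sub i1 i3,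
      circleIntegral.integral_const_mul, v1, v2]
    ring
  simp only [h1]
  rw [integral_const_mul, integral_sub (evalR_int _) ((evalR_int _).const_mul _), integral_const_mul]
  change _ * (II n (Psi x (P * h)) - evalR P x * II n (Psi x h)) = 0
  rw [J_mul hn, sub_self, mul_zero]

lemma FF_total {n : ℕ} (hn : 2 ≤ n) (P h : MvPolynomial (Fin n) ℂ) {R R₁ : ℝ} (hR : R < R₁) (hR₁ : 0 < R₁)
    (ν : Measure (En n)) [IsFiniteMeasure ν] (hν : ν (closedBall 0 R)ᶜ = 0) :
    Integrable (fun w : ℝ × sphere (0 : En n) 1 => ∫ x, FF P h R₁ w.1 w.2 x ∂ν)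
      (tau.prod (sphereMeasure n)) ∧
    ∫ w : ℝ × sphere (0 : En n) 1, ∫ x, FF P h R₁ w.1 w.2 x ∂ν ∂(tau.prod (sphereMeasure n)) = 0 := by
  have hi := FF_int P h hR hR₁ ν hν
  refine ⟨hi.integral_prod_left, ?_⟩
  rw [integral_integral_swap hi]
  apply integral_eq_zero_of_ae
  have hB : ∀ᵐ x ∂ν, x ∈ closedBall (0 : En n) R := by rw [ae_iff]; exact hν
  filter_upwards [hi.prod_left_ae, hB] with x hx hxB
  rw [integral_prod_symm _ hx]
  apply FF_zero hn P h hR₁ x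
  have : ‖x‖ ≤ R := by simpa using hxB
  linarith

end SK

/-- `(1/(2πi)) ∮_{Γ_{R₁}} ∫_{S^{n-1}} h(ζθ) Q_P(ζ,θ) dθ dζ = 0`
for every polynomial `h`. -/
theorem circleIntegral_secondKind_eq_zero
    (n : ℕ) (hn : 2 ≤ n) (R R₁ : ℝ) (hR₁ : R < R₁)
    (μ : SignedMeasure (En n)) (hμ : SuppIn μ (closedBall (0 : En n) R))
    (P h : MvPolynomial (Fin n) ℂ) :
    (2 * Real.pi * Complex.I)⁻¹ *
      (∮ ζ in C(0, R₁), ∫ θ : sphere (0 : En n) 1,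
        evalC h ζ (θ : En n) * qP μ P ζ (θ : En n) ∂(sphereMeasure n)) = 0 := by
  suffices hmain : (∮ ζ in C(0, R₁), ∫ θ : sphere (0 : En n) 1,
        evalC h ζ (θ : En n) * qP μ P ζ (θ : En n) ∂(sphereMeasure n)) = 0 by
    rw [hmain, mul_zero]
  have hTV : μ.toJordanDecomposition.posPart (closedBall (0 : En n) R)ᶜ = 0 ∧
      μ.toJordanDecomposition.negPart (closedBall (0 : En n) R)ᶜ = 0 := by
    have h0 := hμ
    unfold SuppIn SignedMeasure.totalVariation at h0
    rw [Measure.add_apply] at h0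
    exact add_eq_zero.mp h0
  rcases lt_or_ge R 0 with hneg | hpos
  · have hp : μ.toJordanDecomposition.posPart = 0 := by
      have := hTV.1
      rwa [closedBall_eq_empty.mpr hneg, Set.compl_empty, Measure.measure_univ_eq_zero] at this
    have hm : μ.toJordanDecomposition.negPart = 0 := by
      have := hTV.2
      rwa [closedBall_eq_empty.mpr hneg, Set.compl_empty, Measure.measure_univ_eq_zero] at this
    simp [qP, sInt, hp, hm, circleIntegral]
  · have hR0 : 0 < R₁ := lt_of_le_of_lt hpos hR₁
    obtain ⟨ip, vp⟩ := SK.FF_total hn P h hR₁ hR0 μ.toJordanDecomposition.posPart hTV.1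
    obtain ⟨im, vm⟩ := SK.FF_total hn P h hR₁ hR0 μ.toJordanDecomposition.negPart hTV.2
    have e : ∀ (t : ℝ), deriv (circleMap 0 R₁) t • (∫ θ : sphere (0 : En n) 1,
        evalC h (circleMap 0 R₁ t) (θ : En n) * qP μ P (circleMap 0 R₁ t) (θ : En n) ∂(sphereMeasure n)) =
        ∫ θ : sphere (0 : En n) 1, (omegaN n : ℂ)⁻¹ *
          (∫ x, SK.FF P h R₁ t θ x ∂μ.toJordanDecomposition.posPart
            - ∫ x, SK.FF P h R₁ t θ x ∂μ.toJordanDecomposition.negPart) ∂(sphereMeasure n) := by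
      intro t
      rw [smul_eq_mul, ← integral_const_mul]
      congr 1
      ext θ
      simp only [SK.FF, qP, sInt, integral_const_mul]
      ring
    unfold circleIntegral
    rw [intervalIntegral.integral_of_le (by positivity)]
    simp only [e]
    have hi := (ip.sub im).const_mul ((omegaN n : ℂ)⁻¹)
    have h2 := integral_prod _ hi
    simp only [Pi.sub_apply] at h2
    rw [← h2, integral_const_mul, integral_sub ip im, vp, vm]
    simp
end
end
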